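/- Let c₀ > 0 and let M be a flat flag kernel with respect to the flag F₁. Let K be the tempered distribution on ℝ² defined by ⟨K, φ⟩ = ⟨M, (x,y) ↦ φ(x, y + c₀x²)⟩ (so that formally K(x,y) = M(x, y − c₀x²)), and let m = 𝓕K be the Fourier transform of K. Then m is given by a bounded measurable function on ℝ² which is C^∞ away from the ξ-axis {η = 0}, and there exist constants c > 0 and c' with c₀·c' = π/2, flat flag multipliers L₁ and L₂ with respect to F₁, and a C^∞ function Φ on ℝ² ∖ {(0,0)} supported in the region {(ξ,η) : |ξ| ≥ c|η|^{1/2}}, such that for all (ξ,η) with η ≠ 0 and ξ ≠ 0: m(ξ,η) = L₁(ξ,η) + Φ(ξ,η)·e^{i c' ξ²/η}·(|η|^{1/2}/ξ)·L₂(ξ,η). -/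

import Mathlib

open Real Filter Topology MeasureTheory ENNReal NNReal

noncomputable section

/-- `eI r = exp(i r)`. -/
def eI (r : ℝ) : ℂ := Complex.exp (Complex.I * r)

/-- A normalized bump function on `ℝ`: a `C^∞` function supported in `[-1,1]`
with `|φ| ≤ 1` and `|φ'| ≤ 1`. -/
def IsNormalizedBump (φ : ℝ → ℝ) : Prop :=
  ContDiff ℝ (⊤ : ℕ∞) φ ∧ (∀ t : ℝ, 1 < |t| → φ t = 0) ∧
  (∀ t, |φ t| ≤ 1) ∧ (∀ t, |deriv φ t| ≤ 1)

/-- A Calderón–Zygmund kernel on `ℝ` with constants `(Cd, C)`, given as a tempered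
distribution `u` coinciding away from `0` with the smooth function `k`:
`k` is `C^∞` on `ℝ \ {0}` with `|∂^α k(t)| ≤ Cd α |t|^{-1-α}`, `u` agrees with
integration against `k` on test functions supported away from `0`, and
`|⟨u, φ(δ·)⟩| ≤ C` for every `δ > 0` and every normalized bump function `φ`. -/
def IsCZKernelDist (Cd : ℕ → ℝ) (C : ℝ) (u : SchwartzMap ℝ ℂ →L[ℂ] ℂ) (k : ℝ → ℂ) : Prop :=
  ContDiffOn ℝ (⊤ : ℕ∞) k {t : ℝ | t ≠ 0} ∧
  (∀ (α : ℕ) (t : ℝ), t ≠ 0 → ‖iteratedDeriv α k t‖ ≤ Cd α * |t| ^ (-1 - (α : ℝ))) ∧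
  (∀ ψ : SchwartzMap ℝ ℂ, (0:ℝ) ∉ tsupport (fun t => ψ t) →
    u ψ = ∫ t : ℝ, k t * ψ t) ∧
  (∀ δ : ℝ, 0 < δ → ∀ φ : ℝ → ℝ, IsNormalizedBump φ →
    ∀ ψ : SchwartzMap ℝ ℂ, (∀ t : ℝ, ψ t = (φ (δ * t) : ℂ)) → ‖u ψ‖ ≤ C)

/-- Cancellation conditions for a distribution `M` on `ℝ²`: for every normalized bump
function `φ` and every `R > 0`, the one-dimensional distributions
`g ↦ ⟨M, g(x) φ(Ry)⟩` and `h ↦ ⟨M, φ(Rx) h(y)⟩` are CZ kernels on `ℝ` with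
constants `(Cd, C)`, uniformly in `φ` and `R`. -/
def FlagCancellation (Cd : ℕ → ℝ) (C : ℝ)
    (M : SchwartzMap (ℝ × ℝ) ℂ →L[ℂ] ℂ) : Prop :=
  ∀ φ : ℝ → ℝ, IsNormalizedBump φ → ∀ R : ℝ, 0 < R →
    (∃ (u : SchwartzMap ℝ ℂ →L[ℂ] ℂ) (k : ℝ → ℂ), IsCZKernelDist Cd C u k ∧
      ∀ (g : SchwartzMap ℝ ℂ) (ψ : SchwartzMap (ℝ × ℝ) ℂ),
        (∀ p : ℝ × ℝ, ψ p = g p.1 * (φ (R * p.2) : ℂ)) → u g = M ψ) ∧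
    (∃ (u : SchwartzMap ℝ ℂ →L[ℂ] ℂ) (k : ℝ → ℂ), IsCZKernelDist Cd C u k ∧
      ∀ (g : SchwartzMap ℝ ℂ) (ψ : SchwartzMap (ℝ × ℝ) ℂ),
        (∀ p : ℝ × ℝ, ψ p = (φ (R * p.1) : ℂ) * g p.2) → u g = M ψ)

/-- A flat flag kernel with respect to the flag `F₁ : 0 ⊂ ℝ×{0} ⊂ ℝ²`: a tempered
distribution `M` on `ℝ²` coinciding on `{y ≠ 0}` with a `C^∞` function `F` satisfying
`|∂_x^α ∂_y^β F(x,y)| ≤ Cab α β (|x|+|y|^{1/2})^{-1-α} |y|^{-1-β}`, together with the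
cancellation conditions. -/
def IsFlagKernelF1 (Cab : ℕ → ℕ → ℝ) (Cd : ℕ → ℝ) (C : ℝ)
    (M : SchwartzMap (ℝ × ℝ) ℂ →L[ℂ] ℂ) (F : ℝ → ℝ → ℂ) : Prop :=
  ContDiffOn ℝ (⊤ : ℕ∞) (fun p : ℝ × ℝ => F p.1 p.2) {p : ℝ × ℝ | p.2 ≠ 0} ∧
  (∀ (α β : ℕ) (x y : ℝ), y ≠ 0 →
    ‖iteratedDeriv α (fun x' : ℝ => iteratedDeriv β (fun y' : ℝ => F x' y') y) x‖
      ≤ Cab α β * (|x| + |y| ^ ((1:ℝ)/2)) ^ (-1 - (α : ℝ)) * |y| ^ (-1 - (β : ℝ))) ∧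
  (∀ ψ : SchwartzMap (ℝ × ℝ) ℂ, (∀ p : ℝ × ℝ, p ∈ tsupport (fun q => ψ q) → p.2 ≠ 0) →
    M ψ = ∫ p : ℝ × ℝ, F p.1 p.2 * ψ p) ∧
  FlagCancellation Cd C M

/-- A flat flag kernel with respect to the flag `F₂ : 0 ⊂ {0}×ℝ ⊂ ℝ²`: a tempered
distribution `M` on `ℝ²` coinciding on `{x ≠ 0}` with a `C^∞` function `F` satisfying
`|∂_x^α ∂_y^β F(x,y)| ≤ Cab α β |x|^{-1-α} (x²+|y|)^{-1-β}`, together with the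
cancellation conditions. -/
def IsFlagKernelF2 (Cab : ℕ → ℕ → ℝ) (Cd : ℕ → ℝ) (C : ℝ)
    (M : SchwartzMap (ℝ × ℝ) ℂ →L[ℂ] ℂ) (F : ℝ → ℝ → ℂ) : Prop :=
  ContDiffOn ℝ (⊤ : ℕ∞) (fun p : ℝ × ℝ => F p.1 p.2) {p : ℝ × ℝ | p.1 ≠ 0} ∧
  (∀ (α β : ℕ) (x y : ℝ), x ≠ 0 →
    ‖iteratedDeriv α (fun x' : ℝ => iteratedDeriv β (fun y' : ℝ => F x' y') y) x‖
      ≤ Cab α β * |x| ^ (-1 - (α : ℝ)) * (x ^ 2 + |y|) ^ (-1 - (β : ℝ))) ∧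
  (∀ ψ : SchwartzMap (ℝ × ℝ) ℂ, (∀ p : ℝ × ℝ, p ∈ tsupport (fun q => ψ q) → p.1 ≠ 0) →
    M ψ = ∫ p : ℝ × ℝ, F p.1 p.2 * ψ p) ∧
  FlagCancellation Cd C M

/-- A flat flag multiplier with respect to the flag `F₁`: a bounded function `L` on `ℝ²`,
`C^∞` on `{η ≠ 0}`, such that in parabolic polar coordinates `ξ = aδ`, `η = ±δ²` one has
`|∂_δ^α ∂_a^β L(aδ, ±δ²)| ≤ Cab α β * δ^{-α} (1+|a|)^{-β}` for all `δ > 0`, `a ∈ ℝ`. -/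
def IsFlagMultF1 (B : ℝ) (Cab : ℕ → ℕ → ℝ) (L : ℝ → ℝ → ℂ) : Prop :=
  (∀ ξ η : ℝ, ‖L ξ η‖ ≤ B) ∧
  ContDiffOn ℝ (⊤ : ℕ∞) (fun p : ℝ × ℝ => L p.1 p.2) {p : ℝ × ℝ | p.2 ≠ 0} ∧
  (∀ s : ℝ, s = 1 ∨ s = -1 → ∀ (α β : ℕ) (δ : ℝ), 0 < δ → ∀ a : ℝ,
    ‖iteratedDeriv α
        (fun δ' : ℝ => iteratedDeriv β (fun a' : ℝ => L (a' * δ') (s * δ' ^ 2)) a) δ‖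
      ≤ Cab α β * δ ^ (-(α : ℝ)) * (1 + |a|) ^ (-(β : ℝ)))

/-- Smooth compactly supported complex functions. -/
def TestFn {E : Type*} [NormedAddCommGroup E] [NormedSpace ℝ E] (f : E → ℂ) : Prop :=
  ContDiff ℝ (⊤ : ℕ∞) f ∧ HasCompactSupport f

open Classical in
/-- The pairing of a tempered distribution with a test function, zero on other functions. -/
def ap (M : SchwartzMap (ℝ × ℝ) ℂ →L[ℂ] ℂ) (f : ℝ × ℝ → ℂ) : ℂ :=
  if h : TestFn f then M (h.2.toSchwartzMap h.1) else 0

section TestFn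
variable {E : Type*} [NormedAddCommGroup E] [NormedSpace ℝ E]

lemma TestFn.add {f g : E → ℂ} (hf : TestFn f) (hg : TestFn g) : TestFn (fun x => f x + g x) :=
  ⟨hf.1.add hg.1, hf.2.add hg.2⟩

lemma TestFn.mul_left {f g : E → ℂ} (hf : ContDiff ℝ (⊤ : ℕ∞) f) (hg : TestFn g) :
    TestFn (fun x => f x * g x) :=
  ⟨hf.mul hg.1, hg.2.mul_left⟩

lemma TestFn.mul_right {f g : E → ℂ} (hf : TestFn f) (hg : ContDiff ℝ (⊤ : ℕ∞) g) :
    TestFn (fun x => f x * g x) :=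
  ⟨hf.1.mul hg, hf.2.mul_right⟩

lemma TestFn.smul {f : E → ℂ} (c : ℂ) (hf : TestFn f) : TestFn (fun x => c * f x) :=
  TestFn.mul_left contDiff_const hf

lemma TestFn.sub {f g : E → ℂ} (hf : TestFn f) (hg : TestFn g) : TestFn (fun x => f x - g x) := by
  simpa [sub_eq_add_neg] using hf.add (hg.smul (-1))

end TestFn

section ap
variable (M : SchwartzMap (ℝ × ℝ) ℂ →L[ℂ] ℂ)

lemma ap_of {f : ℝ × ℝ → ℂ} (h : TestFn f) : ap M f = M (h.2.toSchwartzMap h.1) := by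
  simp [ap, h]

lemma ap_coe (ψ : SchwartzMap (ℝ × ℝ) ℂ) (h : HasCompactSupport (fun x => ψ x)) :
    ap M (fun x => ψ x) = M ψ := by
  rw [ap_of M ⟨ψ.smooth _, h⟩]; congr 1

lemma ap_add {f g : ℝ × ℝ → ℂ} (hf : TestFn f) (hg : TestFn g) :
    ap M (fun x => f x + g x) = ap M f + ap M g := by
  rw [ap_of M hf, ap_of M hg, ap_of M (hf.add hg), ← map_add]; congr 1

lemma ap_smul {f : ℝ × ℝ → ℂ} (c : ℂ) (hf : TestFn f) :
    ap M (fun x => c * f x) = c * ap M f := by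
  rw [ap_of M hf, ap_of M (hf.smul c), ← smul_eq_mul, ← map_smul]; congr 1

lemma ap_sub {f g : ℝ × ℝ → ℂ} (hf : TestFn f) (hg : TestFn g) :
    ap M (fun x => f x - g x) = ap M f - ap M g := by
  rw [ap_of M hf, ap_of M hg, ap_of M (hf.sub hg), ← map_sub]; congr 1

lemma ap_zero : ap M (fun _ => 0) = 0 := by
  have h : TestFn (fun _ : ℝ × ℝ => (0 : ℂ)) := ⟨contDiff_const, HasCompactSupport.zero⟩
  have := ap_smul M 0 h
  simpa using this

end ap

/-- Uniform compactness of the supports of a family of functions over bounded sets of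
parameters. -/
def LocSupp {P : Type*} [Norm P] (Ψ : P × (ℝ × ℝ) → ℂ) : Prop :=
  ∀ R : ℝ, ∃ K : Set (ℝ × ℝ), IsCompact K ∧ ∀ p, ‖p‖ ≤ R → ∀ x, x ∉ K → Ψ (p, x) = 0

lemma LocSupp.hasCompactSupport {P : Type*} [Norm P] {Ψ : P × (ℝ × ℝ) → ℂ}
    (h : LocSupp Ψ) (p : P) : HasCompactSupport (fun x => Ψ (p, x)) := by
  obtain ⟨K, hK, h⟩ := h ‖p‖
  exact HasCompactSupport.intro hK (fun x hx => h p le_rfl x hx)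

lemma LocSupp.testFn {P : Type*} [NormedAddCommGroup P] [NormedSpace ℝ P] {Ψ : P × (ℝ × ℝ) → ℂ}
    (h : LocSupp Ψ) (hΨ : ContDiff ℝ (⊤ : ℕ∞) Ψ) (p : P) : TestFn (fun x => Ψ (p, x)) :=
  ⟨hΨ.comp (contDiff_const.prodMk contDiff_id), h.hasCompactSupport p⟩

lemma iteratedFDeriv_slice {P Q : Type*} [NormedAddCommGroup P] [NormedSpace ℝ P]
    [NormedAddCommGroup Q] [NormedSpace ℝ Q] {Ψ : P × Q → ℂ}
    (hΨ : ContDiff ℝ (⊤ : ℕ∞) Ψ) (l : ℕ) (p : P) (x : Q) :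
    iteratedFDeriv ℝ l (fun y => Ψ (p, y)) x =
      (iteratedFDeriv ℝ l Ψ (p, x)).compContinuousLinearMap
        (fun _ => ContinuousLinearMap.inr ℝ P Q) := by
  have h1 : (fun y => Ψ (p, y)) =
      (fun z => Ψ (z + ((p, 0) : P × Q))) ∘ (ContinuousLinearMap.inr ℝ P Q) := by
    ext y; simp
  have h2 : ContDiff ℝ (⊤ : ℕ∞) (fun z => Ψ (z + ((p, 0) : P × Q))) :=
    hΨ.comp (contDiff_id.add contDiff_const)
  rw [h1, ContinuousLinearMap.iteratedFDeriv_comp_right _ h2 x (i := l) (mod_cast le_top),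
    iteratedFDeriv_comp_add_right]
  simp

theorem ap_continuous (M : SchwartzMap (ℝ × ℝ) ℂ →L[ℂ] ℂ) {P : Type*} [NormedAddCommGroup P]
    [NormedSpace ℝ P] {Ψ : P × (ℝ × ℝ) → ℂ} (hΨ : ContDiff ℝ (⊤ : ℕ∞) Ψ) (hs : LocSupp Ψ) :
    Continuous (fun p => ap M (fun x => Ψ (p, x))) := by
  have e : (fun p => ap M (fun x => Ψ (p, x))) = fun p =>
      M ((hs.testFn hΨ p).2.toSchwartzMap (hs.testFn hΨ p).1) := by
    ext p; exact ap_of M (hs.testFn hΨ p)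
  rw [e]
  refine M.continuous.comp (continuous_iff_continuousAt.2 fun p₀ => ?_)
  refine ((schwartz_withSeminorms ℝ (ℝ × ℝ) ℂ).tendsto_nhds _ _).2 ?_
  rintro ⟨k, l⟩ ε hε
  obtain ⟨K, hK, hK0⟩ := hs (‖p₀‖ + 1)
  have hcont : Continuous (fun z : P × (ℝ × ℝ) => ‖z.2‖ ^ k *
      ‖iteratedFDeriv ℝ l (fun y => Ψ (z.1, y)) z.2 -
        iteratedFDeriv ℝ l (fun y => Ψ (p₀, y)) z.2‖) := by
    have hc := hΨ.continuous_iteratedFDeriv (m := l) (mod_cast le_top)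
    have h1 : Continuous (fun z : P × (ℝ × ℝ) => iteratedFDeriv ℝ l (fun y => Ψ (z.1, y)) z.2) := by
      simp_rw [iteratedFDeriv_slice hΨ]
      exact (ContinuousMultilinearMap.compContinuousLinearMapL
        (fun _ : Fin l => ContinuousLinearMap.inr ℝ P (ℝ × ℝ))).continuous.comp hc
    have h2 : Continuous (fun z : P × (ℝ × ℝ) =>
        iteratedFDeriv ℝ l (fun y => Ψ (p₀, y)) z.2) :=
      h1.comp (continuous_const.prodMk continuous_snd)
    exact (continuous_snd.norm.pow k).mul (h1.sub h2).norm
  have hev : ∀ᶠ p in 𝓝 p₀, ∀ x ∈ K, ‖x‖ ^ k *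
      ‖iteratedFDeriv ℝ l (fun y => Ψ (p, y)) x - iteratedFDeriv ℝ l (fun y => Ψ (p₀, y)) x‖
        < ε / 2 := by
    refine hK.eventually_forall_of_forall_eventually fun x _ => ?_
    refine (hcont.tendsto (p₀, x)).eventually (gt_mem_nhds ?_)
    simpa using hε
  have hnear : ∀ᶠ p in 𝓝 p₀, ‖p‖ < ‖p₀‖ + 1 :=
    continuous_norm.continuousAt.eventually (gt_mem_nhds (lt_add_one _))
  filter_upwards [hev, hnear] with p h1 h2
  refine lt_of_le_of_lt (SchwartzMap.seminorm_le_bound ℝ k l _ (half_pos hε).le fun x => ?_)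
    (half_lt_self hε)
  have h3 : iteratedFDeriv ℝ l (⇑((hs.testFn hΨ p).2.toSchwartzMap (hs.testFn hΨ p).1 -
      (hs.testFn hΨ p₀).2.toSchwartzMap (hs.testFn hΨ p₀).1)) x =
      iteratedFDeriv ℝ l (fun y => Ψ (p, y)) x - iteratedFDeriv ℝ l (fun y => Ψ (p₀, y)) x := by
    rw [← iteratedFDeriv_sub_apply]
    · rfl
    · exact (((hs.testFn hΨ p).1.of_le (mod_cast le_top)).contDiffAt)
    · exact (((hs.testFn hΨ p₀).1.of_le (mod_cast le_top)).contDiffAt)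
  rw [h3]
  by_cases hx : x ∈ K
  · exact (h1 x hx).le
  · have hz : ∀ q, (∀ x, x ∉ K → Ψ (q, x) = 0) →
        iteratedFDeriv ℝ l (fun y => Ψ (q, y)) x = 0 := by
      intro q hq
      have : (fun y => Ψ (q, y)) =ᶠ[𝓝 x] fun _ => 0 := by
        filter_upwards [hK.isClosed.isOpen_compl.mem_nhds hx] with y hy using hq y hy
      rw [(Filter.EventuallyEq.iteratedFDeriv ℝ this l).eq_of_nhds]
      simp
    rw [hz p (hK0 p h2.le), hz p₀ (hK0 p₀ (le_add_of_nonneg_right zero_le_one))]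
    simp [half_pos hε |>.le]

theorem contDiff_integral_param {Q : Type*} [NormedAddCommGroup Q] [NormedSpace ℝ Q]
    {Ψ : ℝ × Q → ℂ} (hΨ : ContDiff ℝ (⊤ : ℕ∞) Ψ) :
    ContDiff ℝ (⊤ : ℕ∞) (fun q => ∫ t in (0 : ℝ)..1, Ψ (t, q)) := by
  let χ : ContDiffBump (0 : ℝ) := ⟨1, 2, by norm_num, by norm_num⟩
  have h := contDiffOn_convolution_right_with_param_comp (n := (⊤ : ℕ∞)) (𝕜 := ℝ) (μ := volume)
    (ContinuousLinearMap.mul ℝ ℂ) (s := Set.univ) (v := fun _ : Q => (0 : ℝ)) contDiffOn_const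
    (f := Set.indicator (Set.Ioc 0 1) (fun _ => 1))
    (g := fun q t => ((χ t : ℝ) : ℂ) * Ψ (-t, q)) (k := Metric.closedBall 0 2) isOpen_univ
    (isCompact_closedBall _ _) (fun q t _ ht => by
      rw [χ.zero_of_le_dist]; simp
      simpa using (not_le.1 (fun h => ht (by simpa using h))).le)
    ((integrable_indicator_iff measurableSet_Ioc).2
      (by simp)).locallyIntegrable
    (by
      refine ContDiff.contDiffOn ?_
      have h1 : ContDiff ℝ (⊤ : ℕ∞) (fun z : Q × ℝ => ((χ z.2 : ℝ) : ℂ)) :=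
        Complex.ofRealCLM.contDiff.comp (χ.contDiff.comp contDiff_snd)
      exact h1.mul (hΨ.comp (contDiff_snd.neg.prodMk contDiff_fst)))
  rw [contDiffOn_univ] at h
  convert h using 1
  ext q
  rw [convolution_def, intervalIntegral.integral_of_le zero_le_one,
    ← integral_indicator measurableSet_Ioc]
  refine integral_congr_ae (Eventually.of_forall fun t => ?_)
  by_cases ht : t ∈ Set.Ioc (0 : ℝ) 1
  · simp only [Set.indicator_of_mem ht]
    rw [χ.one_of_mem_closedBall]
    · simp
    · have : |t| ≤ 1 := abs_le.2 ⟨by linarith [ht.1], ht.2⟩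
      simpa [Real.dist_eq] using this
  · simp [Set.indicator_of_notMem ht]

theorem ap_hasDerivAt (M : SchwartzMap (ℝ × ℝ) ℂ →L[ℂ] ℂ) {Ψ Ψ' : ℝ × (ℝ × ℝ) → ℂ}
    (hΨ : ContDiff ℝ (⊤ : ℕ∞) Ψ) (hs : LocSupp Ψ)
    (hd : ∀ t x, HasDerivAt (fun t => Ψ (t, x)) (Ψ' (t, x)) t) (t₀ : ℝ) :
    HasDerivAt (fun t => ap M (fun x => Ψ (t, x))) (ap M (fun x => Ψ' (t₀, x))) t₀ := by
  have hΨ' : ContDiff ℝ (⊤ : ℕ∞) Ψ' := by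
    have e : Ψ' = fun z => fderiv ℝ Ψ z (1, 0) := by
      ext ⟨t, x⟩
      have h1 : HasDerivAt (fun t => Ψ (t, x)) (fderiv ℝ Ψ (t, x) (1, 0)) t :=
        HasFDerivAt.comp_hasDerivAt (f := fun t => (t, x)) t
          (hΨ.differentiable (by simp) (t, x)).hasFDerivAt
          ((hasDerivAt_id t).prodMk (hasDerivAt_const t x))
      exact (hd t x).unique h1
    rw [e]
    exact (hΨ.fderiv_right (by simp)).clm_apply contDiff_const
  have hs' : LocSupp Ψ' := by
    intro R
    obtain ⟨K, hK, h⟩ := hs (R + 1)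
    refine ⟨K, hK, fun t ht x hx => (hd t x).unique ?_⟩
    refine (hasDerivAt_const t (0 : ℂ)).congr_of_eventuallyEq ?_
    have hnear : ∀ᶠ p in 𝓝 t, ‖p‖ < R + 1 :=
      continuous_norm.continuousAt.eventually (gt_mem_nhds (by linarith))
    filter_upwards [hnear] with p hp using h p hp.le x hx
  set H : ℝ × (ℝ × ℝ) → ℂ := fun z => ∫ θ in (0 : ℝ)..1, Ψ' (t₀ + θ * (z.1 - t₀), z.2) with hH
  have hHs : ContDiff ℝ (⊤ : ℕ∞) H := by
    refine contDiff_integral_param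
      (Ψ := fun w : ℝ × (ℝ × (ℝ × ℝ)) => Ψ' (t₀ + w.1 * (w.2.1 - t₀), w.2.2)) (hΨ'.comp ?_)
    fun_prop
  have hHl : LocSupp H := by
    intro R
    obtain ⟨K, hK, h⟩ := hs' (|t₀| + (R + |t₀|))
    refine ⟨K, hK, fun t ht x hx => ?_⟩
    rw [hH]
    refine (intervalIntegral.integral_congr (g := fun _ => 0) fun θ hθ => ?_).trans (by simp)
    rw [Set.uIcc_of_le zero_le_one] at hθ
    refine h _ ?_ x hx
    have h1 : |t - t₀| ≤ R + |t₀| := (abs_sub _ _).trans (by gcongr; exact ht)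
    calc ‖t₀ + θ * (t - t₀)‖ ≤ |t₀| + |θ * (t - t₀)| := abs_add_le _ _
      _ ≤ |t₀| + 1 * (R + |t₀|) := by
          rw [abs_mul]
          gcongr
          exact abs_le.2 ⟨by linarith [hθ.1], hθ.2⟩
      _ = _ := by ring
  have key : ∀ t x, Ψ (t, x) - Ψ (t₀, x) = ((t - t₀ : ℝ) : ℂ) * H (t, x) := by
    intro t x
    have h1 : ∀ θ ∈ Set.uIcc (0 : ℝ) 1, HasDerivAt (fun θ => Ψ (t₀ + θ * (t - t₀), x))
        ((t - t₀) • Ψ' (t₀ + θ * (t - t₀), x)) θ := by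
      intro θ _
      have := HasDerivAt.scomp θ (hd (t₀ + θ * (t - t₀)) x)
        (((hasDerivAt_id θ).mul_const (t - t₀)).const_add t₀)
      simpa [Function.comp_def] using this
    have h2 := intervalIntegral.integral_eq_sub_of_hasDerivAt h1
      (Continuous.intervalIntegrable (by
        have hc := hΨ'.continuous.comp
          (show Continuous fun θ : ℝ => (t₀ + θ * (t - t₀), x) by fun_prop)
        exact hc.const_smul (t - t₀)) _ _)
    rw [intervalIntegral.integral_smul] at h2
    simp only [one_mul, zero_mul, add_zero, add_sub_cancel] at h2
    rw [← h2, hH]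
    simp
  have hslope : ∀ t, t ≠ t₀ → ap M (fun x => H (t, x)) =
      slope (fun t => ap M (fun x => Ψ (t, x))) t₀ t := by
    intro t ht
    have h1 : ((t - t₀ : ℝ) : ℂ) ≠ 0 := by exact_mod_cast sub_ne_zero.2 ht
    rw [slope_def_module, ← ap_sub M (hs.testFn hΨ t) (hs.testFn hΨ t₀)]
    simp_rw [key]
    rw [ap_smul M _ (hHl.testFn hHs t), Complex.real_smul, ← mul_assoc]
    push_cast at h1 ⊢
    rw [inv_mul_cancel₀ h1, one_mul]
  rw [hasDerivAt_iff_tendsto_slope]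
  have hc := (ap_continuous M hHs hHl).tendsto t₀
  have e0 : ap M (fun x => H (t₀, x)) = ap M (fun x => Ψ' (t₀, x)) := by
    simp [hH]
  rw [e0] at hc
  refine (hc.mono_left nhdsWithin_le_nhds).congr' ?_
  filter_upwards [self_mem_nhdsWithin] with t ht using hslope t ht

theorem ap_integral (M : SchwartzMap (ℝ × ℝ) ℂ →L[ℂ] ℂ) {Ψ : ℝ × (ℝ × ℝ) → ℂ}
    (hΨ : TestFn Ψ) : ap M (fun x => ∫ t, Ψ (t, x)) = ∫ t, ap M (fun x => Ψ (t, x)) := by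
  have hc := hΨ.1.continuous
  obtain ⟨R, hR0, hout⟩ : ∃ R : ℝ, 0 ≤ R ∧ ∀ t x, R ≤ ‖t‖ ∨ R < ‖x‖ → Ψ (t, x) = 0 := by
    obtain ⟨R, hR⟩ := hΨ.2.isCompact.isBounded.subset_closedBall 0
    refine ⟨|R| + 1, by positivity, fun t x h => ?_⟩
    refine image_eq_zero_of_notMem_tsupport fun hm => ?_
    have h1 : ‖(t, x)‖ ≤ R := by simpa using hR hm
    rw [Prod.norm_def, max_le_iff] at h1
    have := le_abs_self R
    rcases h with h | h
    · linarith [h1.1]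
    · linarith [h1.2]
  have hs : LocSupp Ψ := fun _ => ⟨Metric.closedBall 0 R, isCompact_closedBall _ _,
    fun t _ x hx => hout t x (Or.inr (by simpa using hx))⟩
  set Θ : ℝ × (ℝ × ℝ) → ℂ := fun z => ((z.1 + R : ℝ) : ℂ) *
    ∫ θ in (0 : ℝ)..1, Ψ (-R + θ * (z.1 + R), z.2) with hΘ
  have hΘ1 : ∀ s x, Θ (s, x) = ∫ t in (-R)..s, Ψ (t, x) := by
    intro s x
    have := intervalIntegral.smul_integral_comp_add_mul (a := 0) (b := 1)
      (f := fun t => Ψ (t, x)) (s + R) (-R)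
    rw [mul_zero, mul_one, add_zero, show -R + (s + R) = s by ring] at this
    rw [← this, hΘ]
    simp [mul_comm]
  have hΘs : ContDiff ℝ (⊤ : ℕ∞) Θ := by
    refine ContDiff.mul (Complex.ofRealCLM.contDiff.comp (contDiff_fst.add contDiff_const)) ?_
    refine contDiff_integral_param
      (Ψ := fun w : ℝ × (ℝ × (ℝ × ℝ)) => Ψ (-R + w.1 * (w.2.1 + R), w.2.2)) (hΨ.1.comp ?_)
    fun_prop
  have hΘl : LocSupp Θ := by
    intro _
    refine ⟨Metric.closedBall 0 R, isCompact_closedBall _ _, fun t _ x hx => ?_⟩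
    rw [hΘ1]
    refine (intervalIntegral.integral_congr (g := fun _ => 0) fun θ _ => ?_).trans (by simp)
    exact hout θ x (Or.inr (by simpa using hx))
  have hd : ∀ s x, HasDerivAt (fun s => Θ (s, x)) (Ψ (s, x)) s := by
    intro s x
    simp_rw [hΘ1]
    have hcx : Continuous fun t => Ψ (t, x) := hc.comp (by fun_prop)
    exact intervalIntegral.integral_hasDerivAt_right (hcx.intervalIntegrable _ _)
      (hcx.stronglyMeasurableAtFilter _ _) hcx.continuousAt
  have hD := ap_hasDerivAt M hΘs hΘl hd
  have h1 := intervalIntegral.integral_eq_sub_of_hasDerivAt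
    (a := -R) (b := R) (fun t _ => hD t)
    ((ap_continuous M hΨ.1 hs).intervalIntegrable _ _)
  have conv : ∀ f : ℝ → ℂ, (∀ t, R ≤ |t| → f t = 0) → ∫ t, f t = ∫ t in (-R)..R, f t := by
    intro f hf
    rw [intervalIntegral.integral_of_le (by linarith),
      setIntegral_eq_integral_of_forall_compl_eq_zero]
    intro t ht
    apply hf
    by_contra hcon
    rw [not_le, abs_lt] at hcon
    exact ht ⟨hcon.1, hcon.2.le⟩
  have e1 : (fun x => Θ (-R, x)) = fun _ => 0 := by
    ext x
    rw [hΘ1, intervalIntegral.integral_same]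
  have e2 : (fun x => Θ (R, x)) = fun x => ∫ t, Ψ (t, x) := by
    ext x
    rw [hΘ1, conv _ fun t ht => hout t x (Or.inl ht)]
  rw [conv _ (fun t ht => ?_), h1, e1, e2, ap_zero, sub_zero]
  simp_rw [fun x => hout t x (Or.inl ht)]
  exact ap_zero M

section eI

lemma norm_eI (r : ℝ) : ‖eI r‖ = 1 := by
  rw [eI, mul_comm]; exact Complex.norm_exp_ofReal_mul_I r

lemma eI_add (r t : ℝ) : eI (r + t) = eI r * eI t := by
  simp [eI, mul_add, Complex.exp_add]

lemma contDiff_eI : ContDiff ℝ (⊤ : ℕ∞) eI := by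
  unfold eI
  have h : ContDiff ℝ (⊤ : ℕ∞) (fun r : ℝ => Complex.I * (r : ℂ)) :=
    contDiff_const.mul Complex.ofRealCLM.contDiff
  exact h.cexp

lemma hasDerivAt_eI (r : ℝ) : HasDerivAt eI (Complex.I * eI r) r := by
  have h : HasDerivAt (fun r : ℝ => Complex.I * (r : ℂ)) (Complex.I * 1) r :=
    (Complex.ofRealCLM.hasDerivAt).const_mul _
  refine h.cexp.congr_deriv ?_
  simp only [eI]; ring

lemma HasDerivAt.eI {f : ℝ → ℝ} {f' x : ℝ} (hf : HasDerivAt f f' x) :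
    HasDerivAt (fun x => _root_.eI (f x)) (f' * (Complex.I * _root_.eI (f x))) x := by
  have := HasDerivAt.scomp x (hasDerivAt_eI (f x)) hf
  simpa [Function.comp_def] using this

lemma ContDiff.eI {E : Type*} [NormedAddCommGroup E] [NormedSpace ℝ E] {f : E → ℝ}
    (hf : ContDiff ℝ (⊤ : ℕ∞) f) : ContDiff ℝ (⊤ : ℕ∞) (fun x => _root_.eI (f x)) :=
  contDiff_eI.comp hf

/-- The character `u ↦ exp(-2 π i a u)`. -/
def ch (a u : ℝ) : ℂ := eI (-2 * π * a * u)

lemma norm_ch (a u : ℝ) : ‖ch a u‖ = 1 := norm_eI _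

lemma hasDerivAt_ch (a u : ℝ) :
    HasDerivAt (ch a) (-(2 * π * a * Complex.I) * ch a u) u := by
  have h : HasDerivAt (fun u : ℝ => -2 * π * a * u) (-2 * π * a * 1) u :=
    (hasDerivAt_id u).const_mul _
  refine h.eI.congr_deriv ?_
  push_cast [ch]; ring

lemma contDiff_ch (a : ℝ) : ContDiff ℝ (⊤ : ℕ∞) (ch a) :=
  ContDiff.eI (by fun_prop)

lemma ch_scale (a u : ℝ) : ch a u = ch 1 (a * u) := by
  simp [ch, mul_assoc]

end eI

section IBP

/-- Integration by parts on the line for compactly supported functions. -/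
lemma integral_deriv_mul_of_compact {q q' e e' : ℝ → ℂ} (hq : ∀ t, HasDerivAt q (q' t) t)
    (hq' : Continuous q') (hc : HasCompactSupport q) (he : ∀ t, HasDerivAt e (e' t) t)
    (he' : Continuous e') : ∫ t, q t * e' t = - ∫ t, q' t * e t := by
  have hqc : Continuous q := continuous_iff_continuousAt.2 fun t => (hq t).continuousAt
  have hec : Continuous e := continuous_iff_continuousAt.2 fun t => (he t).continuousAt
  have e1 : q' = deriv q := funext fun t => (hq t).deriv.symm
  have hc' : HasCompactSupport q' := by rw [e1]; exact hc.deriv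
  exact integral_mul_deriv_eq_deriv_mul_of_integrable (fun t _ => hq t) (fun t _ => he t)
    ((hqc.mul he').integrable_of_hasCompactSupport hc.mul_right)
    ((hq'.mul hec).integrable_of_hasCompactSupport hc'.mul_right)
    ((hqc.mul hec).integrable_of_hasCompactSupport hc.mul_right)

lemma norm_integral_mul_ch_le {q q' : ℝ → ℂ} (hq : ∀ t, HasDerivAt q (q' t) t)
    (hq' : Continuous q') (hc : HasCompactSupport q) {a : ℝ} (ha : a ≠ 0) :
    ‖∫ t, q t * ch a t‖ ≤ 1 / (2 * π * |a|) * ∫ t, ‖q' t‖ := by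
  have h := integral_deriv_mul_of_compact hq hq' hc (fun t => hasDerivAt_ch a t)
    (continuous_const.mul (contDiff_ch a).continuous)
  have h2 : ∫ t, q t * (-(2 * π * a * Complex.I) * ch a t) =
      -(2 * π * a * Complex.I) * ∫ t, q t * ch a t := by
    rw [← integral_const_mul]
    congr 1; ext t; ring
  rw [h2] at h
  have h3 : 2 * π * |a| * ‖∫ t, q t * ch a t‖ = ‖∫ t, q' t * ch a t‖ := by
    have := congrArg norm h
    rw [norm_neg, norm_mul, norm_neg] at this
    rw [← this]
    simp [abs_of_pos Real.pi_pos]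
  have h4 : ‖∫ t, q' t * ch a t‖ ≤ ∫ t, ‖q' t‖ := by
    refine (norm_integral_le_integral_norm _).trans (le_of_eq ?_)
    congr 1; ext t; simp [norm_ch]
  have hpos : 0 < 2 * π * |a| := by positivity
  rw [div_mul_eq_mul_div, one_mul, le_div_iff₀ hpos, mul_comm]
  linarith

/-- The quadratic phase `w ↦ exp(iκw²)`. -/
def Gam (κ w : ℝ) : ℂ := eI (κ * w ^ 2)

lemma norm_Gam (κ w : ℝ) : ‖Gam κ w‖ = 1 := norm_eI _

lemma contDiff_Gam (κ : ℝ) : ContDiff ℝ (⊤ : ℕ∞) (Gam κ) := ContDiff.eI (by fun_prop)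

lemma hasDerivAt_Gam (κ w : ℝ) :
    HasDerivAt (Gam κ) (2 * κ * w * Complex.I * Gam κ w) w := by
  have h : HasDerivAt (fun w : ℝ => κ * w ^ 2) (κ * (2 * w)) w := by
    simpa using (hasDerivAt_pow 2 w).const_mul κ
  refine h.eI.congr_deriv ?_
  push_cast [Gam]; ring

/-- The resolvent symbol `1 / (1 - 2 i κ w²)`. -/
def resP (κ w : ℝ) : ℂ := (1 - 2 * κ * w ^ 2 * Complex.I)⁻¹

lemma resP_den_ne (κ w : ℝ) : (1 - 2 * κ * w ^ 2 * Complex.I : ℂ) ≠ 0 := by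
  intro h
  have := congrArg Complex.re h
  simp [← Complex.ofReal_pow] at this

lemma norm_resP_le (κ w : ℝ) : ‖resP κ w‖ ≤ 1 := by
  rw [resP, norm_inv]
  refine inv_le_one_of_one_le₀ ?_
  have := Complex.abs_re_le_norm (1 - 2 * κ * w ^ 2 * Complex.I : ℂ)
  simpa [← Complex.ofReal_pow] using this

lemma norm_resP_le' {κ : ℝ} (hκ : κ ≠ 0) (w : ℝ) :
    ‖resP κ w‖ ≤ (1 + 1 / |κ|) / (1 + w ^ 2) := by
  have h1 := Complex.abs_re_le_norm (1 - 2 * κ * w ^ 2 * Complex.I : ℂ)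
  have h2 := Complex.abs_im_le_norm (1 - 2 * κ * w ^ 2 * Complex.I : ℂ)
  have hk : 0 < |κ| := abs_pos.2 hκ
  rw [resP, norm_inv]
  set n := ‖(1 - 2 * κ * w ^ 2 * Complex.I : ℂ)‖
  have h1' : 1 ≤ n := by simpa [← Complex.ofReal_pow] using h1
  have h2' : 2 * |κ| * w ^ 2 ≤ n := by
    simpa [← Complex.ofReal_pow, abs_mul] using h2
  rw [inv_eq_one_div, div_le_div_iff₀ (by linarith) (by positivity)]
  have h3 : (1 / |κ|) * (2 * |κ| * w ^ 2) ≤ (1 / |κ|) * n := by gcongr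
  have h4 : (1 / |κ|) * (2 * |κ| * w ^ 2) = 2 * w ^ 2 := by field_simp
  nlinarith [sq_nonneg w]

lemma hasDerivAt_resP_mul (κ w : ℝ) :
    HasDerivAt (fun w : ℝ => resP κ w * w) (2 * resP κ w ^ 2 - resP κ w) w := by
  have h0 : HasDerivAt (fun w : ℝ => (w : ℂ)) 1 w := Complex.ofRealCLM.hasDerivAt
  have h1 : HasDerivAt (fun w : ℝ => (1 - 2 * κ * w ^ 2 * Complex.I : ℂ))
      (-(2 * κ * (2 * w) * Complex.I)) w := by
    have := (((h0.pow 2).const_mul (2 * κ : ℂ)).mul_const Complex.I).const_sub 1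
    simpa using this
  have h2 := (h1.inv (resP_den_ne κ w)).mul h0
  refine h2.congr_deriv ?_
  have := resP_den_ne κ w
  simp only [Pi.inv_apply, resP]
  field_simp
  ring

/-- Non-stationary estimate for integrals against a translated quadratic phase. -/
lemma norm_integral_mul_Gam_le {κ : ℝ} {q q' : ℝ → ℂ}
    (hq : ∀ t, HasDerivAt q (q' t) t) (hq' : Continuous q') (hc : HasCompactSupport q) (v : ℝ) :
    ‖∫ u, q u * Gam κ (u + v)‖ ≤
      ∫ u, (4 * ‖q u‖ * ‖resP κ (u + v)‖ + ‖q' u‖ * (‖resP κ (u + v)‖ * |u + v|)) := by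
  have hqc : Continuous q := continuous_iff_continuousAt.2 fun t => (hq t).continuousAt
  have hPc : Continuous (resP κ) := by
    unfold resP
    exact Continuous.inv₀ (by fun_prop) (resP_den_ne κ)
  have hPv : Continuous fun u => resP κ (u + v) := hPc.comp (by fun_prop)
  have hG : ∀ u, HasDerivAt (fun u => Gam κ (u + v))
      (2 * κ * ((u + v : ℝ) : ℂ) * Complex.I * Gam κ (u + v)) u := fun u =>
    (hasDerivAt_Gam κ (u + v)).comp_add_const u v
  have hGc : Continuous fun u => Gam κ (u + v) := (contDiff_Gam κ).continuous.comp (by fun_prop)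
  have hQ : ∀ u, HasDerivAt (fun u => q u * (resP κ (u + v) * ((u + v : ℝ) : ℂ)))
      (q' u * (resP κ (u + v) * ((u + v : ℝ) : ℂ)) +
        q u * (2 * resP κ (u + v) ^ 2 - resP κ (u + v))) u := fun u =>
    (hq u).mul ((hasDerivAt_resP_mul κ (u + v)).comp_add_const u v)
  have e1 : q' = deriv q := funext fun t => (hq t).deriv.symm
  have hc' : HasCompactSupport q' := by rw [e1]; exact hc.deriv
  have h := integral_deriv_mul_of_compact hQ (by fun_prop) hc.mul_right hG (by fun_prop)
  have key : ∫ u, q u * Gam κ (u + v) =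
      ∫ u, (q u * (2 * resP κ (u + v) ^ 2) + q' u * (resP κ (u + v) * ((u + v : ℝ) : ℂ)))
        * Gam κ (u + v) := by
    have e : ∀ u, q u * Gam κ (u + v) = q u * resP κ (u + v) * Gam κ (u + v) -
        q u * (resP κ (u + v) * ((u + v : ℝ) : ℂ)) *
          (2 * κ * ((u + v : ℝ) : ℂ) * Complex.I * Gam κ (u + v)) := by
      intro u
      have := resP_den_ne κ (u + v)
      unfold resP
      field_simp
    simp_rw [e]
    rw [integral_sub, h, sub_neg_eq_add, ← integral_add]
    · congr 1; ext u; ring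
    · exact Continuous.integrable_of_hasCompactSupport (by fun_prop) hc.mul_right.mul_right
    · exact Continuous.integrable_of_hasCompactSupport (by fun_prop)
        (hc'.mul_right.add hc.mul_right).mul_right
    · exact Continuous.integrable_of_hasCompactSupport (by fun_prop) hc.mul_right.mul_right
    · exact Continuous.integrable_of_hasCompactSupport (by fun_prop) hc.mul_right.mul_right
  rw [key]
  refine norm_integral_le_of_norm_le ?_ (Eventually.of_forall fun u => ?_)
  · refine Integrable.add ?_ ?_
    · exact Continuous.integrable_of_hasCompactSupport (by fun_prop)
        (hc.norm.mul_left (f := fun _ => (4 : ℝ))).mul_right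
    · exact Continuous.integrable_of_hasCompactSupport (by fun_prop) hc'.norm.mul_right
  · rw [norm_mul, norm_Gam, mul_one]
    refine (norm_add_le _ _).trans ?_
    have hP := norm_resP_le κ (u + v)
    have h0 := norm_nonneg (resP κ (u + v))
    have : ‖resP κ (u + v)‖ ^ 2 ≤ ‖resP κ (u + v)‖ := by nlinarith
    rw [norm_mul, norm_mul, norm_mul, norm_mul, norm_pow, Complex.norm_real, Real.norm_eq_abs]
    have h5 : ‖(2 : ℂ)‖ = 2 := by simp
    rw [h5]
    have := norm_nonneg (q u)
    have h6 : ‖q u‖ * ‖resP κ (u + v)‖ ^ 2 ≤ ‖q u‖ * ‖resP κ (u + v)‖ := by gcongr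
    have h7 : 0 ≤ ‖q u‖ * ‖resP κ (u + v)‖ := by positivity
    linarith

end IBP

section CB

/-- Smooth functions with derivatives up to order `N` bounded by `D`. -/
structure CB (N : ℕ) (D : ℝ) (h : ℝ → ℂ) : Prop where
  smooth : ContDiff ℝ (⊤ : ℕ∞) h
  bd : ∀ j ≤ N, ∀ t, ‖iteratedDeriv j h t‖ ≤ D

/-- Smooth functions supported in `[-1,1]` with derivatives up to order `N` bounded by `B`. -/
structure CN (N : ℕ) (B : ℝ) (f : ℝ → ℂ) : Prop extends CB N B f where
  supp : ∀ t, 1 < |t| → f t = 0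

lemma CB.nonneg {N : ℕ} {D : ℝ} {h : ℝ → ℂ} (H : CB N D h) : 0 ≤ D :=
  (norm_nonneg _).trans (H.bd 0 (Nat.zero_le _) 0)

lemma CB.norm_le {N : ℕ} {D : ℝ} {h : ℝ → ℂ} (H : CB N D h) (t : ℝ) : ‖h t‖ ≤ D := by
  simpa using H.bd 0 (Nat.zero_le _) t

lemma CB.norm_deriv_le {N : ℕ} {D : ℝ} {h : ℝ → ℂ} (H : CB (N + 1) D h) (t : ℝ) :
    ‖deriv h t‖ ≤ D := by
  simpa using H.bd 1 (by omega) t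

lemma CB.hasDerivAt {N : ℕ} {D : ℝ} {h : ℝ → ℂ} (H : CB N D h) (t : ℝ) :
    HasDerivAt h (deriv h t) t :=
  (H.smooth.differentiable (by simp) t).hasDerivAt

lemma CB.mono {N N' : ℕ} {D D' : ℝ} {h : ℝ → ℂ} (H : CB N D h) (hN : N' ≤ N) (hD : D ≤ D') :
    CB N' D' h := ⟨H.smooth, fun j hj t => (H.bd j (hj.trans hN) t).trans hD⟩

lemma CN.mono {N N' : ℕ} {D D' : ℝ} {h : ℝ → ℂ} (H : CN N D h) (hN : N' ≤ N) (hD : D ≤ D') :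
    CN N' D' h := ⟨H.toCB.mono hN hD, H.supp⟩

lemma CN.testFn {N : ℕ} {D : ℝ} {h : ℝ → ℂ} (H : CN N D h) : TestFn h :=
  ⟨H.smooth, HasCompactSupport.intro (isCompact_Icc (a := -1) (b := 1)) fun t ht =>
    H.supp t (by by_contra hc; exact ht (abs_le.1 (not_lt.1 hc)))⟩

lemma CB.mul {N : ℕ} {B D : ℝ} {f h : ℝ → ℂ} (F : CB N B f) (H : CB N D h) :
    CB N (2 ^ N * (B * D)) (fun t => f t * h t) := by
  refine ⟨F.smooth.mul H.smooth, fun j hj t => ?_⟩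
  have hB := F.nonneg
  have hD := H.nonneg
  rw [← norm_iteratedFDeriv_eq_norm_iteratedDeriv]
  refine (norm_iteratedFDeriv_mul_le F.smooth H.smooth t (n := j)
    (mod_cast le_top)).trans ?_
  calc _ ≤ ∑ i ∈ Finset.range (j + 1), (j.choose i : ℝ) * (B * D) := by
        refine Finset.sum_le_sum fun i hi => ?_
        rw [mul_assoc, norm_iteratedFDeriv_eq_norm_iteratedDeriv,
          norm_iteratedFDeriv_eq_norm_iteratedDeriv]
        have hi' := Finset.mem_range.1 hi
        gcongr
        · exact F.bd i (by omega) t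
        · exact H.bd _ (by omega) t
    _ = 2 ^ j * (B * D) := by
        rw [← Finset.sum_mul]
        congr 1
        exact_mod_cast Nat.sum_range_choose j
    _ ≤ _ := by gcongr; norm_num

lemma CN.mul {N : ℕ} {B D : ℝ} {f h : ℝ → ℂ} (F : CN N B f) (H : CB N D h) :
    CN N (2 ^ N * (B * D)) (fun t => f t * h t) :=
  ⟨F.toCB.mul H, fun t ht => by simp [F.supp t ht]⟩

lemma CB.scale {N : ℕ} {D : ℝ} {h : ℝ → ℂ} (H : CB N D h) {l : ℝ} (hl : |l| ≤ 1) :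
    CB N D (fun t => h (l * t)) := by
  refine ⟨H.smooth.comp (by fun_prop), fun j hj t => ?_⟩
  have h1 := iteratedDeriv_comp_const_smul (n := j) (H.smooth.of_le (mod_cast le_top)) l
  rw [h1]
  simp only [norm_smul, norm_pow, Real.norm_eq_abs]
  calc |l| ^ j * ‖iteratedDeriv j h (l * t)‖ ≤ 1 * D := by
        gcongr
        · exact pow_le_one₀ (abs_nonneg _) hl
        · exact H.bd j hj _
    _ = D := one_mul D

lemma CB.smul {N : ℕ} {D : ℝ} {h : ℝ → ℂ} (H : CB N D h) (c : ℂ) :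
    CB N (‖c‖ * D) (fun t => c * h t) := by
  refine ⟨contDiff_const.mul H.smooth, fun j hj t => ?_⟩
  rw [iteratedDeriv_const_mul_field, norm_mul]
  gcongr
  exact H.bd j hj t

lemma CN.smul {N : ℕ} {D : ℝ} {h : ℝ → ℂ} (H : CN N D h) (c : ℂ) :
    CN N (‖c‖ * D) (fun t => c * h t) :=
  ⟨H.toCB.smul c, fun t ht => by simp [H.supp t ht]⟩

lemma CN.normalize {N : ℕ} {D : ℝ} {h : ℝ → ℂ} (H : CN N D h) {D' : ℝ} (hD : D ≤ D')
    (h0 : 0 < D') : CN N 1 (fun t => ((D'⁻¹ : ℝ) : ℂ) * h t) := by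
  refine (H.smul _).mono le_rfl ?_
  rw [Complex.norm_real, norm_inv, Real.norm_of_nonneg h0.le, inv_mul_le_iff₀ h0, mul_one]
  exact hD

lemma TestFn.exists_CB {f : ℝ → ℂ} (h : TestFn f) (N : ℕ) : ∃ D, CB N D f := by
  have h1 : ∀ j, ∃ C, ∀ t, ‖iteratedDeriv j f t‖ ≤ C := by
    intro j
    have hc : Continuous (iteratedDeriv j f) := h.1.continuous_iteratedDeriv j (mod_cast le_top)
    have hs : HasCompactSupport (iteratedDeriv j f) := by
      rw [show iteratedDeriv j f = fun t => iteratedFDeriv ℝ j f t (fun _ => 1) from rfl]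
      exact (h.2.iteratedFDeriv (𝕜 := ℝ) j).comp_left
        (g := fun L : ContinuousMultilinearMap ℝ (fun _ : Fin j => ℝ) ℂ => L fun _ => 1) rfl
    exact hc.bounded_above_of_compact_support hs
  choose C hC using h1
  refine ⟨∑ j ∈ Finset.range (N + 1), |C j|, h.1, fun j hj t => (hC j t).trans ?_⟩
  exact (le_abs_self _).trans (Finset.single_le_sum (f := fun j => |C j|)
    (fun _ _ => abs_nonneg _) (Finset.mem_range.2 (by omega)))

lemma exists_CN_of_smooth {f : ℝ → ℂ} (h : ContDiff ℝ (⊤ : ℕ∞) f)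
    (hs : ∀ t, 1 < |t| → f t = 0) (N : ℕ) : ∃ D, CN N D f := by
  obtain ⟨D, hD⟩ := TestFn.exists_CB (f := f) ⟨h, HasCompactSupport.intro
    (isCompact_Icc (a := -1) (b := 1)) fun t ht =>
    hs t (by by_contra hc; exact ht (abs_le.1 (not_lt.1 hc)))⟩ N
  exact ⟨D, hD, hs⟩

lemma exists_CB_ch (N : ℕ) : ∃ D, 1 ≤ D ∧ CB N D (ch 1) := by
  have h : ∀ j, iteratedDeriv j (ch 1) = fun u => (-(2 * π * Complex.I)) ^ j * ch 1 u := by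
    intro j
    induction j with
    | zero => simp
    | succ j ih =>
      ext u
      rw [iteratedDeriv_succ, ih]
      rw [((hasDerivAt_ch 1 u).const_mul _).deriv]
      push_cast; ring
  refine ⟨(1 + 2 * π) ^ N, one_le_pow₀ (by linarith [Real.pi_pos]), contDiff_ch 1,
    fun j hj t => ?_⟩
  rw [h]
  simp only [norm_mul, norm_ch, mul_one, norm_pow, norm_neg, Complex.norm_I, Complex.norm_real,
    Complex.norm_ofNat, Real.norm_of_nonneg Real.pi_pos.le]
  calc (2 * π) ^ j ≤ (1 + 2 * π) ^ j := by gcongr; linarith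
    _ ≤ _ := pow_le_pow_right₀ (by linarith [Real.pi_pos]) hj

/-- A fixed bump function on the line, equal to one on `[-1/2, 1/2]`, supported in `[-1,1]`. -/
def cutB : ContDiffBump (0 : ℝ) := ⟨1 / 2, 1, by norm_num, by norm_num⟩

/-- The complex-valued version of the bump `cutB`. -/
def cut (t : ℝ) : ℂ := ((cutB t : ℝ) : ℂ)

lemma contDiff_cut : ContDiff ℝ (⊤ : ℕ∞) cut := Complex.ofRealCLM.contDiff.comp cutB.contDiff

lemma cut_of_le {t : ℝ} (h : |t| ≤ 1 / 2) : cut t = 1 := by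
  rw [cut, cutB.one_of_mem_closedBall (by simpa [Real.dist_eq, cutB] using h)]; simp

lemma cut_of_ge {t : ℝ} (h : 1 ≤ |t|) : cut t = 0 := by
  rw [cut, cutB.zero_of_le_dist (by simpa [Real.dist_eq, cutB] using h)]; simp

lemma norm_cut_le (t : ℝ) : ‖cut t‖ ≤ 1 := by
  rw [cut, Complex.norm_real, Real.norm_of_nonneg cutB.nonneg]; exact cutB.le_one

lemma norm_one_sub_cut_le (t : ℝ) : ‖1 - cut t‖ ≤ 1 := by
  rw [cut, ← Complex.ofReal_one, ← Complex.ofReal_sub, Complex.norm_real,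
    Real.norm_of_nonneg (sub_nonneg.2 cutB.le_one)]
  linarith [cutB.nonneg (x := t)]

lemma testFn_cut : TestFn cut :=
  ⟨contDiff_cut, HasCompactSupport.intro (isCompact_Icc (a := -1) (b := 1)) fun t ht =>
    cut_of_ge (by by_contra hc; exact ht (abs_le.1 (not_le.1 hc).le))⟩

lemma exists_CN_cut (N : ℕ) : ∃ D, 1 ≤ D ∧ CN N D cut := by
  obtain ⟨D, hD⟩ := exists_CN_of_smooth contDiff_cut (fun t ht => cut_of_ge ht.le) N
  refine ⟨max D 1, le_max_right _ _, hD.mono le_rfl (le_max_left _ _)⟩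

end CB

section CZ1

/-- One-dimensional Calderón–Zygmund distributions with kernel constant `A`, whose size on
dilated bumps is controlled at scales at most one. -/
def CZ1 (N : ℕ) (A : ℝ) (T : (ℝ → ℂ) → ℂ) : Prop :=
  (∀ f g, TestFn f → TestFn g → T (fun u => f u + g u) = T f + T g) ∧
  (∀ (c : ℂ) f, TestFn f → T (fun u => c * f u) = c * T f) ∧
  (∀ f r, CN N 1 f → 1 ≤ r → ‖T (fun u => f (r * u))‖ ≤ A) ∧
  ∃ k k' : ℝ → ℂ, (∀ u, u ≠ 0 → HasDerivAt k (k' u) u) ∧ ContinuousOn k' {0}ᶜ ∧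
    (∀ u, u ≠ 0 → ‖k u‖ ≤ A / |u|) ∧ (∀ u, u ≠ 0 → ‖k' u‖ ≤ A / u ^ 2) ∧
    ∀ g, TestFn g → 0 ∉ tsupport g → T g = ∫ u, k u * g u

lemma CZ1.nonneg {N : ℕ} {A : ℝ} {T : (ℝ → ℂ) → ℂ} (h : CZ1 N A T) : 0 ≤ A := by
  have h1 : iteratedDeriv 0 (fun _ : ℝ => (0 : ℂ)) = fun _ => 0 := by simp
  refine (norm_nonneg _).trans (h.2.2.1 (fun _ => 0) 1 ⟨⟨contDiff_const, ?_⟩, fun _ _ => rfl⟩ le_rfl)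
  intro j _ t
  simp

lemma CZ1.norm_scale_le {N : ℕ} {A : ℝ} {T : (ℝ → ℂ) → ℂ} (h : CZ1 N A T) {f : ℝ → ℂ} {D r : ℝ}
    (hf : CN N D f) (hD : 0 < D) (hr : 1 ≤ r) : ‖T (fun u => f (r * u))‖ ≤ D * A := by
  have h1 := h.2.2.1 _ r (hf.normalize le_rfl hD) hr
  have hr0 : r ≠ 0 := by positivity
  have h2 : TestFn (fun u => f (r * u)) := by
    refine ⟨hf.smooth.comp (by fun_prop), ?_⟩
    exact hf.testFn.2.comp_homeomorph (Homeomorph.mulLeft₀ r hr0)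
  rw [h.2.1 _ _ h2, norm_mul, Complex.norm_real, norm_inv, Real.norm_of_nonneg hD.le,
    inv_mul_le_iff₀ hD] at h1
  exact h1

/-- Products of a kernel, smooth off the origin, with functions vanishing near the origin. -/
lemma hasDerivAt_kernel_mul {k k' h h' : ℝ → ℂ} {ε : ℝ} (hε : 0 < ε)
    (hk : ∀ u, u ≠ 0 → HasDerivAt k (k' u) u) (hk' : ContinuousOn k' {0}ᶜ)
    (hh : ∀ u, HasDerivAt h (h' u) u) (hh' : Continuous h') (h0 : ∀ u, |u| < ε → h u = 0) :
    (∀ u, HasDerivAt (fun u => k u * h u) (k' u * h u + k u * h' u) u) ∧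
      Continuous (fun u => k' u * h u + k u * h' u) := by
  have hev : ∀ᶠ u in 𝓝 (0 : ℝ), |u| < ε := by
    have := Metric.ball_mem_nhds (0 : ℝ) hε
    filter_upwards [this] with u hu using by simpa [Real.dist_eq] using hu
  have hz' : ∀ u, |u| < ε → h' u = 0 := by
    intro u hu
    have h1 : h =ᶠ[𝓝 u] fun _ => 0 := by
      have : ∀ᶠ v in 𝓝 u, |v| < ε := continuous_abs.continuousAt.eventually (gt_mem_nhds hu)
      filter_upwards [this] with v hv using h0 v hv
    exact (hh u).unique ((hasDerivAt_const u (0 : ℂ)).congr_of_eventuallyEq h1)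
  have hhc : Continuous h := continuous_iff_continuousAt.2 fun u => (hh u).continuousAt
  constructor
  · intro u
    by_cases hu : u = 0
    · subst hu
      have e : k' 0 * h 0 + k 0 * h' 0 = 0 := by
        rw [h0 0 (by simpa using hε), hz' 0 (by simpa using hε)]; ring
      rw [e]
      refine (hasDerivAt_const (0 : ℝ) (0 : ℂ)).congr_of_eventuallyEq ?_
      filter_upwards [hev] with v hv
      rw [h0 v hv, mul_zero]
    · exact (hk u hu).mul (hh u)
  · refine continuous_iff_continuousAt.2 fun u => ?_
    by_cases hu : u = 0
    · subst hu
      refine (continuousAt_const (y := (0 : ℂ))).congr ?_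
      filter_upwards [hev] with v hv
      rw [h0 v hv, hz' v hv]; ring
    · have h1 : ContinuousAt k' u := hk'.continuousAt (isOpen_compl_singleton.mem_nhds hu)
      exact (h1.mul hhc.continuousAt).add ((hk u hu).continuousAt.mul hh'.continuousAt)

lemma zero_notMem_tsupport {h : ℝ → ℂ} {ε : ℝ} (hε : 0 < ε) (h0 : ∀ u, |u| < ε → h u = 0) :
    (0 : ℝ) ∉ tsupport h := by
  rw [notMem_tsupport_iff_eventuallyEq]
  filter_upwards [Metric.ball_mem_nhds (0 : ℝ) hε] with u hu
  exact h0 u (by simpa [Real.dist_eq] using hu)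

end CZ1

section CZ1bounds

/-- A kernel multiplied by a function that vanishes near the origin. -/
lemma norm_kernel_mul_le {A β : ℝ} {k k' h h' : ℝ → ℂ} {ε : ℝ} (hε : 0 < ε)
    (hA : 0 ≤ A)
    (kb : ∀ u, u ≠ 0 → ‖k u‖ ≤ A / |u|) (kb' : ∀ u, u ≠ 0 → ‖k' u‖ ≤ A / u ^ 2)
    (h0 : ∀ u, |u| < ε → h u = 0) (h0' : ∀ u, |u| < ε → h' u = 0)
    (hb : ∀ u, ‖h u‖ ≤ β) (hb' : ∀ u, ‖h' u‖ * |u| ≤ β) (u : ℝ) :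
    (|u| < ε → ‖k u * h u‖ = 0 ∧ ‖k' u * h u + k u * h' u‖ = 0) ∧
    (ε ≤ |u| → ‖k u * h u‖ ≤ A * β / |u| ∧
      ‖k' u * h u + k u * h' u‖ ≤ 2 * (A * β) / |u| ^ 2) := by
  refine ⟨fun hu => by simp [h0 u hu, h0' u hu], fun hu => ?_⟩
  have hu0 : 0 < |u| := hε.trans_le hu
  have hne : u ≠ 0 := abs_pos.1 hu0
  have h1 : ‖h' u‖ ≤ β / |u| := by rw [le_div_iff₀ hu0]; exact hb' u
  constructor
  · rw [norm_mul]
    calc ‖k u‖ * ‖h u‖ ≤ (A / |u|) * β := by gcongr; exacts [kb u hne, hb u]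
      _ = _ := by ring
  · refine (norm_add_le _ _).trans ?_
    rw [norm_mul, norm_mul]
    calc ‖k' u‖ * ‖h u‖ + ‖k u‖ * ‖h' u‖ ≤ (A / u ^ 2) * β + (A / |u|) * (β / |u|) := by
          gcongr; exacts [kb' u hne, hb u, kb u hne]
      _ = _ := by rw [← sq_abs u]; field_simp; ring

lemma deriv_eq_zero_of_abs_lt {h h' : ℝ → ℂ} {ε : ℝ} (hh : ∀ u, HasDerivAt h (h' u) u)
    (h0 : ∀ u, |u| < ε → h u = 0) (u : ℝ) (hu : |u| < ε) : h' u = 0 := by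
  have h1 : (fun _ : ℝ => (0 : ℂ)) =ᶠ[𝓝 u] h := by
    filter_upwards [continuous_abs.continuousAt.eventually (gt_mem_nhds hu)] with x hx
      using (h0 x hx).symm
  exact (hh u).unique ((hasDerivAt_const u (0 : ℂ)).congr_of_eventuallyEq h1.symm)

lemma integrable_scaled_inv_one_add_sq (c v : ℝ) (hc : c ≠ 0) :
    Integrable (fun u : ℝ => (1 + (c * (u + v)) ^ 2)⁻¹) := by
  have := (integrable_inv_one_add_sq.comp_mul_left' hc).comp_add_right v
  simpa using this

lemma integral_scaled_inv_one_add_sq (c v : ℝ) :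
    ∫ u : ℝ, (1 + (c * (u + v)) ^ 2)⁻¹ = |c|⁻¹ * π := by
  rw [integral_add_right_eq_self (fun u : ℝ => (1 + (c * u) ^ 2)⁻¹) v,
    Measure.integral_comp_mul_left (fun u : ℝ => (1 + u ^ 2)⁻¹) c,
    integral_univ_inv_one_add_sq, abs_inv, smul_eq_mul]

lemma CZ1.norm_far_mul_ch_le {N : ℕ} {A β ε a : ℝ} {T : (ℝ → ℂ) → ℂ} (hT : CZ1 N A T)
    {h : ℝ → ℂ} (hε : 0 < ε) (hh : TestFn h) (h0 : ∀ u, |u| < ε → h u = 0)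
    (hb : ∀ u, ‖h u‖ ≤ β) (hb' : ∀ u, ‖deriv h u‖ * |u| ≤ β) (ha : a ≠ 0) :
    ‖T (fun u => h u * ch a u)‖ ≤ 2 * (A * β) / (|a| * ε) := by
  have hA := hT.nonneg
  have hβ : 0 ≤ β := (norm_nonneg _).trans (hb 0)
  obtain ⟨-, -, -, k, k', kd, kc, kb, kb', hk⟩ := hT
  have hd : ∀ u, HasDerivAt h (deriv h u) u := fun u =>
    (hh.1.differentiable (by simp) u).hasDerivAt
  have hdc : Continuous (deriv h) := hh.1.continuous_deriv (by simp)
  have h0' := deriv_eq_zero_of_abs_lt hd h0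
  obtain ⟨hq, hq'⟩ := hasDerivAt_kernel_mul hε kd kc hd hdc h0
  rw [hk _ (hh.mul_right (contDiff_ch a))
    (zero_notMem_tsupport hε fun u hu => by simp [h0 u hu])]
  have e1 : (fun u => k u * (h u * ch a u)) = fun u => k u * h u * ch a u := by
    ext u; ring
  rw [e1]
  have hcs : HasCompactSupport (fun u => k u * h u) := hh.2.mul_left
  refine (norm_integral_mul_ch_le hq hq' hcs ha).trans ?_
  have hbd : ∫ u, ‖k' u * h u + k u * deriv h u‖ ≤
      ∫ u, 4 * (A * β) / ε ^ 2 * (1 + (ε⁻¹ * (u + 0)) ^ 2)⁻¹ := by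
    refine integral_mono_of_nonneg (Eventually.of_forall fun u => norm_nonneg _)
      ((integrable_scaled_inv_one_add_sq _ 0 (by positivity)).const_mul _)
      (Eventually.of_forall fun u => ?_)
    have hu := norm_kernel_mul_le hε hA kb kb' h0 h0' hb hb' u
    simp only [add_zero]
    rcases lt_or_ge |u| ε with h1 | h1
    · rw [(hu.1 h1).2]; positivity
    · refine (hu.2 h1).2.trans ?_
      have hu0 : 0 < |u| := hε.trans_le h1
      rw [← div_eq_mul_inv, div_div, div_le_div_iff₀ (by positivity) (by positivity), mul_pow,
        inv_pow, ← sq_abs u]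
      have h2 : ε ^ 2 ≤ |u| ^ 2 := by gcongr
      have h3 : ε ^ 2 * (1 + (ε ^ 2)⁻¹ * |u| ^ 2) = ε ^ 2 + |u| ^ 2 := by field_simp
      rw [h3]
      have := mul_nonneg hA hβ
      nlinarith
  rw [integral_const_mul, integral_scaled_inv_one_add_sq] at hbd
  have ha' : 0 < |a| := abs_pos.2 ha
  calc _ ≤ 1 / (2 * π * |a|) * (4 * (A * β) / ε ^ 2 * (|ε⁻¹|⁻¹ * π)) := by gcongr
    _ = _ := by
      have := Real.pi_pos
      rw [abs_of_pos (inv_pos.2 hε), inv_inv]; field_simp; ring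

/-- One-dimensional Calderón–Zygmund kernels have bounded truncated Fourier transforms. -/
lemma CZ1.exists_norm_mul_ch_le (N : ℕ) : ∃ C : ℝ, 0 ≤ C ∧ ∀ (A : ℝ) (T : (ℝ → ℂ) → ℂ), CZ1 N A T →
    ∀ (g : ℝ → ℂ) (a : ℝ), CN (N + 1) 1 g → ‖T (fun u => g u * ch a u)‖ ≤ C * A := by
  obtain ⟨D, hD1, hD⟩ := exists_CB_ch N
  obtain ⟨E, hE1, hE⟩ := exists_CN_cut (N + 1)
  have hE0 : 0 < E := by linarith
  have hD0 : 0 < D := by linarith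
  set D1 : ℝ := 2 ^ N * (E * (2 ^ N * (1 * D))) with hD1'
  have hD10 : 0 < D1 := by positivity
  set D2 : ℝ := 2 ^ N * (1 * D) with hD2'
  have hD20 : 0 < D2 := by positivity
  refine ⟨D2 + D1 + 4 * (1 + E), by positivity, fun A T hT g a hg => ?_⟩
  have hA := hT.nonneg
  have hgN : CN N 1 g := hg.mono (by omega) le_rfl
  rcases le_or_gt |a| 1 with ha | ha
  · have h1 : CN N D2 (fun u => g u * ch a u) := by
      have := hgN.mul (hD.scale ha)
      simpa only [← ch_scale] using this
    have h2 := hT.norm_scale_le h1 hD20 le_rfl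
    simp only [one_mul] at h2
    refine h2.trans ?_
    gcongr
    linarith
  · have ha0 : 0 < |a| := by linarith
    have hane : a ≠ 0 := abs_pos.1 ha0
    have hinv : |(|a|⁻¹)| ≤ 1 := by
      rw [abs_inv, abs_abs]; exact inv_le_one_of_one_le₀ ha.le
    have hinv' : |a * |a|⁻¹| ≤ 1 := by
      rw [abs_mul, abs_inv, abs_abs, mul_inv_cancel₀ ha0.ne']
    have hnear : CN N D1 (fun w => cut w * (g (|a|⁻¹ * w) * ch 1 (a * |a|⁻¹ * w))) :=
      (hE.mono (by omega) le_rfl).mul ((hgN.toCB.scale hinv).mul (hD.scale hinv'))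
    have hn := hT.norm_scale_le hnear hD10 ha.le
    have hcutd : ∀ u, HasDerivAt (fun u => 1 - cut (|a| * u)) (-(|a| * deriv cut (|a| * u))) u := by
      intro u
      have h1 := HasDerivAt.scomp u (hE.toCB.hasDerivAt (|a| * u))
        ((hasDerivAt_id u).const_mul |a|)
      have h2 := h1.const_sub 1
      refine h2.congr_deriv ?_
      simp
    have hfar : TestFn (fun u => g u * (1 - cut (|a| * u))) :=
      hg.testFn.mul_right (contDiff_const.sub (contDiff_cut.comp (by fun_prop)))
    have hder : ∀ u, deriv (fun u => g u * (1 - cut (|a| * u))) u =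
        deriv g u * (1 - cut (|a| * u)) + g u * (-(|a| * deriv cut (|a| * u))) := fun u =>
      ((hg.toCB.hasDerivAt u).mul (hcutd u)).deriv
    have hdc0 : ∀ w, 1 < |w| → deriv cut w = 0 := by
      intro w hw
      have : cut =ᶠ[𝓝 w] fun _ => 0 := by
        filter_upwards [continuous_abs.continuousAt.eventually (lt_mem_nhds hw)] with x hx
          using cut_of_ge hx.le
      rw [this.deriv_eq, deriv_const]
    have hdg0 : ∀ w, 1 < |w| → deriv g w = 0 := by
      intro w hw
      have : g =ᶠ[𝓝 w] fun _ => 0 := by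
        filter_upwards [continuous_abs.continuousAt.eventually (lt_mem_nhds hw)] with x hx
          using hg.supp x hx
      rw [this.deriv_eq, deriv_const]
    have hf := hT.norm_far_mul_ch_le (β := 1 + E) (ε := (2 * |a|)⁻¹) (by positivity) hfar
      (fun u hu => by
        have : |(|a| * u)| ≤ 1 / 2 := by
          rw [abs_mul, abs_abs]
          have := (mul_lt_mul_of_pos_left hu ha0).le
          refine this.trans (le_of_eq ?_)
          field_simp
        simp [cut_of_le this])
      (fun u => by
        rw [norm_mul]
        have := mul_le_mul (hg.toCB.norm_le u) (norm_one_sub_cut_le (|a| * u)) (norm_nonneg _)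
          zero_le_one
        linarith)
      (fun u => by
        rw [hder]
        have h1 : ‖deriv g u‖ * |u| ≤ 1 := by
          rcases le_or_gt |u| 1 with h | h
          · exact mul_le_one₀ (hg.toCB.norm_deriv_le u) (abs_nonneg _) h
          · simp [hdg0 u h]
        have h2 : ‖deriv cut (|a| * u)‖ * (|a| * |u|) ≤ E := by
          rcases le_or_gt |(|a| * u)| 1 with h | h
          · rw [abs_mul, abs_abs] at h
            calc _ ≤ E * 1 := by
                  gcongr
                  exact hE.toCB.norm_deriv_le _
              _ = E := mul_one _
          · rw [hdc0 _ h]; simp; linarith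
        calc _ ≤ (‖deriv g u‖ * ‖1 - cut (|a| * u)‖ +
              ‖g u‖ * (|a| * ‖deriv cut (|a| * u)‖)) * |u| := by
              gcongr
              refine (norm_add_le _ _).trans ?_
              simp
          _ ≤ (‖deriv g u‖ * 1 + 1 * (|a| * ‖deriv cut (|a| * u)‖)) * |u| := by
              gcongr
              · exact norm_one_sub_cut_le _
              · exact hg.toCB.norm_le u
          _ = ‖deriv g u‖ * |u| + ‖deriv cut (|a| * u)‖ * (|a| * |u|) := by ring
          _ ≤ 1 + E := add_le_add h1 h2) hane
    have hsplit : (fun u => g u * ch a u) = fun u =>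
        cut (|a| * u) * (g (|a|⁻¹ * (|a| * u)) * ch 1 (a * |a|⁻¹ * (|a| * u))) +
          g u * (1 - cut (|a| * u)) * ch a u := by
      ext u
      rw [ch_scale a u, inv_mul_cancel_left₀ ha0.ne',
        show a * |a|⁻¹ * (|a| * u) = a * u by field_simp]
      ring
    have htn : TestFn (fun u => cut (|a| * u) * (g (|a|⁻¹ * (|a| * u)) *
        ch 1 (a * |a|⁻¹ * (|a| * u)))) :=
      ⟨hnear.smooth.comp (by fun_prop : ContDiff ℝ (⊤ : ℕ∞) fun u : ℝ => |a| * u),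
        hnear.testFn.2.comp_homeomorph (Homeomorph.mulLeft₀ |a| ha0.ne')⟩
    rw [hsplit, hT.1 _ _ htn (hfar.mul_right (contDiff_ch a))]
    refine (norm_add_le _ _).trans ?_
    have e : 2 * (A * (1 + E)) / (|a| * (2 * |a|)⁻¹) = 4 * (1 + E) * A := by
      field_simp; ring
    rw [e] at hf
    have : 0 ≤ D2 * A := by positivity
    linarith

/-- The oscillatory part: kernels against a chirp. -/
lemma CZ1.exists_norm_mul_Gam_le {κ : ℝ} (hκ : κ ≠ 0) : ∃ C : ℝ, 0 ≤ C ∧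
    ∀ (N : ℕ) (A β ρ : ℝ) (T : (ℝ → ℂ) → ℂ), CZ1 N A T → 1 / 2 ≤ ρ →
    ∀ (b : ℝ → ℂ) (v : ℝ), TestFn b → (∀ u, |u| < ρ → b u = 0) → (∀ u, ‖b u‖ ≤ β) →
      (∀ u, ‖deriv b u‖ * |u| ≤ β) →
      ‖T (fun u => b u * Gam κ (u + v))‖ * (1 + |v| + ρ) ≤ C * (A * β) := by
  set K : ℝ := 1 + 1 / |κ| with hK
  have hκ0 : 0 < |κ| := abs_pos.2 hκ
  have hK0 : 0 < K := by positivity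
  refine ⟨40 * K * (2 * π), by positivity, fun N A β ρ T hT hρ b v hb b0 bb bb' => ?_⟩
  have hA := hT.nonneg
  have hβ : 0 ≤ β := (norm_nonneg _).trans (bb 0)
  have hρ0 : 0 < ρ := by linarith
  obtain ⟨-, -, -, k, k', kd, kc, kb, kb', hk⟩ := hT
  have hd : ∀ u, HasDerivAt b (deriv b u) u := fun u =>
    (hb.1.differentiable (by simp) u).hasDerivAt
  have hdc : Continuous (deriv b) := hb.1.continuous_deriv (by simp)
  have b0' := deriv_eq_zero_of_abs_lt hd b0
  obtain ⟨hq, hq'⟩ := hasDerivAt_kernel_mul hρ0 kd kc hd hdc b0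
  rw [hk _ (hb.mul_right (g := fun u => Gam κ (u + v))
      ((contDiff_Gam κ).comp (by fun_prop : ContDiff ℝ (⊤ : ℕ∞) fun u : ℝ => u + v)))
    (zero_notMem_tsupport hρ0 fun u hu => by simp [b0 u hu])]
  have e1 : (fun u => k u * (b u * Gam κ (u + v))) = fun u => k u * b u * Gam κ (u + v) := by
    ext u; ring
  rw [e1]
  have hX : 0 < 1 + |v| + ρ := by positivity
  refine (mul_le_mul_of_nonneg_right (norm_integral_mul_Gam_le hq hq' hb.2.mul_left v)
    hX.le).trans ?_
  rw [← integral_mul_const]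
  have h_int : ∫ u : ℝ, 40 * K * (A * β) * ((1 + (1 * (u + 0)) ^ 2)⁻¹ + (1 + (1 * (u + v)) ^ 2)⁻¹) =
      40 * K * (2 * π) * (A * β) := by
    rw [integral_const_mul, integral_add (integrable_scaled_inv_one_add_sq 1 0 one_ne_zero)
      (integrable_scaled_inv_one_add_sq 1 v one_ne_zero), integral_scaled_inv_one_add_sq,
      integral_scaled_inv_one_add_sq]
    simp; ring
  rw [← h_int]
  refine integral_mono_of_nonneg (Eventually.of_forall fun u => by positivity)
    (((integrable_scaled_inv_one_add_sq 1 0 one_ne_zero).add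
      (integrable_scaled_inv_one_add_sq 1 v one_ne_zero)).const_mul _)
    (Eventually.of_forall fun u => ?_)
  have hu := norm_kernel_mul_le hρ0 hA kb kb' b0 b0' bb bb' u
  simp only [one_mul, add_zero]
  have hP : 0 < (1 + u ^ 2)⁻¹ := by positivity
  have hQ : 0 < (1 + (u + v) ^ 2)⁻¹ := by positivity
  rcases lt_or_ge |u| ρ with h1 | h1
  · rw [(hu.1 h1).1, (hu.1 h1).2]
    have : 0 ≤ A * β := by positivity
    simp only [mul_zero, zero_mul, add_zero]
    positivity
  · obtain ⟨hu1, hu2⟩ := hu.2 h1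
    set U := |u| with hU
    set W := |u + v| with hW
    have hU0 : 1 / 2 ≤ U := hρ.trans h1
    have hUp : 0 < U := by linarith
    have hW0 : 0 ≤ W := abs_nonneg _
    have hXle : 1 + |v| + ρ ≤ 4 * U + W := by
      have h2 : |v| ≤ W + U := by
        have := abs_sub (u + v) u
        simpa using this
      linarith
    have hr : ‖resP κ (u + v)‖ ≤ K * (1 + (u + v) ^ 2)⁻¹ := by
      have := norm_resP_le' hκ (u + v)
      rwa [div_eq_mul_inv] at this
    set Q := (1 + (u + v) ^ 2)⁻¹ with hQd
    set P := (1 + u ^ 2)⁻¹ with hPd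
    have hQW : Q * (1 + W ^ 2) = 1 := by
      rw [hQd, hW, sq_abs]; exact inv_mul_cancel₀ (by positivity)
    have hPU : (1 / U) ^ 2 ≤ 5 * P := by
      rw [hPd, ← sq_abs u, ← hU, ← div_eq_mul_inv, div_pow, one_pow,
        div_le_div_iff₀ (by positivity) (by positivity)]
      nlinarith
    have hQW2 : Q * W ^ 2 ≤ 1 := by nlinarith
    have hQWQ : (Q * W) ^ 2 ≤ Q := by nlinarith
    set Y := 1 / U with hY
    have hY0 : 0 < Y := by positivity
    have hYU : Y * U = 1 := by rw [hY]; field_simp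
    have hG : 0 ≤ A * β := by positivity
    have hm : Q * W * Y ≤ (Q + 5 * P) / 2 := by nlinarith [sq_nonneg (Q * W - Y)]
    calc (4 * ‖k u * b u‖ * ‖resP κ (u + v)‖ +
          ‖k' u * b u + k u * deriv b u‖ * (‖resP κ (u + v)‖ * W)) * (1 + |v| + ρ)
        ≤ (4 * (A * β / U) * (K * Q) + (2 * (A * β) / U ^ 2) * (K * Q * W)) * (4 * U + W) := by
          gcongr
      _ = K * (A * β) * (4 * Y * Q * (4 * U + W) + 2 * Y ^ 2 * (Q * W) * (4 * U + W)) := by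
          rw [hY]; field_simp
      _ = K * (A * β) * (16 * Q * (Y * U) + 4 * (Q * W * Y) + 8 * (Y * U) * (Q * W * Y) +
            2 * Y ^ 2 * (Q * W ^ 2)) := by ring
      _ ≤ K * (A * β) * (40 * (P + Q)) := by
          refine mul_le_mul_of_nonneg_left ?_ (mul_nonneg hK0.le hG)
          rw [hYU]
          have h3 : Y ^ 2 * (Q * W ^ 2) ≤ Y ^ 2 * 1 :=
            mul_le_mul_of_nonneg_left hQW2 (sq_nonneg Y)
          linarith
      _ = _ := by ring

end CZ1bounds

section FK

/-- The complement of the line `y = 0`. -/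
def offLine : Set (ℝ × ℝ) := {p | p.2 ≠ 0}

lemma isOpen_offLine : IsOpen offLine := isOpen_ne_fun continuous_snd continuous_const

/-- The Euler field `x ∂_x`. -/
def dX (F : ℝ × ℝ → ℂ) (p : ℝ × ℝ) : ℂ := (p.1 : ℂ) * fderiv ℝ F p (1, 0)

/-- The Euler field `y ∂_y`. -/
def dY (F : ℝ × ℝ → ℂ) (p : ℝ × ℝ) : ℂ := (p.2 : ℂ) * fderiv ℝ F p (0, 1)

lemma contDiff_ofReal_comp {E : Type*} [NormedAddCommGroup E] [NormedSpace ℝ E] {f : E → ℝ}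
    (hf : ContDiff ℝ (⊤ : ℕ∞) f) : ContDiff ℝ (⊤ : ℕ∞) (fun x => (f x : ℂ)) :=
  Complex.ofRealCLM.contDiff.comp hf

lemma ContDiffOn.fderiv_vec {F : ℝ × ℝ → ℂ} (h : ContDiffOn ℝ (⊤ : ℕ∞) F offLine) (v : ℝ × ℝ) :
    ContDiffOn ℝ (⊤ : ℕ∞) (fun p => fderiv ℝ F p v) offLine :=
  (h.fderiv_of_isOpen isOpen_offLine (by simp)).clm_apply contDiffOn_const

lemma ContDiffOn.dX {F : ℝ × ℝ → ℂ} (h : ContDiffOn ℝ (⊤ : ℕ∞) F offLine) :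
    ContDiffOn ℝ (⊤ : ℕ∞) (dX F) offLine :=
  (contDiff_ofReal_comp contDiff_fst).contDiffOn.mul (h.fderiv_vec _)

lemma fderiv_congr_offLine {F G : ℝ × ℝ → ℂ} (h : Set.EqOn F G offLine) :
    Set.EqOn (fderiv ℝ F) (fderiv ℝ G) offLine := fun _ hp =>
  (Filter.eventuallyEq_of_mem (isOpen_offLine.mem_nhds hp) h).fderiv_eq

lemma dX_congr {F G : ℝ × ℝ → ℂ} (h : Set.EqOn F G offLine) :
    Set.EqOn (dX F) (dX G) offLine := fun p hp => by
  simp only [dX, fderiv_congr_offLine h hp]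

lemma dY_congr {F G : ℝ × ℝ → ℂ} (h : Set.EqOn F G offLine) :
    Set.EqOn (dY F) (dY G) offLine := fun p hp => by
  simp only [dY, fderiv_congr_offLine h hp]

lemma ContDiffOn.diffAt {F : ℝ × ℝ → ℂ} (h : ContDiffOn ℝ (⊤ : ℕ∞) F offLine) {p : ℝ × ℝ}
    (hp : p ∈ offLine) : DifferentiableAt ℝ F p :=
  (h.contDiffAt (isOpen_offLine.mem_nhds hp)).differentiableAt (by simp)

lemma fderiv_lin {F G : ℝ × ℝ → ℂ} (c d : ℂ) {p : ℝ × ℝ} (hF : DifferentiableAt ℝ F p)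
    (hG : DifferentiableAt ℝ G p) (v : ℝ × ℝ) :
    fderiv ℝ (fun q => c * F q + d * G q) p v = c * fderiv ℝ F p v + d * fderiv ℝ G p v := by
  have h := (hF.hasFDerivAt.const_mul c).add (hG.hasFDerivAt.const_mul d)
  have h2 : fderiv ℝ (fun q => c * F q + d * G q) p = _ := h.fderiv
  rw [h2]; simp

lemma dX_lin {F G : ℝ × ℝ → ℂ} (hF : ContDiffOn ℝ (⊤ : ℕ∞) F offLine)
    (hG : ContDiffOn ℝ (⊤ : ℕ∞) G offLine) (c d : ℂ) :
    Set.EqOn (dX fun q => c * F q + d * G q) (fun q => c * dX F q + d * dX G q) offLine :=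
  fun p hp => by
    simp only [dX, fderiv_lin c d (hF.diffAt hp) (hG.diffAt hp)]; ring

lemma dY_lin {F G : ℝ × ℝ → ℂ} (hF : ContDiffOn ℝ (⊤ : ℕ∞) F offLine)
    (hG : ContDiffOn ℝ (⊤ : ℕ∞) G offLine) (c d : ℂ) :
    Set.EqOn (dY fun q => c * F q + d * G q) (fun q => c * dY F q + d * dY G q) offLine :=
  fun p hp => by
    simp only [dY, fderiv_lin c d (hF.diffAt hp) (hG.diffAt hp)]; ring

/-- The size `1 / ((|x| + |y|^{1/2}) |y|)` of a flag kernel. -/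
def flagW (p : ℝ × ℝ) : ℝ := ((|p.1| + √|p.2|) * |p.2|)⁻¹

/-- Flag kernels away from the line `y = 0`, with `n` Euler derivatives controlled. -/
def FK : ℕ → (ℝ × ℝ → ℂ) → Prop
  | 0, F => ContDiffOn ℝ (⊤ : ℕ∞) F offLine ∧ ∃ C, 0 ≤ C ∧ ∀ p ∈ offLine, ‖F p‖ ≤ C * flagW p
  | n + 1, F => FK n F ∧ FK n (dX F) ∧ FK n (dY F)

lemma FK.base {n : ℕ} {F : ℝ × ℝ → ℂ} (h : FK n F) : FK 0 F := by
  induction n generalizing F with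
  | zero => exact h
  | succ n ih => exact ih h.1

lemma flagW_nonneg (p : ℝ × ℝ) : 0 ≤ flagW p := by unfold flagW; positivity

lemma FK.congr {n : ℕ} {F G : ℝ × ℝ → ℂ} (h : FK n F) (e : Set.EqOn G F offLine) : FK n G := by
  induction n generalizing F G with
  | zero =>
    obtain ⟨h1, C, hC, h2⟩ := h
    exact ⟨h1.congr e, C, hC, fun p hp => by rw [e hp]; exact h2 p hp⟩
  | succ n ih => exact ⟨ih h.1 e, ih h.2.1 (dX_congr e), ih h.2.2 (dY_congr e)⟩

lemma FK.lin {n : ℕ} {F G : ℝ × ℝ → ℂ} (hF : FK n F) (hG : FK n G) (c d : ℂ) :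
    FK n (fun p => c * F p + d * G p) := by
  induction n generalizing F G with
  | zero =>
    obtain ⟨h1, C, hC, h2⟩ := hF
    obtain ⟨k1, D, hD, k2⟩ := hG
    refine ⟨(contDiffOn_const.mul h1).add (contDiffOn_const.mul k1), ‖c‖ * C + ‖d‖ * D,
      by positivity, fun p hp => (norm_add_le _ _).trans ?_⟩
    rw [norm_mul, norm_mul, add_mul, mul_assoc, mul_assoc]
    gcongr
    · exact h2 p hp
    · exact k2 p hp
  | succ n ih =>
    exact ⟨ih hF.1 hG.1, (ih hF.2.1 hG.2.1).congr (dX_lin hF.base.1 hG.base.1 c d),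
      (ih hF.2.2 hG.2.2).congr (dY_lin hF.base.1 hG.base.1 c d)⟩

lemma fderiv_comm_offLine {F : ℝ × ℝ → ℂ} (h : ContDiffOn ℝ (⊤ : ℕ∞) F offLine) (v w : ℝ × ℝ) :
    Set.EqOn (fun p => fderiv ℝ (fun q => fderiv ℝ F q v) p w)
      (fun p => fderiv ℝ (fun q => fderiv ℝ F q w) p v) offLine := by
  intro p hp
  have h1 : ContDiffAt ℝ (⊤ : ℕ∞) F p := h.contDiffAt (isOpen_offLine.mem_nhds hp)
  have h2 := h1.isSymmSndFDerivAt (by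
    simpa using (WithTop.coe_le_coe.2 le_top : ((2 : ℕ∞) : WithTop ℕ∞) ≤ ((⊤ : ℕ∞) : WithTop ℕ∞)))
  have h3 : DifferentiableAt ℝ (fderiv ℝ F) p :=
    (h1.fderiv_right (m := 1) (by norm_cast)).differentiableAt (by simp)
  have h4 : ∀ u : ℝ × ℝ, fderiv ℝ (fun q => fderiv ℝ F q u) p = (fderiv ℝ (fderiv ℝ F) p).flip u := by
    intro u
    have := (h3.hasFDerivAt.clm_apply (hasFDerivAt_const u p)).fderiv
    rw [this]; ext <;> simp
  simp only [h4, ContinuousLinearMap.flip_apply]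
  exact h2 w v

/-- `∂_x^i G`. -/
def pdx (G : ℝ × ℝ → ℂ) (i : ℕ) : ℝ × ℝ → ℂ := (fun G p => fderiv ℝ G p (1, 0))^[i] G

/-- `∂_y^j G`. -/
def pdy (G : ℝ × ℝ → ℂ) (j : ℕ) : ℝ × ℝ → ℂ := (fun G p => fderiv ℝ G p (0, 1))^[j] G

lemma pdx_succ (G : ℝ × ℝ → ℂ) (i : ℕ) : pdx G (i + 1) = fun p => fderiv ℝ (pdx G i) p (1, 0) :=
  Function.iterate_succ_apply' _ _ _

lemma pdy_succ (G : ℝ × ℝ → ℂ) (i : ℕ) : pdy G (i + 1) = fun p => fderiv ℝ (pdy G i) p (0, 1) :=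
  Function.iterate_succ_apply' _ _ _

lemma contDiffOn_pdx {G : ℝ × ℝ → ℂ} (h : ContDiffOn ℝ (⊤ : ℕ∞) G offLine) (i : ℕ) :
    ContDiffOn ℝ (⊤ : ℕ∞) (pdx G i) offLine := by
  induction i with
  | zero => exact h
  | succ i ih => rw [pdx_succ]; exact ih.fderiv_vec _

lemma contDiffOn_pdy {G : ℝ × ℝ → ℂ} (h : ContDiffOn ℝ (⊤ : ℕ∞) G offLine) (i : ℕ) :
    ContDiffOn ℝ (⊤ : ℕ∞) (pdy G i) offLine := by
  induction i with
  | zero => exact h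
  | succ i ih => rw [pdy_succ]; exact ih.fderiv_vec _

lemma fderiv_pdx {G : ℝ × ℝ → ℂ} (h : ContDiffOn ℝ (⊤ : ℕ∞) G offLine) (i : ℕ) :
    Set.EqOn (fun p => fderiv ℝ (pdx G i) p (0, 1)) (pdx (fun p => fderiv ℝ G p (0, 1)) i)
      offLine := by
  induction i with
  | zero => exact fun p _ => rfl
  | succ i ih =>
    rw [pdx_succ, pdx_succ]
    intro p hp
    have h1 := fderiv_comm_offLine (contDiffOn_pdx h i) (1, 0) (0, 1) hp
    have h2 := fderiv_congr_offLine ih hp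
    simp only at h1 ⊢
    rw [h1, h2]

lemma hasDerivAt_slice_fst {G : ℝ × ℝ → ℂ} (h : ContDiffOn ℝ (⊤ : ℕ∞) G offLine) {p : ℝ × ℝ}
    (hp : p ∈ offLine) : HasDerivAt (fun x => G (x, p.2)) (fderiv ℝ G p (1, 0)) p.1 := by
  have h1 := (h.diffAt hp).hasFDerivAt
  have h2 : HasDerivAt (fun x : ℝ => (x, p.2)) ((1 : ℝ), (0 : ℝ)) p.1 :=
    (hasDerivAt_id p.1).prodMk (hasDerivAt_const p.1 p.2)
  exact h1.comp_hasDerivAt p.1 h2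

lemma hasDerivAt_slice_snd {G : ℝ × ℝ → ℂ} (h : ContDiffOn ℝ (⊤ : ℕ∞) G offLine) {p : ℝ × ℝ}
    (hp : p ∈ offLine) : HasDerivAt (fun y => G (p.1, y)) (fderiv ℝ G p (0, 1)) p.2 := by
  have h1 := (h.diffAt hp).hasFDerivAt
  have h2 : HasDerivAt (fun y : ℝ => (p.1, y)) ((0 : ℝ), (1 : ℝ)) p.2 :=
    (hasDerivAt_const p.2 p.1).prodMk (hasDerivAt_id p.2)
  exact h1.comp_hasDerivAt p.2 h2

lemma iteratedDeriv_snd {G : ℝ × ℝ → ℂ} (h : ContDiffOn ℝ (⊤ : ℕ∞) G offLine) (j : ℕ)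
    (x y : ℝ) (hy : y ≠ 0) : iteratedDeriv j (fun y' => G (x, y')) y = pdy G j (x, y) := by
  induction j generalizing y with
  | zero => simp [pdy]
  | succ j ih =>
    rw [iteratedDeriv_succ, pdy_succ]
    have h1 : iteratedDeriv j (fun y' => G (x, y')) =ᶠ[𝓝 y] fun y' => pdy G j (x, y') := by
      filter_upwards [isOpen_ne.mem_nhds hy] with z hz using ih z hz
    rw [h1.deriv_eq]
    exact (hasDerivAt_slice_snd (contDiffOn_pdy h j) (p := (x, y)) hy).deriv

lemma iteratedDeriv_fst {G : ℝ × ℝ → ℂ} (h : ContDiffOn ℝ (⊤ : ℕ∞) G offLine) (i : ℕ)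
    (x y : ℝ) (hy : y ≠ 0) : iteratedDeriv i (fun x' => G (x', y)) x = pdx G i (x, y) := by
  induction i generalizing x with
  | zero => simp [pdx]
  | succ i ih =>
    rw [iteratedDeriv_succ, pdx_succ]
    have h1 : iteratedDeriv i (fun x' => G (x', y)) = fun x' => pdx G i (x', y) := by
      ext x'; exact ih x'
    rw [h1]
    exact (hasDerivAt_slice_fst (contDiffOn_pdx h i) (p := (x, y)) hy).deriv

lemma hasFDerivAt_monomial_mul {G : ℝ × ℝ → ℂ} (i j : ℕ) {p : ℝ × ℝ} (hG : DifferentiableAt ℝ G p) :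
    (p.1 : ℂ) * fderiv ℝ (fun q : ℝ × ℝ => (q.1 : ℂ) ^ i * (q.2 : ℂ) ^ j * G q) p (1, 0) =
      i * ((p.1 : ℂ) ^ i * (p.2 : ℂ) ^ j * G p) +
        (p.1 : ℂ) ^ (i + 1) * (p.2 : ℂ) ^ j * fderiv ℝ G p (1, 0) ∧
    (p.2 : ℂ) * fderiv ℝ (fun q : ℝ × ℝ => (q.1 : ℂ) ^ i * (q.2 : ℂ) ^ j * G q) p (0, 1) =
      j * ((p.1 : ℂ) ^ i * (p.2 : ℂ) ^ j * G p) +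
        (p.1 : ℂ) ^ i * (p.2 : ℂ) ^ (j + 1) * fderiv ℝ G p (0, 1) := by
  have h1 : HasFDerivAt (fun q : ℝ × ℝ => (q.1 : ℂ))
      (Complex.ofRealCLM.comp (ContinuousLinearMap.fst ℝ ℝ ℝ)) p :=
    (Complex.ofRealCLM.comp (ContinuousLinearMap.fst ℝ ℝ ℝ)).hasFDerivAt
  have h2 : HasFDerivAt (fun q : ℝ × ℝ => (q.2 : ℂ))
      (Complex.ofRealCLM.comp (ContinuousLinearMap.snd ℝ ℝ ℝ)) p :=
    (Complex.ofRealCLM.comp (ContinuousLinearMap.snd ℝ ℝ ℝ)).hasFDerivAt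
  have h3 := ((h1.pow i).mul (h2.pow j)).mul hG.hasFDerivAt
  have h4 : fderiv ℝ (fun q : ℝ × ℝ => (q.1 : ℂ) ^ i * (q.2 : ℂ) ^ j * G q) p = _ := h3.fderiv
  rw [h4]
  constructor
  · cases i with
    | zero => simp; ring
    | succ i => simp; ring
  · cases j with
    | zero => simp; ring
    | succ i => simp; ring

/-- Differential inequalities in Cartesian form imply the Euler form. -/
lemma FK_of_bounds {F : ℝ × ℝ → ℂ} (hF : ContDiffOn ℝ (⊤ : ℕ∞) F offLine)
    (hb : ∀ i j, ∃ C, 0 ≤ C ∧ ∀ p ∈ offLine,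
      ‖(p.1 : ℂ) ^ i * (p.2 : ℂ) ^ j * pdx (pdy F j) i p‖ ≤ C * flagW p) (n : ℕ) : FK n F := by
  suffices H : ∀ n i j, FK n (fun p => (p.1 : ℂ) ^ i * (p.2 : ℂ) ^ j * pdx (pdy F j) i p) by
    simpa [pdx, pdy] using H n 0 0
  have hsm : ∀ i j, ContDiffOn ℝ (⊤ : ℕ∞) (pdx (pdy F j) i) offLine := fun i j =>
    contDiffOn_pdx (contDiffOn_pdy hF j) i
  intro n
  induction n with
  | zero =>
    intro i j
    refine ⟨ContDiffOn.mul (ContDiff.contDiffOn ?_) (hsm i j), hb i j⟩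
    exact ((contDiff_ofReal_comp contDiff_fst).pow i).mul ((contDiff_ofReal_comp contDiff_snd).pow j)
  | succ n ih =>
    intro i j
    refine ⟨ih i j, ((ih i j).lin (ih (i + 1) j) i 1).congr fun p hp => ?_,
      ((ih i j).lin (ih i (j + 1)) j 1).congr fun p hp => ?_⟩
    · simp only [dX]
      rw [(hasFDerivAt_monomial_mul i j ((hsm i j).diffAt hp)).1, pdx_succ, one_mul]
    · simp only [dY]
      rw [(hasFDerivAt_monomial_mul i j ((hsm i j).diffAt hp)).2, one_mul]
      congr 2
      rw [pdy_succ]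
      exact fderiv_pdx (contDiffOn_pdy hF j) i hp

end FK

section Euler
variable (M : SchwartzMap (ℝ × ℝ) ℂ →L[ℂ] ℂ)

open LineDeriv in
/-- The functional `f ↦ ⟨M, x ∂_x f⟩`. -/
def MX : SchwartzMap (ℝ × ℝ) ℂ →L[ℂ] ℂ :=
  M ∘L (SchwartzMap.smulLeftCLM ℂ (fun p : ℝ × ℝ => (p.1 : ℂ))) ∘L
    (lineDerivOpCLM ℂ (SchwartzMap (ℝ × ℝ) ℂ) ((1, 0) : ℝ × ℝ))

open LineDeriv in
/-- The functional `f ↦ ⟨M, y ∂_y f⟩`. -/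
def MY : SchwartzMap (ℝ × ℝ) ℂ →L[ℂ] ℂ :=
  M ∘L (SchwartzMap.smulLeftCLM ℂ (fun p : ℝ × ℝ => (p.2 : ℂ))) ∘L
    (lineDerivOpCLM ℂ (SchwartzMap (ℝ × ℝ) ℂ) ((0, 1) : ℝ × ℝ))

lemma TestFn.fderiv_vec {f : ℝ × ℝ → ℂ} (h : TestFn f) (v : ℝ × ℝ) :
    TestFn (fun p => fderiv ℝ f p v) :=
  ⟨(h.1.fderiv_right (by simp)).clm_apply contDiff_const,
    (h.2.fderiv (𝕜 := ℝ)).mono fun p hp hc => hp (by simp [hc])⟩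

lemma TestFn.dX {f : ℝ × ℝ → ℂ} (h : TestFn f) : TestFn (dX f) :=
  TestFn.mul_left (contDiff_ofReal_comp contDiff_fst) (h.fderiv_vec _)

lemma TestFn.dY {f : ℝ × ℝ → ℂ} (h : TestFn f) : TestFn (dY f) :=
  TestFn.mul_left (contDiff_ofReal_comp contDiff_snd) (h.fderiv_vec _)

lemma ap_MX {f : ℝ × ℝ → ℂ} (h : TestFn f) : ap (MX M) f = ap M (dX f) := by
  rw [ap_of _ h, ap_of _ h.dX, MX]
  simp only [ContinuousLinearMap.comp_apply]
  congr 1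
  ext p
  exact (SchwartzMap.smulLeftCLM_apply_apply (ContinuousLinearMap.hasTemperateGrowth
    (Complex.ofRealCLM.comp (ContinuousLinearMap.fst ℝ ℝ ℝ))) _ p).trans rfl

lemma ap_MY {f : ℝ × ℝ → ℂ} (h : TestFn f) : ap (MY M) f = ap M (dY f) := by
  rw [ap_of _ h, ap_of _ h.dY, MY]
  simp only [ContinuousLinearMap.comp_apply]
  congr 1
  ext p
  exact (SchwartzMap.smulLeftCLM_apply_apply (ContinuousLinearMap.hasTemperateGrowth
    (Complex.ofRealCLM.comp (ContinuousLinearMap.snd ℝ ℝ ℝ))) _ p).trans rfl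

end Euler

section KK

/-- The Euler operator `t d/dt`. -/
def dZ (k : ℝ → ℂ) (t : ℝ) : ℂ := (t : ℂ) * deriv k t

lemma ContDiffOn.diffAt_ne {k : ℝ → ℂ} (h : ContDiffOn ℝ (⊤ : ℕ∞) k {t | t ≠ 0}) {t : ℝ}
    (ht : t ≠ 0) : HasDerivAt k (deriv k t) t :=
  ((h.contDiffAt (isOpen_ne.mem_nhds ht)).differentiableAt (by simp)).hasDerivAt

lemma ContDiffOn.deriv_ne {k : ℝ → ℂ} (h : ContDiffOn ℝ (⊤ : ℕ∞) k {t | t ≠ 0}) :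
    ContDiffOn ℝ (⊤ : ℕ∞) (deriv k) {t | t ≠ 0} :=
  h.deriv_of_isOpen isOpen_ne (by simp)

lemma ContDiffOn.dZ {k : ℝ → ℂ} (h : ContDiffOn ℝ (⊤ : ℕ∞) k {t | t ≠ 0}) :
    ContDiffOn ℝ (⊤ : ℕ∞) (dZ k) {t | t ≠ 0} :=
  (contDiff_ofReal_comp contDiff_id).contDiffOn.mul h.deriv_ne

lemma dZ_congr {k l : ℝ → ℂ} (h : Set.EqOn k l {t | t ≠ 0}) : Set.EqOn (dZ k) (dZ l) {t | t ≠ 0} :=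
  fun t ht => by
    have : k =ᶠ[𝓝 t] l := Filter.eventuallyEq_of_mem (isOpen_ne.mem_nhds ht) h
    simp only [dZ, this.deriv_eq]

/-- Calderón–Zygmund kernels off the origin, with all Euler derivatives controlled. -/
def KK : (ℕ → ℝ) → (ℝ → ℂ) → Prop := fun C k =>
  ContDiffOn ℝ (⊤ : ℕ∞) k {t | t ≠ 0} ∧ ∀ n t, t ≠ 0 → ‖dZ^[n] k t‖ ≤ C n / |t|

lemma dZ_iterate_contDiffOn {k : ℝ → ℂ} (h : ContDiffOn ℝ (⊤ : ℕ∞) k {t | t ≠ 0}) (n : ℕ) :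
    ContDiffOn ℝ (⊤ : ℕ∞) (dZ^[n] k) {t | t ≠ 0} := by
  induction n with
  | zero => exact h
  | succ n ih => rw [Function.iterate_succ_apply']; exact ih.dZ

lemma dZ_iterate_congr {k l : ℝ → ℂ} (h : Set.EqOn k l {t | t ≠ 0}) (n : ℕ) :
    Set.EqOn (dZ^[n] k) (dZ^[n] l) {t | t ≠ 0} := by
  induction n with
  | zero => exact h
  | succ n ih => rw [Function.iterate_succ_apply', Function.iterate_succ_apply']; exact dZ_congr ih

lemma dZ_lin {k l : ℝ → ℂ} (hk : ContDiffOn ℝ (⊤ : ℕ∞) k {t | t ≠ 0})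
    (hl : ContDiffOn ℝ (⊤ : ℕ∞) l {t | t ≠ 0}) (c d : ℂ) :
    Set.EqOn (dZ fun t => c * k t + d * l t) (fun t => c * dZ k t + d * dZ l t) {t | t ≠ 0} :=
  fun t ht => by
    have := (((hk.diffAt_ne ht).const_mul c).add ((hl.diffAt_ne ht).const_mul d)).deriv
    have h2 : deriv (fun t => c * k t + d * l t) t = _ := this
    simp only [dZ, h2]; ring

lemma dZ_iterate_lin {k l : ℝ → ℂ} (hk : ContDiffOn ℝ (⊤ : ℕ∞) k {t | t ≠ 0})
    (hl : ContDiffOn ℝ (⊤ : ℕ∞) l {t | t ≠ 0}) (c d : ℂ) (n : ℕ) :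
    Set.EqOn (dZ^[n] fun t => c * k t + d * l t) (fun t => c * dZ^[n] k t + d * dZ^[n] l t)
      {t | t ≠ 0} := by
  induction n with
  | zero => exact fun t _ => rfl
  | succ n ih =>
    simp only [Function.iterate_succ_apply']
    exact (dZ_congr ih).trans (dZ_lin (dZ_iterate_contDiffOn hk n) (dZ_iterate_contDiffOn hl n) c d)

lemma KK.lin {C D : ℕ → ℝ} {k l : ℝ → ℂ} (hk : KK C k) (hl : KK D l) (c d : ℂ) :
    KK (fun n => ‖c‖ * C n + ‖d‖ * D n) (fun t => c * k t + d * l t) := by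
  refine ⟨(contDiffOn_const.mul hk.1).add (contDiffOn_const.mul hl.1), fun n t ht => ?_⟩
  rw [dZ_iterate_lin hk.1 hl.1 c d n ht]
  refine (norm_add_le _ _).trans ?_
  rw [norm_mul, norm_mul, add_div, mul_div_assoc, mul_div_assoc]
  gcongr
  · exact hk.2 n t ht
  · exact hl.2 n t ht

lemma KK.dZ {C : ℕ → ℝ} {k : ℝ → ℂ} (hk : KK C k) : KK (fun n => C (n + 1)) (dZ k) :=
  ⟨hk.1.dZ, fun n t ht => by rw [← Function.iterate_succ_apply]; exact hk.2 (n + 1) t ht⟩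

/-- Constants converting Cartesian bounds into Euler bounds. -/
def eulerConst (C : ℕ → ℝ) : ℕ → ℕ → ℝ
  | 0, α => C α
  | n + 1, α => α * eulerConst C n α + eulerConst C n (α + 1)

lemma KK_of_bounds {C : ℕ → ℝ} {k : ℝ → ℂ} (hk : ContDiffOn ℝ (⊤ : ℕ∞) k {t | t ≠ 0})
    (hb : ∀ (α : ℕ) (t : ℝ), t ≠ 0 → ‖iteratedDeriv α k t‖ ≤ C α * |t| ^ (-1 - (α : ℝ))) :
    KK (fun n => eulerConst C n 0) k := by
  have hsm : ∀ α, ContDiffOn ℝ (⊤ : ℕ∞) (iteratedDeriv α k) {t | t ≠ 0} := by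
    intro α
    induction α with
    | zero => simpa using hk
    | succ α ih => rw [iteratedDeriv_succ]; exact ih.deriv_ne
  set G : ℕ → ℝ → ℂ := fun α t => (t : ℂ) ^ α * iteratedDeriv α k t with hG
  have hGs : ∀ α, ContDiffOn ℝ (⊤ : ℕ∞) (G α) {t | t ≠ 0} := fun α =>
    ((contDiff_ofReal_comp contDiff_id).pow α).contDiffOn.mul (hsm α)
  have hd : ∀ α, Set.EqOn (dZ (G α)) (fun t => α * G α t + 1 * G (α + 1) t) {t | t ≠ 0} := by
    intro α t ht
    have h1 : HasDerivAt (fun t : ℝ => (t : ℂ) ^ α) (α * (t : ℂ) ^ (α - 1)) t := by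
      refine ((Complex.ofRealCLM.hasDerivAt (x := t)).pow α).congr_deriv ?_
      simp
    have h2 : deriv (G α) t = _ := (h1.mul ((hsm α).diffAt_ne ht)).deriv
    rw [dZ, h2]
    simp only [hG, iteratedDeriv_succ]
    cases α with
    | zero => simp
    | succ n => simp; ring
  have key : ∀ n α t, t ≠ 0 → ‖dZ^[n] (G α) t‖ ≤ eulerConst C n α / |t| := by
    intro n
    induction n with
    | zero =>
      intro α t ht
      have ht' : 0 < |t| := abs_pos.2 ht
      simp only [Function.iterate_zero, id, hG, eulerConst, norm_mul, norm_pow, Complex.norm_real,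
        Real.norm_eq_abs]
      calc |t| ^ α * ‖iteratedDeriv α k t‖ ≤ |t| ^ α * (C α * |t| ^ (-1 - (α : ℝ))) := by
            gcongr; exact hb α t ht
        _ = _ := by
            rw [Real.rpow_sub ht', Real.rpow_neg_one, Real.rpow_natCast]; field_simp
    | succ n ih =>
      intro α t ht
      rw [Function.iterate_succ_apply, dZ_iterate_congr (hd α) n ht,
        dZ_iterate_lin (hGs α) (hGs (α + 1)) α 1 n ht, eulerConst, add_div, mul_div_assoc]
      refine (norm_add_le _ _).trans ?_
      simp only [norm_mul, one_mul, Complex.norm_natCast]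
      gcongr
      · exact ih α t ht
      · exact ih (α + 1) t ht
  refine ⟨hk, fun n t ht => ?_⟩
  have := key n 0 t ht
  simpa [hG] using this

lemma exists_eq_zero_near {g : ℝ → ℂ} (h0 : (0 : ℝ) ∉ tsupport g) :
    ∃ ε > 0, ∀ u, |u| < ε → g u = 0 := by
  rw [notMem_tsupport_iff_eventuallyEq] at h0
  obtain ⟨ε, hε, h⟩ := Metric.eventually_nhds_iff.1 h0
  exact ⟨ε, hε, fun u hu => h (by simpa [Real.dist_eq] using hu)⟩

lemma TestFn.deriv {g : ℝ → ℂ} (hg : TestFn g) : TestFn (deriv g) :=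
  ⟨hg.1.deriv' , hg.2.deriv⟩

lemma TestFn.dZ {g : ℝ → ℂ} (hg : TestFn g) : TestFn (dZ g) :=
  TestFn.mul_left (contDiff_ofReal_comp contDiff_id) hg.deriv

lemma TestFn.hasDerivAt {g : ℝ → ℂ} (hg : TestFn g) (t : ℝ) : HasDerivAt g (_root_.deriv g t) t :=
  (hg.1.differentiable (by simp) t).hasDerivAt

lemma notMem_tsupport_dZ {g : ℝ → ℂ} (hg : TestFn g) (h0 : (0 : ℝ) ∉ tsupport g) :
    (0 : ℝ) ∉ tsupport (dZ g) := by
  obtain ⟨ε, hε, h⟩ := exists_eq_zero_near h0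
  refine zero_notMem_tsupport hε fun u hu => ?_
  rw [dZ, deriv_eq_zero_of_abs_lt hg.hasDerivAt h u hu, mul_zero]

lemma integral_mul_dZ {k g : ℝ → ℂ} (hk : ContDiffOn ℝ (⊤ : ℕ∞) k {t | t ≠ 0}) (hg : TestFn g)
    (h0 : (0 : ℝ) ∉ tsupport g) : ∫ t, k t * dZ g t = ∫ t, (-1 * k t + -1 * dZ k t) * g t := by
  obtain ⟨ε, hε, h⟩ := exists_eq_zero_near h0
  have hc : Continuous (deriv g) := hg.deriv.1.continuous
  have hgc : Continuous g := hg.1.continuous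
  have hd : ∀ t, HasDerivAt (fun t : ℝ => (t : ℂ) * g t) (1 * g t + (t : ℂ) * deriv g t) t := fun t =>
    (Complex.ofRealCLM.hasDerivAt (x := t)).mul (hg.hasDerivAt t)
  have hkc : ContinuousOn (deriv k) {0}ᶜ := hk.deriv_ne.continuousOn
  obtain ⟨hq, hq'⟩ := hasDerivAt_kernel_mul hε (fun u hu => hk.diffAt_ne hu) hkc hd
    (by fun_prop) (fun u hu => by simp [h u hu])
  have hcs : HasCompactSupport (fun t => k t * ((t : ℂ) * g t)) := hg.2.mul_left.mul_left
  have h1 := integral_deriv_mul_of_compact hq hq' hcs (fun t => hasDerivAt_const t (1 : ℂ))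
    continuous_const
  simp only [mul_zero, integral_zero, mul_one] at h1
  obtain ⟨hk2, hk2'⟩ := hasDerivAt_kernel_mul hε (fun u hu => hk.diffAt_ne hu) hkc hg.hasDerivAt
    hc h
  have hI1 : Integrable (fun t => k t * dZ g t) := by
    obtain ⟨hk3, -⟩ := hasDerivAt_kernel_mul hε (fun u hu => hk.diffAt_ne hu) hkc hg.dZ.hasDerivAt
      hg.dZ.deriv.1.continuous (fun u hu => by
        rw [dZ, deriv_eq_zero_of_abs_lt hg.hasDerivAt h u hu, mul_zero])
    exact (continuous_iff_continuousAt.2 fun t => (hk3 t).continuousAt).integrable_of_hasCompactSupport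
      hg.dZ.2.mul_left
  have hI0 : Integrable (fun t => deriv k t * ((t : ℂ) * g t) + k t * (1 * g t + (t : ℂ) * deriv g t)) :=
    hq'.integrable_of_hasCompactSupport (by
      refine HasCompactSupport.add (hg.2.mul_left.mul_left) (HasCompactSupport.mul_left ?_)
      exact hg.2.mul_left.add hg.2.deriv.mul_left)
  have e1 : (fun t => (-1 * k t + -1 * dZ k t) * g t) = fun t => k t * dZ g t -
      (deriv k t * ((t : ℂ) * g t) + k t * (1 * g t + (t : ℂ) * deriv g t)) := by
    ext t; simp only [dZ]; ring
  rw [e1, integral_sub hI1 hI0, neg_eq_zero.1 h1.symm, sub_zero]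

lemma exists_CN_dZ (N : ℕ) : ∃ D : ℝ, 0 < D ∧ ∀ f, CN (N + 1) 1 f → CN N D (dZ f) := by
  have ht : TestFn (fun t : ℝ => (t : ℂ) * cut (1 / 2 * t)) := by
    refine TestFn.mul_left (contDiff_ofReal_comp contDiff_id) ⟨contDiff_cut.comp (by fun_prop), ?_⟩
    exact testFn_cut.2.comp_homeomorph (Homeomorph.mulLeft₀ (1 / 2 : ℝ) (by norm_num))
  obtain ⟨D, hD⟩ := ht.exists_CB N
  refine ⟨max 1 (2 ^ N * (1 * D)), by positivity, fun f hf => ?_⟩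
  have h0 : ∀ t, 1 < |t| → deriv f t = 0 := by
    intro w hw
    have : f =ᶠ[𝓝 w] fun _ => 0 := by
      filter_upwards [continuous_abs.continuousAt.eventually (lt_mem_nhds hw)] with x hx
        using hf.supp x hx
    rw [this.deriv_eq, deriv_const]
  have h1 : CN N 1 (deriv f) := by
    refine ⟨⟨hf.testFn.deriv.1, fun j hj t => ?_⟩, h0⟩
    rw [← iteratedDeriv_succ']
    exact hf.bd (j + 1) (by omega) t
  have h2 := h1.mul hD
  have e : dZ f = fun t => deriv f t * ((t : ℂ) * cut (1 / 2 * t)) := by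
    ext t
    rcases le_or_gt |t| 1 with h | h
    · rw [cut_of_le (by rw [abs_mul, abs_of_pos (by norm_num : (0 : ℝ) < 1 / 2)]; linarith), dZ]
      ring
    · simp [dZ, h0 t h]
  rw [e]
  exact h2.mono le_rfl (le_max_right _ _)

end KK

section Ker

lemma TestFn.tensor {g h : ℝ → ℂ} (hg : TestFn g) (hh : TestFn h) :
    TestFn (fun p : ℝ × ℝ => g p.1 * h p.2) := by
  refine ⟨(hg.1.comp contDiff_fst).mul (hh.1.comp contDiff_snd), ?_⟩
  refine HasCompactSupport.intro (hg.2.isCompact.prod hh.2.isCompact) fun p hp => ?_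
  by_contra hc
  exact hp ⟨subset_tsupport _ fun h => hc (by simp [h]), subset_tsupport _ fun h => hc (by simp [h])⟩

lemma TestFn.scale {g : ℝ → ℂ} (hg : TestFn g) {r : ℝ} (hr : r ≠ 0) :
    TestFn (fun u => g (r * u)) :=
  ⟨hg.1.comp (contDiff_const.mul contDiff_id), hg.2.comp_homeomorph (Homeomorph.mulLeft₀ r hr)⟩

/-- The class of flag kernels in the form used below: it is stable under `x∂_x` and `y∂_y`. -/
structure Ker (M : SchwartzMap (ℝ × ℝ) ℂ →L[ℂ] ℂ) : Prop where
  far : ∃ F, (∀ n, FK n F) ∧ ∀ f, TestFn f → tsupport f ⊆ offLine → ap M f = ∫ p, F p * f p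
  ker : ∃ (N : ℕ) (C : ℕ → ℝ), ∀ h R, CN N 1 h → 0 < R → ∃ k, KK C k ∧
    ∀ g, TestFn g → (0 : ℝ) ∉ tsupport g →
      ap M (fun p => g p.1 * h (R * p.2)) = ∫ x, k x * g x
  bdd : ∃ (N : ℕ) (C : ℝ), ∀ f h r R, CN N 1 f → CN N 1 h → 0 < r → 0 < R →
    ‖ap M (fun p => f (r * p.1) * h (R * p.2))‖ ≤ C

lemma FK.smooth_mul {F f : ℝ × ℝ → ℂ} (hF : ContDiffOn ℝ (⊤ : ℕ∞) F offLine) (hf : TestFn f)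
    (hs : tsupport f ⊆ offLine) : TestFn (fun p => F p * f p) := by
  refine ⟨contDiff_iff_contDiffAt.2 fun p => ?_, hf.2.mul_left⟩
  by_cases hp : p ∈ tsupport f
  · exact (hF.contDiffAt (isOpen_offLine.mem_nhds (hs hp))).mul hf.1.contDiffAt
  · have : (fun p => F p * f p) =ᶠ[𝓝 p] fun _ => 0 := by
      filter_upwards [notMem_tsupport_iff_eventuallyEq.1 hp] with q hq
      simp [hq]
    exact contDiffAt_const.congr_of_eventuallyEq this

lemma integral_fderiv_eq_zero_of_testFn {f : ℝ × ℝ → ℂ} (hf : TestFn f) (v : ℝ × ℝ) :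
    ∫ p, fderiv ℝ f p v = 0 := by
  have h := integral_bilinear_fderiv_right_eq_neg_left_of_integrable (μ := volume)
    (B := ContinuousLinearMap.mul ℝ ℂ) (f := fun _ : ℝ × ℝ => (1 : ℂ)) (g := f) (v := v) (by simp)
    (by simpa using (hf.fderiv_vec v).1.continuous.integrable_of_hasCompactSupport (hf.fderiv_vec v).2)
    (by simpa using hf.1.continuous.integrable_of_hasCompactSupport hf.2)
    (fun x _ => differentiableAt_const _) (fun x _ => hf.1.differentiable (by simp) x)
  simpa using h

lemma tsupport_fderiv_vec {f : ℝ × ℝ → ℂ} (v : ℝ × ℝ) {p : ℝ × ℝ} (hp : p ∉ tsupport f) :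
    f p = 0 ∧ fderiv ℝ f p v = 0 := by
  refine ⟨image_eq_zero_of_notMem_tsupport hp, ?_⟩
  rw [(notMem_tsupport_iff_eventuallyEq.1 hp).fderiv_eq]
  simp

lemma integral_mul_euler {F f E : ℝ × ℝ → ℂ} {l : ℝ × ℝ →L[ℝ] ℝ} {v : ℝ × ℝ} (hv : l v = 1)
    (hF : ContDiffOn ℝ (⊤ : ℕ∞) F offLine) (hf : TestFn f) (hs : tsupport f ⊆ offLine)
    (hE : ∀ p, E p = (l p : ℂ) * fderiv ℝ F p v) :
    ∫ p, F p * ((l p : ℂ) * fderiv ℝ f p v) = ∫ p, (-1 * F p + -1 * E p) * f p := by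
  have hl : ContDiff ℝ (⊤ : ℕ∞) (fun p => (l p : ℂ)) := contDiff_ofReal_comp l.contDiff
  have hH : TestFn (fun p => F p * ((l p : ℂ) * f p)) :=
    FK.smooth_mul hF (TestFn.mul_left hl hf) ((closure_mono (show Function.support (fun p => (l p : ℂ) * f p) ⊆ Function.support f from
      fun p hp hc => hp (by simp [hc]))).trans hs)
  have h0 := integral_fderiv_eq_zero_of_testFn hH v
  have hI : Integrable (fun p => F p * ((l p : ℂ) * fderiv ℝ f p v)) := by
    have := FK.smooth_mul hF (TestFn.mul_left hl (hf.fderiv_vec v))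
      ((closure_minimal (fun p hp => by
        by_contra hc
        exact hp (by simp [(tsupport_fderiv_vec v hc).2])) (isClosed_tsupport f)).trans hs)
    exact this.1.continuous.integrable_of_hasCompactSupport this.2
  have hI2 : Integrable (fun p => fderiv ℝ (fun p => F p * ((l p : ℂ) * f p)) p v) :=
    (hH.fderiv_vec v).1.continuous.integrable_of_hasCompactSupport (hH.fderiv_vec v).2
  have e : (fun p => (-1 * F p + -1 * E p) * f p) = fun p => F p * ((l p : ℂ) * fderiv ℝ f p v) -
      fderiv ℝ (fun p => F p * ((l p : ℂ) * f p)) p v := by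
    ext p
    by_cases hp : p ∈ tsupport f
    · have h1 := (hF.diffAt (hs hp)).hasFDerivAt
      have h2 := (hf.1.differentiable (by simp) p).hasFDerivAt
      have h3 : HasFDerivAt (fun p => (l p : ℂ)) (Complex.ofRealCLM.comp l) p :=
        (Complex.ofRealCLM.comp l).hasFDerivAt
      have h4 : fderiv ℝ (fun p => F p * ((l p : ℂ) * f p)) p = _ := (h1.mul (h3.mul h2)).fderiv
      rw [h4, hE]
      simp [hv]
      ring
    · have hp' : p ∉ tsupport (fun p => F p * ((l p : ℂ) * f p)) := fun h =>
        hp (closure_mono (show Function.support (fun p => F p * ((l p : ℂ) * f p)) ⊆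
          Function.support f from fun q hq hc => hq (by simp [hc])) h)
      rw [(tsupport_fderiv_vec v hp').2, (tsupport_fderiv_vec v hp).1, (tsupport_fderiv_vec v hp).2]
      simp
  rw [e, integral_sub hI hI2, h0, sub_zero]

lemma tsupport_euler_subset {f : ℝ × ℝ → ℂ} (c : ℝ × ℝ → ℂ) (v : ℝ × ℝ)
    (hs : tsupport f ⊆ offLine) : tsupport (fun p => c p * fderiv ℝ f p v) ⊆ offLine :=
  (closure_minimal (fun p hp => by
    by_contra hc
    exact hp (by simp [(tsupport_fderiv_vec v hc).2])) (isClosed_tsupport f)).trans hs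

lemma dX_tensor {g h : ℝ → ℂ} (hg : TestFn g) (hh : TestFn h) :
    dX (fun p => g p.1 * h p.2) = fun p => dZ g p.1 * h p.2 := by
  ext p
  have h1 : HasFDerivAt (fun p : ℝ × ℝ => g p.1) _ p :=
    (hg.hasDerivAt p.1).hasFDerivAt.comp p hasFDerivAt_fst
  have h2 : HasFDerivAt (fun p : ℝ × ℝ => h p.2) _ p :=
    (hh.hasDerivAt p.2).hasFDerivAt.comp p hasFDerivAt_snd
  have h3 : fderiv ℝ (fun p : ℝ × ℝ => g p.1 * h p.2) p = _ := (h1.mul h2).fderiv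
  rw [dX, h3]
  simp [dZ]
  ring

lemma dY_tensor {g h : ℝ → ℂ} (hg : TestFn g) (hh : TestFn h) :
    dY (fun p => g p.1 * h p.2) = fun p => g p.1 * dZ h p.2 := by
  ext p
  have h1 : HasFDerivAt (fun p : ℝ × ℝ => g p.1) _ p :=
    (hg.hasDerivAt p.1).hasFDerivAt.comp p hasFDerivAt_fst
  have h2 : HasFDerivAt (fun p : ℝ × ℝ => h p.2) _ p :=
    (hh.hasDerivAt p.2).hasFDerivAt.comp p hasFDerivAt_snd
  have h3 : fderiv ℝ (fun p : ℝ × ℝ => g p.1 * h p.2) p = _ := (h1.mul h2).fderiv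
  rw [dY, h3]
  simp [dZ]
  ring

lemma dZ_scale (g : ℝ → ℂ) (r : ℝ) : dZ (fun u => g (r * u)) = fun u => dZ g (r * u) := by
  ext u
  simp only [dZ]
  rw [deriv_comp_mul_left r g u]
  simp; ring

theorem Ker.MX {M : SchwartzMap (ℝ × ℝ) ℂ →L[ℂ] ℂ} (hM : Ker M) : Ker (MX M) := by
  obtain ⟨⟨F, hF, hr⟩, ⟨N, C, hk⟩, ⟨N', C', hb⟩⟩ := hM
  refine ⟨⟨fun p => -1 * F p + -1 * dX F p, fun n => (hF n).lin (hF (n + 1)).2.1 _ _, ?_⟩,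
    ⟨N, fun n => ‖(-1 : ℂ)‖ * C n + ‖(-1 : ℂ)‖ * C (n + 1), ?_⟩, ?_⟩
  · intro f hf hs
    rw [ap_MX _ hf, hr _ hf.dX (tsupport_euler_subset _ _ hs)]
    exact integral_mul_euler (l := ContinuousLinearMap.fst ℝ ℝ ℝ) (v := (1, 0)) rfl (hF 0).1 hf hs
      fun p => rfl
  · intro h R hh hR
    obtain ⟨k, hk1, hk2⟩ := hk h R hh hR
    refine ⟨_, hk1.lin hk1.dZ (-1) (-1), fun g hg h0 => ?_⟩
    rw [ap_MX _ (hg.tensor (hh.testFn.scale hR.ne')), dX_tensor hg (hh.testFn.scale hR.ne'),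
      hk2 _ hg.dZ (notMem_tsupport_dZ hg h0)]
    exact integral_mul_dZ hk1.1 hg h0
  · obtain ⟨D, hD0, hD⟩ := exists_CN_dZ N'
    refine ⟨N' + 1, D * C', fun f h r R hf hh hr hR => ?_⟩
    have hf' := hf.testFn.scale hr.ne'
    have hh' := hh.testFn.scale hR.ne'
    have h1 := hb _ h r R ((hD f hf).normalize le_rfl hD0) (hh.mono (by omega) le_rfl) hr hR
    have h2 : ap M (fun p => (((D⁻¹ : ℝ) : ℂ) * dZ f (r * p.1)) * h (R * p.2)) =
        ((D⁻¹ : ℝ) : ℂ) * ap M (fun p => dZ f (r * p.1) * h (R * p.2)) := by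
      rw [← ap_smul M _ (f := fun p => dZ f (r * p.1) * h (R * p.2))
        ((hf.testFn.dZ.scale hr.ne').tensor hh')]
      congr 1; ext p; ring
    rw [ap_MX _ (hf'.tensor hh'), dX_tensor hf' hh', dZ_scale]
    rw [h2, norm_mul, Complex.norm_real, norm_inv, Real.norm_of_nonneg hD0.le,
      inv_mul_le_iff₀ hD0] at h1
    exact h1

theorem Ker.MY {M : SchwartzMap (ℝ × ℝ) ℂ →L[ℂ] ℂ} (hM : Ker M) : Ker (MY M) := by
  obtain ⟨⟨F, hF, hr⟩, ⟨N, C, hk⟩, ⟨N', C', hb⟩⟩ := hM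
  refine ⟨⟨fun p => -1 * F p + -1 * dY F p, fun n => (hF n).lin (hF (n + 1)).2.2 _ _, ?_⟩, ?_, ?_⟩
  · intro f hf hs
    rw [ap_MY _ hf, hr _ hf.dY (tsupport_euler_subset _ _ hs)]
    exact integral_mul_euler (l := ContinuousLinearMap.snd ℝ ℝ ℝ) (v := (0, 1)) rfl (hF 0).1 hf hs
      fun p => rfl
  · obtain ⟨D, hD0, hD⟩ := exists_CN_dZ N
    refine ⟨N + 1, fun n => ‖(D : ℂ)‖ * C n + ‖(0 : ℂ)‖ * C n, fun h R hh hR => ?_⟩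
    obtain ⟨k, hk1, hk2⟩ := hk _ R ((hD h hh).normalize le_rfl hD0) hR
    refine ⟨_, hk1.lin hk1 D 0, fun g hg h0 => ?_⟩
    have hh' := hh.testFn.scale hR.ne'
    have h2 : ap M (fun p => g p.1 * dZ h (R * p.2)) =
        D * ap M (fun p => g p.1 * (((D⁻¹ : ℝ) : ℂ) * dZ h (R * p.2))) := by
      rw [← ap_smul M _ (f := fun p => g p.1 * (((D⁻¹ : ℝ) : ℂ) * dZ h (R * p.2)))
        (hg.tensor ((hh.testFn.dZ.scale hR.ne').smul _))]
      have : (D : ℂ) ≠ 0 := by exact_mod_cast hD0.ne'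
      congr 1; ext p; push_cast; field_simp
    rw [ap_MY _ (hg.tensor hh'), dY_tensor hg hh', dZ_scale, h2, hk2 g hg h0,
      ← integral_const_mul]
    congr 1; ext x; ring
  · obtain ⟨D, hD0, hD⟩ := exists_CN_dZ N'
    refine ⟨N' + 1, D * C', fun f h r R hf hh hr hR => ?_⟩
    have hf' := hf.testFn.scale hr.ne'
    have hh' := hh.testFn.scale hR.ne'
    have h1 := hb f _ r R (hf.mono (by omega) le_rfl) ((hD h hh).normalize le_rfl hD0) hr hR
    have h2 : ap M (fun p => f (r * p.1) * (((D⁻¹ : ℝ) : ℂ) * dZ h (R * p.2))) =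
        ((D⁻¹ : ℝ) : ℂ) * ap M (fun p => f (r * p.1) * dZ h (R * p.2)) := by
      rw [← ap_smul M _ (f := fun p => f (r * p.1) * dZ h (R * p.2))
        (hf'.tensor (hh.testFn.dZ.scale hR.ne'))]
      congr 1; ext p; ring
    rw [ap_MY _ (hf'.tensor hh'), dY_tensor hf' hh', dZ_scale]
    rw [h2, norm_mul, Complex.norm_real, norm_inv, Real.norm_of_nonneg hD0.le,
      inv_mul_le_iff₀ hD0] at h1
    exact h1

end Ker

section Base

lemma testFn_kernel_mul {k g : ℝ → ℂ} (hk : ContDiffOn ℝ (⊤ : ℕ∞) k {t | t ≠ 0}) (hg : TestFn g)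
    (h0 : (0 : ℝ) ∉ tsupport g) : TestFn (fun x => k x * g x) := by
  refine ⟨contDiff_iff_contDiffAt.2 fun p => ?_, hg.2.mul_left⟩
  by_cases hp : p ∈ tsupport g
  · have hp0 : p ≠ 0 := fun h => h0 (h ▸ hp)
    exact (hk.contDiffAt (isOpen_ne.mem_nhds hp0)).mul hg.1.contDiffAt
  · have : (fun p => k p * g p) =ᶠ[𝓝 p] fun _ => 0 := by
      filter_upwards [notMem_tsupport_iff_eventuallyEq.1 hp] with q hq
      simp [hq]
    exact contDiffAt_const.congr_of_eventuallyEq this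

lemma integrable_kernel_mul {k g : ℝ → ℂ} (hk : ContDiffOn ℝ (⊤ : ℕ∞) k {t | t ≠ 0}) (hg : TestFn g)
    (h0 : (0 : ℝ) ∉ tsupport g) : Integrable (fun x => k x * g x) :=
  (testFn_kernel_mul hk hg h0).1.continuous.integrable_of_hasCompactSupport
    (testFn_kernel_mul hk hg h0).2

lemma CN.isNormalizedBump_re {h : ℝ → ℂ} (H : CN 1 1 h) : IsNormalizedBump (fun t => (h t).re) := by
  refine ⟨Complex.reCLM.contDiff.comp H.smooth, fun t ht => by simp [H.supp t ht],
    fun t => (Complex.abs_re_le_norm _).trans (H.toCB.norm_le t), fun t => ?_⟩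
  have h1 : HasDerivAt (fun t => (h t).re) (deriv h t).re t :=
    Complex.reCLM.hasFDerivAt.comp_hasDerivAt t (H.toCB.hasDerivAt t)
  rw [h1.deriv]
  exact (Complex.abs_re_le_norm _).trans (CB.norm_deriv_le (N := 0) H.toCB t)

lemma CN.isNormalizedBump_im {h : ℝ → ℂ} (H : CN 1 1 h) : IsNormalizedBump (fun t => (h t).im) := by
  refine ⟨Complex.imCLM.contDiff.comp H.smooth, fun t ht => by simp [H.supp t ht],
    fun t => (Complex.abs_im_le_norm _).trans (H.toCB.norm_le t), fun t => ?_⟩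
  have h1 : HasDerivAt (fun t => (h t).im) (deriv h t).im t :=
    Complex.imCLM.hasFDerivAt.comp_hasDerivAt t (H.toCB.hasDerivAt t)
  rw [h1.deriv]
  exact (Complex.abs_im_le_norm _).trans (CB.norm_deriv_le (N := 0) H.toCB t)

lemma IsNormalizedBump.testFn {φ : ℝ → ℝ} (h : IsNormalizedBump φ) :
    TestFn (fun t => (φ t : ℂ)) :=
  ⟨contDiff_ofReal_comp h.1, HasCompactSupport.intro (isCompact_Icc (a := -1) (b := 1)) fun t ht => by
    rw [h.2.1 t]
    · simp
    · by_contra hc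
      exact ht (abs_le.1 (not_lt.1 hc))⟩

variable {Cd : ℕ → ℝ} {C : ℝ} {M : SchwartzMap (ℝ × ℝ) ℂ →L[ℂ] ℂ}

lemma FlagCancellation.exists_kernel (hM : FlagCancellation Cd C M) {φ : ℝ → ℝ}
    (hφ : IsNormalizedBump φ) {R : ℝ} (hR : 0 < R) :
    ∃ k, KK (fun n => eulerConst Cd n 0) k ∧
      (∀ g, TestFn g → (0 : ℝ) ∉ tsupport g →
        ap M (fun p => g p.1 * (φ (R * p.2) : ℂ)) = ∫ x, k x * g x) ∧
      ∀ f : ℝ → ℝ, IsNormalizedBump f → ∀ r, 0 < r →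
        ‖ap M (fun p => (f (r * p.1) : ℂ) * (φ (R * p.2) : ℂ))‖ ≤ C := by
  obtain ⟨⟨u, k, ⟨h1, h2, h3, h4⟩, h5⟩, -⟩ := hM φ hφ R hR
  have key : ∀ g (hg : TestFn g),
      ap M (fun p => g p.1 * (φ (R * p.2) : ℂ)) = u (hg.2.toSchwartzMap hg.1) := fun g hg => by
    rw [ap_of M (hg.tensor (hφ.testFn.scale hR.ne'))]
    exact (h5 _ _ fun p => rfl).symm
  refine ⟨k, KK_of_bounds h1 h2, fun g hg h0 => ?_, fun f hf r hr => ?_⟩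
  · rw [key g hg]
    exact h3 _ h0
  · rw [key _ (hf.testFn.scale hr.ne')]
    exact h4 r hr f hf _ fun t => rfl

lemma ap_re_add_im {g h : ℝ → ℂ} (hg : TestFn g) (h1 : TestFn (fun t => ((h t).re : ℂ)))
    (h2 : TestFn (fun t => ((h t).im : ℂ))) {R : ℝ} (hR : R ≠ 0) :
    ap M (fun p => g p.1 * h (R * p.2)) = ap M (fun p => g p.1 * ((h (R * p.2)).re : ℂ)) +
      Complex.I * ap M (fun p => g p.1 * ((h (R * p.2)).im : ℂ)) := by
  have t1 := hg.tensor (h1.scale hR)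
  have t2 := hg.tensor (h2.scale hR)
  rw [← ap_smul M _ t2, ← ap_add M t1 (t2.smul _)]
  congr 1; ext p
  conv_lhs => rw [← Complex.re_add_im (h (R * p.2))]
  ring

lemma ap_re_add_im_left {f h : ℝ → ℂ} (h1 : TestFn (fun t => ((f t).re : ℂ)))
    (h2 : TestFn (fun t => ((f t).im : ℂ))) (hh : TestFn h) {r : ℝ} (hr : r ≠ 0) :
    ap M (fun p => f (r * p.1) * h p.2) = ap M (fun p => ((f (r * p.1)).re : ℂ) * h p.2) +
      Complex.I * ap M (fun p => ((f (r * p.1)).im : ℂ) * h p.2) := by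
  have t1 := (h1.scale hr).tensor hh
  have t2 := (h2.scale hr).tensor hh
  rw [← ap_smul M _ t2, ← ap_add M t1 (t2.smul _)]
  congr 1; ext p
  conv_lhs => rw [← Complex.re_add_im (f (r * p.1))]
  ring

lemma flag_weight_le {x y : ℝ} (hy : y ≠ 0) (i j : ℕ) :
    |x| ^ i * |y| ^ j * ((|x| + |y| ^ ((1 : ℝ) / 2)) ^ (-1 - (i : ℝ)) * |y| ^ (-1 - (j : ℝ))) ≤
      flagW (x, y) := by
  have hy' : 0 < |y| := abs_pos.2 hy
  rw [← Real.sqrt_eq_rpow]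
  have hw : 0 < |x| + √|y| := by positivity
  have e1 : ∀ (t : ℝ) (n : ℕ), 0 < t → t ^ (-1 - (n : ℝ)) = (t ^ n * t)⁻¹ := fun t n ht => by
    rw [show -1 - (n : ℝ) = -((n + 1 : ℕ) : ℝ) by push_cast; ring, Real.rpow_neg ht.le,
      Real.rpow_natCast, pow_succ]
  rw [e1 _ _ hw, e1 _ _ hy', flagW]
  have h1 : |x| ^ i ≤ (|x| + √|y|) ^ i := by gcongr; simp
  calc _ ≤ (|x| + √|y|) ^ i * |y| ^ j *
      (((|x| + √|y|) ^ i * (|x| + √|y|))⁻¹ * (|y| ^ j * |y|)⁻¹) := by gcongr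
    _ = _ := by field_simp

theorem IsFlagKernelF1.ker {Cab : ℕ → ℕ → ℝ} {F : ℝ → ℝ → ℂ} (hM : IsFlagKernelF1 Cab Cd C M F) :
    Ker M := by
  obtain ⟨hF, hb, hr, hc⟩ := hM
  refine ⟨⟨fun p => F p.1 p.2, FK_of_bounds hF fun i j => ⟨|Cab i j|, abs_nonneg _, ?_⟩, ?_⟩,
    ⟨1, fun n => ‖(1 : ℂ)‖ * eulerConst Cd n 0 + ‖Complex.I‖ * eulerConst Cd n 0, ?_⟩,
    ⟨1, 4 * C, ?_⟩⟩
  · rintro ⟨x, y⟩ (hy : y ≠ 0)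
    have h1 := hb i j x y hy
    have e : iteratedDeriv i (fun x' => iteratedDeriv j (fun y' => F x' y') y) x =
        pdx (pdy (fun p : ℝ × ℝ => F p.1 p.2) j) i (x, y) := by
      rw [← iteratedDeriv_fst (contDiffOn_pdy hF j) i x y hy]
      congr 1; ext x'
      exact iteratedDeriv_snd (G := fun p : ℝ × ℝ => F p.1 p.2) hF j x' y hy
    rw [e] at h1
    have h2 : |x| ^ i * |y| ^ j * ‖pdx (pdy (fun p : ℝ × ℝ => F p.1 p.2) j) i (x, y)‖ ≤
        |Cab i j| * (|x| ^ i * |y| ^ j *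
          ((|x| + |y| ^ ((1 : ℝ) / 2)) ^ (-1 - (i : ℝ)) * |y| ^ (-1 - (j : ℝ)))) := by
      have h3 : Cab i j * (|x| + |y| ^ ((1 : ℝ) / 2)) ^ (-1 - (i : ℝ)) * |y| ^ (-1 - (j : ℝ)) ≤
          |Cab i j| * ((|x| + |y| ^ ((1 : ℝ) / 2)) ^ (-1 - (i : ℝ)) * |y| ^ (-1 - (j : ℝ))) := by
        rw [mul_assoc]
        gcongr
        exact le_abs_self _
      have := mul_le_mul_of_nonneg_left (h1.trans h3) (by positivity : 0 ≤ |x| ^ i * |y| ^ j)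
      linarith
    have h4 := mul_le_mul_of_nonneg_left (flag_weight_le (x := x) hy i j) (abs_nonneg (Cab i j))
    simpa using h2.trans h4
  · intro f hf hs
    rw [ap_of M hf]
    exact hr _ fun p hp => hs hp
  · intro h R hh hR
    obtain ⟨k1, hk1, e1, -⟩ := hc.exists_kernel hh.isNormalizedBump_re hR
    obtain ⟨k2, hk2, e2, -⟩ := hc.exists_kernel hh.isNormalizedBump_im hR
    refine ⟨_, hk1.lin hk2 1 Complex.I, fun g hg h0 => ?_⟩
    rw [ap_re_add_im hg hh.isNormalizedBump_re.testFn hh.isNormalizedBump_im.testFn hR.ne',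
      e1 g hg h0, e2 g hg h0, ← integral_const_mul, ← integral_add]
    · congr 1; ext x; ring
    · exact integrable_kernel_mul hk1.1 hg h0
    · exact (integrable_kernel_mul hk2.1 hg h0).const_mul _
  · intro f h r R hf hh hr hR
    have hf1 := hf.isNormalizedBump_re
    have hf2 := hf.isNormalizedBump_im
    have hh1 := hh.isNormalizedBump_re
    have hh2 := hh.isNormalizedBump_im
    obtain ⟨-, -, -, e1⟩ := hc.exists_kernel hh1 hR
    obtain ⟨-, -, -, e2⟩ := hc.exists_kernel hh2 hR
    rw [ap_re_add_im (g := fun t => f (r * t)) (hf.testFn.scale hr.ne') hh1.testFn hh2.testFn hR.ne',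
      ap_re_add_im_left hf1.testFn hf2.testFn (h := fun t => ((h (R * t)).re : ℂ))
        (hh1.testFn.scale hR.ne') hr.ne',
      ap_re_add_im_left hf1.testFn hf2.testFn (h := fun t => ((h (R * t)).im : ℂ))
        (hh2.testFn.scale hR.ne') hr.ne']
    have a1 := e1 _ hf1 r hr
    have a2 := e1 _ hf2 r hr
    have a3 := e2 _ hf1 r hr
    have a4 := e2 _ hf2 r hr
    refine (norm_add_le _ _).trans ?_
    have b1 := norm_add_le (ap M fun p => ((f (r * p.1)).re : ℂ) * ((h (R * p.2)).re : ℂ))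
      (Complex.I * ap M fun p => ((f (r * p.1)).im : ℂ) * ((h (R * p.2)).re : ℂ))
    have b2 := norm_add_le (ap M fun p => ((f (r * p.1)).re : ℂ) * ((h (R * p.2)).im : ℂ))
      (Complex.I * ap M fun p => ((f (r * p.1)).im : ℂ) * ((h (R * p.2)).im : ℂ))
    rw [norm_mul, Complex.norm_I, one_mul] at b1 b2 ⊢
    linarith

end Base

section Slice

/-- Differentiation under the integral sign for smooth functions with compact fibres. -/
lemma hasDerivAt_integral_of_smooth {G : ℝ × ℝ → ℂ} (hG : ContDiff ℝ (⊤ : ℕ∞) G) {K : Set ℝ}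
    (hK : IsCompact K) (h0 : ∀ u t, t ∉ K → G (u, t) = 0) (u₀ : ℝ) :
    HasDerivAt (fun u => ∫ t, G (u, t)) (∫ t, fderiv ℝ G (u₀, t) (1, 0)) u₀ := by
  have hd : ∀ u t, HasDerivAt (fun u => G (u, t)) (fderiv ℝ G (u, t) (1, 0)) u := fun u t =>
    HasFDerivAt.comp_hasDerivAt (f := fun u => (u, t)) u
      (hG.differentiable (by simp) (u, t)).hasFDerivAt
      ((hasDerivAt_id u).prodMk (hasDerivAt_const u t))
  have hc : Continuous (fun p : ℝ × ℝ => fderiv ℝ G p (1, 0)) :=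
    (hG.continuous_fderiv (by simp)).clm_apply continuous_const
  obtain ⟨B, hB⟩ := ((isCompact_closedBall u₀ 1).prod hK).exists_bound_of_continuousOn hc.continuousOn
  have h0' : ∀ u t, t ∉ K → fderiv ℝ G (u, t) (1, 0) = 0 := fun u t ht => by
    rw [← (hd u t).deriv, show (fun u => G (u, t)) = fun _ => 0 from funext fun u => h0 u t ht]
    simp
  have h_int : ∀ f : ℝ → ℂ, Continuous f → (∀ t, t ∉ K → f t = 0) → Integrable f := fun f hf h =>
    hf.integrable_of_hasCompactSupport (HasCompactSupport.intro hK h)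
  refine (hasDerivAt_integral_of_dominated_loc_of_deriv_le (F := fun u t => G (u, t))
    (F' := fun u t => fderiv ℝ G (u, t) (1, 0)) (bound := K.indicator fun _ => B)
    (Metric.closedBall_mem_nhds u₀ one_pos) ?_ ?_ ?_ ?_ ?_ ?_).2
  · exact Eventually.of_forall fun u => (h_int _ (hG.continuous.comp (by fun_prop)) (h0 u)).1
  · exact h_int _ (hG.continuous.comp (by fun_prop)) (h0 u₀)
  · exact (h_int _ (hc.comp (by fun_prop : Continuous fun t => (u₀, t))) (h0' u₀)).1
  · refine Eventually.of_forall fun t u hu => ?_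
    by_cases ht : t ∈ K
    · rw [Set.indicator_of_mem ht]
      exact hB (u, t) ⟨hu, ht⟩
    · rw [h0' u t ht, Set.indicator_of_notMem ht]
      simp
  · exact (integrable_indicator_iff hK.measurableSet).2
      (integrableOn_const (hK.measure_lt_top.ne))
  · exact Eventually.of_forall fun t u _ => hd u t

/-- The kernel in `x` obtained by pairing a flag kernel in `y`. -/
def sliceK (F : ℝ × ℝ → ℂ) (l : ℝ) (H : ℝ → ℂ) (u : ℝ) : ℂ :=
  (l : ℂ)⁻¹ * ∫ y, F (u / l, y) * H (l ^ 2 * y)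

lemma contDiff_slice {F : ℝ × ℝ → ℂ} (hF : ContDiffOn ℝ (⊤ : ℕ∞) F offLine) {l : ℝ}
    {H : ℝ → ℂ} (hH : ContDiff ℝ (⊤ : ℕ∞) H) {ε : ℝ} (hε : 0 < ε) (h0 : ∀ t, |t| < ε → H t = 0) :
    ContDiff ℝ (⊤ : ℕ∞) (fun p : ℝ × ℝ => F (p.1 / l, p.2) * H (l ^ 2 * p.2)) := by
  refine contDiff_iff_contDiffAt.2 fun p => ?_
  by_cases hp : p.2 = 0
  · have : (fun p : ℝ × ℝ => F (p.1 / l, p.2) * H (l ^ 2 * p.2)) =ᶠ[𝓝 p] fun _ => 0 := by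
      have h1 : ∀ᶠ q : ℝ × ℝ in 𝓝 p, |l ^ 2 * q.2| < ε := by
        have : Continuous fun q : ℝ × ℝ => |l ^ 2 * q.2| := by fun_prop
        exact this.continuousAt.eventually_lt continuousAt_const (by simpa [hp] using hε)
      filter_upwards [h1] with q hq
      rw [h0 _ hq, mul_zero]
    exact contDiffAt_const.congr_of_eventuallyEq this
  · refine ContDiffAt.mul ?_ (hH.comp (by fun_prop)).contDiffAt
    refine ContDiffAt.comp p (hF.contDiffAt (isOpen_offLine.mem_nhds hp)) ?_
    exact (contDiff_fst.div_const l).contDiffAt.prodMk contDiffAt_snd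

lemma hasDerivAt_sliceK {F : ℝ × ℝ → ℂ} (hF : ContDiffOn ℝ (⊤ : ℕ∞) F offLine) {l : ℝ}
    (hl : 0 < l) {H : ℝ → ℂ} (hH : TestFn H) {ε : ℝ} (hε : 0 < ε)
    (h0 : ∀ t, |t| < ε → H t = 0) {u : ℝ} (hu : u ≠ 0) :
    HasDerivAt (sliceK F l H) ((u : ℂ)⁻¹ * sliceK (dX F) l H u) u ∧
      Continuous (sliceK F l H) := by
  have hG := contDiff_slice (l := l) hF hH.1 hε h0
  have hc := hH.scale (r := l ^ 2) (by positivity)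
  have hz : ∀ u t, t ∉ tsupport (fun y => H (l ^ 2 * y)) → F (u / l, t) * H (l ^ 2 * t) = 0 :=
    fun u t ht => by
      have : H (l ^ 2 * t) = 0 := image_eq_zero_of_notMem_tsupport (f := fun y => H (l ^ 2 * y)) ht
      rw [this, mul_zero]
  have hd := hasDerivAt_integral_of_smooth hG hc.2.isCompact hz
  have hd2 := fun u => (hd u).const_mul (l : ℂ)⁻¹
  refine ⟨(hd2 u).congr_deriv ?_, continuous_iff_continuousAt.2 fun u => (hd2 u).continuousAt⟩
  have e : ∀ t, fderiv ℝ (fun p : ℝ × ℝ => F (p.1 / l, p.2) * H (l ^ 2 * p.2)) (u, t) (1, 0) =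
      (u : ℂ)⁻¹ * (dX F (u / l, t) * H (l ^ 2 * t)) := by
    intro t
    have h1 : HasDerivAt (fun u => F (u / l, t) * H (l ^ 2 * t))
        (fderiv ℝ (fun p : ℝ × ℝ => F (p.1 / l, p.2) * H (l ^ 2 * p.2)) (u, t) (1, 0)) u :=
      HasFDerivAt.comp_hasDerivAt (f := fun u => (u, t)) u
        (hG.differentiable (by simp) (u, t)).hasFDerivAt
        ((hasDerivAt_id u).prodMk (hasDerivAt_const u t))
    by_cases ht : t = 0
    · have hz0 : H (l ^ 2 * t) = 0 := h0 _ (by simpa [ht] using hε)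
      rw [← h1.deriv]
      simp [hz0]
    · have h2 : HasDerivAt (fun u => F (u / l, t)) (fderiv ℝ F (u / l, t) (1, 0) * ((1 / l : ℝ) : ℂ)) u := by
        have h3 := hasDerivAt_slice_fst hF (p := (u / l, t)) ht
        have h4 : HasDerivAt (fun u : ℝ => u / l) (1 / l) u := (hasDerivAt_id u).div_const l
        have h5 := HasDerivAt.scomp u (h := fun u : ℝ => u / l) h3 h4
        refine h5.congr_deriv ?_
        rw [Complex.real_smul, mul_comm]
      rw [h1.unique (h2.mul_const _), dX]
      have : (u : ℂ) ≠ 0 := by exact_mod_cast hu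
      push_cast
      field_simp
  simp_rw [e, integral_const_mul, sliceK]
  ring

lemma flagW_scale {l : ℝ} (hl : 0 < l) (u t : ℝ) :
    flagW (u / l, t / l ^ 2) = l ^ 3 * flagW (u, t) := by
  simp only [flagW, abs_div, abs_of_pos hl, abs_of_pos (pow_pos hl 2)]
  rw [Real.sqrt_div (abs_nonneg t), Real.sqrt_sq hl.le, ← add_div, div_mul_div_comm, inv_div,
    ← pow_succ', div_eq_mul_inv]

lemma norm_sliceK_le {F : ℝ × ℝ → ℂ} (hF : ContDiffOn ℝ (⊤ : ℕ∞) F offLine) {C : ℝ} (hC : 0 ≤ C)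
    (h1 : ∀ p ∈ offLine, ‖F p‖ ≤ C * flagW p) (h2 : ∀ p ∈ offLine, ‖dY F p‖ ≤ C * flagW p)
    {l : ℝ} (hl : 0 < l) {s : ℝ} (hs : |s| = 1) {B : ℝ → ℂ} (hB : TestFn B) {ε β : ℝ}
    (hε : 1 / 2 ≤ ε) (h0 : ∀ t, |t| < ε → B t = 0) (hb : ∀ t, ‖B t‖ ≤ β)
    (hb' : ∀ t, ‖deriv B t‖ * |t| ≤ β) (u : ℝ) :
    ‖sliceK F l (fun t => B t * ch s t) u‖ ≤ 4 * (C * β) / (ε * (1 + |u|)) := by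
  have hε0 : 0 < ε := by linarith
  have hβ : 0 ≤ β := (norm_nonneg _).trans (hb 0)
  have hl2 : 0 < l ^ 2 := by positivity
  -- rewrite the slice in the variable `t = l² y`
  have e1 : ∫ y, F (u / l, y) * (B (l ^ 2 * y) * ch s (l ^ 2 * y)) =
      ((l ^ 2)⁻¹ : ℝ) * ∫ t, (F (u / l, t / l ^ 2) * B t) * ch s t := by
    have h := Measure.integral_comp_mul_left
      (fun t => (F (u / l, t / l ^ 2) * B t) * ch s t) (l ^ 2)
    rw [abs_of_pos (by positivity), Complex.real_smul] at h
    rw [← h]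
    congr 1; ext y
    rw [mul_div_cancel_left₀ _ hl2.ne']
    ring
  have hGs : ContDiff ℝ (⊤ : ℕ∞) (fun t => F (u / l, t / l ^ 2) * B t) := by
    have h3 := (contDiff_slice (l := l) hF hB.1 hε0 h0).comp ((contDiff_const (c := u)).prodMk
      ((contDiff_id (𝕜 := ℝ) (E := ℝ)).div_const (l ^ 2)))
    convert h3 using 2 with t
    simp only [id, Function.comp_apply]
    rw [mul_div_cancel₀ _ hl2.ne']
  have hGc : HasCompactSupport (fun t => F (u / l, t / l ^ 2) * B t) := hB.2.mul_left
  have hGd : ∀ t, HasDerivAt (fun t => F (u / l, t / l ^ 2) * B t)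
      (deriv (fun t => F (u / l, t / l ^ 2) * B t) t) t :=
    fun t => (hGs.differentiable (by simp) t).hasDerivAt
  have hs0 : s ≠ 0 := by rintro rfl; simp at hs
  have h3 := norm_integral_mul_ch_le hGd (hGs.continuous_deriv (by simp)) hGc hs0
  have hbd : ∀ t, ‖deriv (fun t => F (u / l, t / l ^ 2) * B t) t‖ ≤
      8 * (C * β) * l ^ 3 / ((1 + |u|) * ε ^ 2) * (1 + (ε⁻¹ * (t + 0)) ^ 2)⁻¹ := by
    intro t
    rcases lt_or_ge |t| ε with ht | ht
    · rw [deriv_eq_zero_of_abs_lt hGd (fun t ht => by rw [h0 t ht, mul_zero]) t ht, norm_zero]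
      positivity
    · have ht0 : 0 < |t| := hε0.trans_le ht
      have ht' : t ≠ 0 := abs_pos.1 ht0
      have hp : (u / l, t / l ^ 2) ∈ offLine := div_ne_zero ht' hl2.ne'
      have h4 : HasDerivAt (fun t => F (u / l, t / l ^ 2))
          (((1 / l ^ 2 : ℝ) : ℂ) * fderiv ℝ F (u / l, t / l ^ 2) (0, 1)) t := by
        have h5 := HasDerivAt.scomp t (h := fun t : ℝ => t / l ^ 2) (hasDerivAt_slice_snd hF hp)
          ((hasDerivAt_id t).div_const (l ^ 2))
        exact h5.congr_deriv (by rw [Complex.real_smul])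
      have h5 := (h4.mul (hB.hasDerivAt t)).deriv
      have h6 : (t : ℂ) * (((1 / l ^ 2 : ℝ) : ℂ) * fderiv ℝ F (u / l, t / l ^ 2) (0, 1)) =
          dY F (u / l, t / l ^ 2) := by
        simp only [dY]; push_cast; ring
      have h7 : ‖deriv (fun t => F (u / l, t / l ^ 2) * B t) t‖ * |t| ≤
          2 * (C * β) * flagW (u / l, t / l ^ 2) := by
        have e : (t : ℂ) * deriv (fun t => F (u / l, t / l ^ 2) * B t) t =
            dY F (u / l, t / l ^ 2) * B t + F (u / l, t / l ^ 2) * (t * deriv B t) := by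
          rw [show deriv (fun t => F (u / l, t / l ^ 2) * B t) t = _ from h5, ← h6]
          ring
        have e2 := congrArg norm e
        rw [norm_mul, Complex.norm_real, Real.norm_eq_abs] at e2
        rw [mul_comm, e2]
        refine (norm_add_le _ _).trans ?_
        rw [norm_mul, norm_mul, norm_mul, Complex.norm_real, Real.norm_eq_abs, mul_comm |t|]
        have a1 := mul_le_mul (h2 _ hp) (hb t) (norm_nonneg _) (mul_nonneg hC (flagW_nonneg _))
        have a2 := mul_le_mul (h1 _ hp) (hb' t) (by positivity) (mul_nonneg hC (flagW_nonneg _))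
        linarith
      rw [flagW_scale hl] at h7
      have h8 : flagW (u, t) ≤ 2 / ((1 + |u|) * |t|) := by
        rw [flagW, div_eq_mul_inv, ← inv_inv (2 : ℝ), ← mul_inv]
        refine inv_anti₀ (by positivity) ?_
        rw [← mul_assoc]
        refine mul_le_mul_of_nonneg_right ?_ ht0.le
        have : 1 / 2 ≤ √|t| := Real.le_sqrt_of_sq_le (by linarith)
        simp only
        linarith [abs_nonneg u]
      have h9 : (1 + (ε⁻¹ * (t + 0)) ^ 2)⁻¹ ≥ ε ^ 2 / (2 * |t| ^ 2) := by
        rw [ge_iff_le, add_zero, div_le_iff₀ (by positivity), inv_mul_eq_div,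
          le_div_iff₀ (by positivity)]
        have : ε ^ 2 ≤ |t| ^ 2 := by gcongr
        rw [sq_abs] at this ⊢
        field_simp
        nlinarith
      calc _ = ‖deriv (fun t => F (u / l, t / l ^ 2) * B t) t‖ * |t| / |t| := by field_simp
        _ ≤ 2 * (C * β) * (l ^ 3 * (2 / ((1 + |u|) * |t|))) / |t| := by
          refine div_le_div_of_nonneg_right (h7.trans ?_) ht0.le
          have hcb : 0 ≤ 2 * (C * β) := by positivity
          exact mul_le_mul_of_nonneg_left
            (mul_le_mul_of_nonneg_left h8 (by positivity)) hcb
        _ = 8 * (C * β) * l ^ 3 / ((1 + |u|) * ε ^ 2) * (ε ^ 2 / (2 * |t| ^ 2)) := by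
          field_simp; ring
        _ ≤ _ := mul_le_mul_of_nonneg_left h9 (by positivity)
  have hI := integral_mono_of_nonneg (Eventually.of_forall fun t => norm_nonneg _)
    ((integrable_scaled_inv_one_add_sq ε⁻¹ 0 (by positivity)).const_mul
      (8 * (C * β) * l ^ 3 / ((1 + |u|) * ε ^ 2))) (Eventually.of_forall hbd)
  rw [integral_const_mul, integral_scaled_inv_one_add_sq, abs_of_pos (inv_pos.2 hε0), inv_inv] at hI
  rw [sliceK, e1, norm_mul, norm_mul, norm_inv, Complex.norm_real, Complex.norm_real,
    Real.norm_of_nonneg hl.le, Real.norm_of_nonneg (by positivity)]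
  rw [hs, mul_one] at h3
  calc _ ≤ l⁻¹ * ((l ^ 2)⁻¹ * (1 / (2 * π) *
      (8 * (C * β) * l ^ 3 / ((1 + |u|) * ε ^ 2) * (ε * π)))) := by
        have h10 := h3.trans (mul_le_mul_of_nonneg_left hI (by positivity))
        exact mul_le_mul_of_nonneg_left (mul_le_mul_of_nonneg_left h10 (by positivity))
          (by positivity)
    _ = _ := by field_simp; ring

end Slice

section CZ

lemma CZ1.congr {N : ℕ} {A : ℝ} {T T' : (ℝ → ℂ) → ℂ} (h : CZ1 N A T)
    (e : ∀ f, TestFn f → T' f = T f) : CZ1 N A T' := by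
  obtain ⟨h1, h2, h3, k, k', hk, hc, hb, hb', hr⟩ := h
  refine ⟨fun f g hf hg => ?_, fun c f hf => ?_, fun f r hf hr => ?_, k, k', hk, hc, hb, hb',
    fun g hg h0 => ?_⟩
  · rw [e _ (hf.add hg), e _ hf, e _ hg, h1 f g hf hg]
  · rw [e _ (hf.smul c), e _ hf, h2 c f hf]
  · rw [e _ (hf.testFn.scale (by positivity))]
    exact h3 f r hf hr
  · rw [e _ hg, hr g hg h0]

lemma CZ1.add {N : ℕ} {A A' : ℝ} {T T' : (ℝ → ℂ) → ℂ} (h : CZ1 N A T) (h' : CZ1 N A' T') :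
    CZ1 N (A + A') (fun f => T f + T' f) := by
  obtain ⟨h1, h2, h3, k, k', hk, hc, hb, hb', hr⟩ := h
  obtain ⟨l1, l2, l3, l, l', lk, lc, lb, lb', lr⟩ := h'
  refine ⟨fun f g hf hg => ?_, fun c f hf => ?_, fun f r hf hr => ?_, fun u => k u + l u,
    fun u => k' u + l' u, fun u hu => (hk u hu).add (lk u hu), hc.add lc, fun u hu => ?_,
    fun u hu => ?_, fun g hg h0 => ?_⟩
  · simp only [h1 f g hf hg, l1 f g hf hg]; ring
  · simp only [h2 c f hf, l2 c f hf]; ring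
  · exact (norm_add_le _ _).trans (add_le_add (h3 f r hf hr) (l3 f r hf hr))
  · rw [add_div]; exact (norm_add_le _ _).trans (add_le_add (hb u hu) (lb u hu))
  · rw [add_div]; exact (norm_add_le _ _).trans (add_le_add (hb' u hu) (lb' u hu))
  · simp only [hr g hg h0, lr g hg h0]
    have hi : ∀ {k k' : ℝ → ℂ}, (∀ u, u ≠ 0 → HasDerivAt k (k' u) u) →
        Integrable (fun u => k u * g u) := by
      intro k k' hk
      obtain ⟨ε, hε, hz⟩ := exists_eq_zero_near h0
      refine Continuous.integrable_of_hasCompactSupport ?_ hg.2.mul_left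
      refine continuous_iff_continuousAt.2 fun u => ?_
      by_cases hu : u = 0
      · have : (fun u => k u * g u) =ᶠ[𝓝 u] fun _ => 0 := by
          filter_upwards [Metric.ball_mem_nhds u hε] with v hv
          rw [hz v (by simpa [hu, Real.dist_eq] using hv), mul_zero]
        exact continuousAt_const.congr this.symm
      · exact (hk u hu).continuousAt.mul hg.1.continuous.continuousAt
    rw [← integral_add (hi hk) (hi lk)]
    congr 1; ext u; ring

lemma CZ1.mono {N N' : ℕ} {A A' : ℝ} {T : (ℝ → ℂ) → ℂ} (h : CZ1 N A T) (hN : N ≤ N')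
    (hA : A ≤ A') : CZ1 N' A' T := by
  obtain ⟨h1, h2, h3, k, k', hk, hc, hb, hb', hr⟩ := h
  refine ⟨h1, h2, fun f r hf hr => (h3 f r (hf.mono hN le_rfl) hr).trans hA, k, k', hk, hc,
    fun u hu => (hb u hu).trans (by gcongr), fun u hu => (hb' u hu).trans (by gcongr), hr⟩

lemma CZ1.smul {N : ℕ} {A : ℝ} {T : (ℝ → ℂ) → ℂ} (h : CZ1 N A T) (c : ℂ) :
    CZ1 N (‖c‖ * A) (fun f => c * T f) := by
  obtain ⟨h1, h2, h3, k, k', hk, hc, hb, hb', hr⟩ := h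
  refine ⟨fun f g hf hg => ?_, fun d f hf => ?_, fun f r hf hr => ?_, fun u => c * k u,
    fun u => c * k' u, fun u hu => (hk u hu).const_mul c, continuousOn_const.mul hc,
    fun u hu => ?_, fun u hu => ?_, fun g hg h0 => ?_⟩
  · simp only [h1 f g hf hg]; ring
  · simp only [h2 d f hf]; ring
  · rw [norm_mul]
    exact mul_le_mul_of_nonneg_left (h3 f r hf hr) (norm_nonneg _)
  · rw [norm_mul, mul_div_assoc]
    exact mul_le_mul_of_nonneg_left (hb u hu) (norm_nonneg _)
  · rw [norm_mul, mul_div_assoc]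
    exact mul_le_mul_of_nonneg_left (hb' u hu) (norm_nonneg _)
  · simp only [hr g hg h0]
    rw [← integral_const_mul]
    congr 1; ext u; ring

/-- The pairing of `M` with `f(lx) h(l²y)`. -/
def Tp (M : SchwartzMap (ℝ × ℝ) ℂ →L[ℂ] ℂ) (l : ℝ) (h f : ℝ → ℂ) : ℂ :=
  ap M (fun p => f (l * p.1) * h (l ^ 2 * p.2))

variable {M : SchwartzMap (ℝ × ℝ) ℂ →L[ℂ] ℂ}

lemma testFn_Tp {l : ℝ} (hl : 0 < l) {h f : ℝ → ℂ} (hh : TestFn h) (hf : TestFn f) :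
    TestFn (fun p : ℝ × ℝ => f (l * p.1) * h (l ^ 2 * p.2)) :=
  (hf.scale hl.ne').tensor (hh.scale (pow_pos hl 2).ne')

lemma Tp_add_right {l : ℝ} (hl : 0 < l) {h f g : ℝ → ℂ} (hh : TestFn h) (hf : TestFn f)
    (hg : TestFn g) : Tp M l h (fun u => f u + g u) = Tp M l h f + Tp M l h g := by
  rw [Tp, Tp, Tp, ← ap_add M (testFn_Tp hl hh hf) (testFn_Tp hl hh hg)]
  congr 1; ext p; ring

lemma Tp_smul_right {l : ℝ} (hl : 0 < l) {h f : ℝ → ℂ} (hh : TestFn h) (hf : TestFn f) (c : ℂ) :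
    Tp M l h (fun u => c * f u) = c * Tp M l h f := by
  rw [Tp, Tp, ← ap_smul M c (testFn_Tp hl hh hf)]
  congr 1; ext p; ring

lemma Tp_add_left {l : ℝ} (hl : 0 < l) {h k f : ℝ → ℂ} (hh : TestFn h) (hk : TestFn k)
    (hf : TestFn f) : Tp M l (fun u => h u + k u) f = Tp M l h f + Tp M l k f := by
  rw [Tp, Tp, Tp, ← ap_add M (testFn_Tp hl hh hf) (testFn_Tp hl hk hf)]
  congr 1; ext p; ring

lemma Tp_smul_left {l : ℝ} (hl : 0 < l) {h f : ℝ → ℂ} (hh : TestFn h) (hf : TestFn f) (c : ℂ) :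
    Tp M l (fun u => c * h u) f = c * Tp M l h f := by
  rw [Tp, Tp, ← ap_smul M c (testFn_Tp hl hh hf)]
  congr 1; ext p; ring

/-- Uniform one-dimensional estimates: bumps in the `y` variable. -/
theorem Ker.exists_CZ1_bump (hM : Ker M) : ∃ (N : ℕ) (A : ℝ), 0 ≤ A ∧ ∀ l h, 0 < l → CN N 1 h →
    CZ1 N A (Tp M l h) := by
  obtain ⟨-, ⟨N, C, hk⟩, ⟨N', C', hb⟩⟩ := hM
  refine ⟨max N N', |C 0| + |C 1| + |C'|, by positivity, fun l h hl hh => ?_⟩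
  have hl2 : 0 < l ^ 2 := by positivity
  obtain ⟨k, ⟨k1, k2⟩, k3⟩ := hk h (l ^ 2) (hh.mono (le_max_left _ _) le_rfl) hl2
  have hlC : (l : ℂ) ≠ 0 := by exact_mod_cast hl.ne'
  refine ⟨fun f g hf hg => Tp_add_right hl hh.testFn hf hg,
    fun c f hf => Tp_smul_right hl hh.testFn hf c, fun f r hf hr => ?_,
    fun u => (l : ℂ)⁻¹ * k (u / l), fun u => (l : ℂ)⁻¹ * (deriv k (u / l) * ((1 / l : ℝ) : ℂ)),
    fun u hu => ?_, ?_, fun u hu => ?_, fun u hu => ?_, fun g hg h0 => ?_⟩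
  · have h1 := hb f h (r * l) (l ^ 2) (hf.mono (le_max_right _ _) le_rfl)
      (hh.mono (le_max_right _ _) le_rfl) (by positivity) hl2
    simp only [Tp, ← mul_assoc]
    refine h1.trans ?_
    linarith [le_abs_self C', abs_nonneg (C 0), abs_nonneg (C 1)]
  · have h4 : HasDerivAt (fun u : ℝ => u / l) (1 / l) u := (hasDerivAt_id u).div_const l
    have h5 := HasDerivAt.scomp u (h := fun u : ℝ => u / l)
      (k1.diffAt_ne (div_ne_zero hu hl.ne')) h4
    refine (h5.const_mul (l : ℂ)⁻¹).congr_deriv ?_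
    rw [Complex.real_smul, mul_comm ((1 / l : ℝ) : ℂ)]
  · refine continuousOn_const.mul (ContinuousOn.mul ?_ continuousOn_const)
    exact k1.deriv_ne.continuousOn.comp (by fun_prop) fun u hu => div_ne_zero hu hl.ne'
  · have h1 := k2 0 (u / l) (div_ne_zero hu hl.ne')
    rw [norm_mul, norm_inv, Complex.norm_real, Real.norm_of_nonneg hl.le]
    simp only [Function.iterate_zero, id] at h1
    rw [abs_div, abs_of_pos hl] at h1
    have hu' := abs_pos.2 hu
    calc _ ≤ l⁻¹ * (C 0 / (|u| / l)) := mul_le_mul_of_nonneg_left h1 (by positivity)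
      _ = C 0 / |u| := by field_simp
      _ ≤ _ := by
        gcongr
        linarith [le_abs_self (C 0), abs_nonneg C', abs_nonneg (C 1)]
  · have h1 := k2 1 (u / l) (div_ne_zero hu hl.ne')
    simp only [Function.iterate_one, dZ, norm_mul, Complex.norm_real, Real.norm_eq_abs] at h1
    rw [norm_mul, norm_mul, norm_inv, Complex.norm_real, Complex.norm_real,
      Real.norm_of_nonneg hl.le, Real.norm_of_nonneg (by positivity)]
    rw [abs_div, abs_of_pos hl] at h1
    have hu' := abs_pos.2 hu
    rw [← sq_abs u]
    have h2 : ‖deriv k (u / l)‖ ≤ C 1 * l ^ 2 / |u| ^ 2 := by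
      rw [le_div_iff₀ (by positivity)]
      rw [le_div_iff₀ (by positivity)] at h1
      field_simp at h1
      linarith
    calc _ ≤ l⁻¹ * (C 1 * l ^ 2 / |u| ^ 2 * (1 / l)) := by gcongr
      _ = C 1 / |u| ^ 2 := by field_simp
      _ ≤ _ := by
        gcongr
        linarith [le_abs_self (C 1), abs_nonneg C', abs_nonneg (C 0)]
  · have hg' : (0 : ℝ) ∉ tsupport (fun x => g (l * x)) := by
      obtain ⟨ε, hε, hz⟩ := exists_eq_zero_near h0
      refine zero_notMem_tsupport (ε := ε / l) (by positivity) fun u hu => hz _ ?_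
      rw [abs_mul, abs_of_pos hl]
      rwa [lt_div_iff₀ hl, mul_comm] at hu
    have h1 := k3 _ (hg.scale hl.ne') hg'
    rw [Tp, h1]
    have h := Measure.integral_comp_mul_left (fun u => k (u / l) * g u) l
    rw [abs_of_pos (by positivity), Complex.real_smul] at h
    simp_rw [mul_assoc]
    rw [integral_const_mul]
    push_cast at h
    rw [← h]
    congr 1; ext x
    rw [mul_div_cancel_left₀ _ hl.ne']

theorem Ker.exists_CZ1_far (hM : Ker M) : ∃ A : ℝ, 0 ≤ A ∧ ∀ (N : ℕ) (l s ε β : ℝ) (B : ℝ → ℂ),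
    0 < l → |s| = 1 → TestFn B → 1 / 2 ≤ ε → (∀ t, |t| < ε → B t = 0) → (∀ t, ‖B t‖ ≤ β) →
    (∀ t, ‖deriv B t‖ * |t| ≤ β) → CZ1 N (A * β / ε) (Tp M l (fun t => B t * ch s t)) := by
  obtain ⟨⟨F, hF, hr⟩, -, -⟩ := hM
  obtain ⟨hs, C0, hC0, hb0⟩ := hF 0
  obtain ⟨-, C1, hC1, hb1⟩ := (hF 1).2.1
  obtain ⟨-, C2, hC2, hb2⟩ := (hF 1).2.2
  obtain ⟨-, C3, hC3, hb3⟩ := (hF 2).2.1.2.2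
  set C := C0 + C1 + C2 + C3 with hC
  have up : ∀ {D : ℝ} {G : ℝ × ℝ → ℂ}, (∀ p ∈ offLine, ‖G p‖ ≤ D * flagW p) → D ≤ C →
      ∀ p ∈ offLine, ‖G p‖ ≤ C * flagW p := fun h hD p hp =>
    (h p hp).trans (mul_le_mul_of_nonneg_right hD (flagW_nonneg p))
  have hCn : 0 ≤ C := by positivity
  have u0 := up hb0 (by linarith)
  have u1 := up hb1 (by linarith)
  have u2 := up hb2 (by linarith)
  have u3 := up hb3 (by linarith)
  refine ⟨8 * C, by positivity, fun N l s ε β B hl hs1 hB hε h0 hb hb' => ?_⟩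
  have hε0 : 0 < ε := by linarith
  have hβ : 0 ≤ β := (norm_nonneg _).trans (hb 0)
  have hH : TestFn (fun t => B t * ch s t) := hB.mul_right (contDiff_ch s)
  have hH0 : ∀ t, |t| < ε → B t * ch s t = 0 := fun t ht => by rw [h0 t ht, zero_mul]
  have n0 := norm_sliceK_le hs hCn u0 u2 hl hs1 hB hε h0 hb hb'
  have n1 := norm_sliceK_le hs.dX hCn u1 u3 hl hs1 hB hε h0 hb hb'
  have hl2 : 0 < l ^ 2 := by positivity
  have e4 : 0 ≤ 4 * (C * β) := by positivity
  have m0 : ∀ {u x : ℝ}, x ≤ 4 * (C * β) / (ε * (1 + |u|)) → u ≠ 0 →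
      x ≤ 8 * C * β / ε / |u| := by
    intro u x hx hu
    refine hx.trans ?_
    have hu' := abs_pos.2 hu
    rw [div_div]
    exact div_le_div₀ (by positivity) (by linarith) (by positivity) (by gcongr; linarith)
  have hrep : ∀ f, TestFn f → Tp M l (fun t => B t * ch s t) f =
      ∫ u, sliceK F l (fun t => B t * ch s t) u * f u := by
    intro f hf
    have hT := testFn_Tp hl hH hf
    have hsub : tsupport (fun p : ℝ × ℝ => f (l * p.1) * (B (l ^ 2 * p.2) * ch s (l ^ 2 * p.2))) ⊆
        offLine := by
      refine (closure_minimal (t := {p : ℝ × ℝ | ε ≤ |l ^ 2 * p.2|}) (fun p hp => ?_) ?_).trans ?_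
      · by_contra hc
        exact hp (by
          show f (l * p.1) * (B (l ^ 2 * p.2) * ch s (l ^ 2 * p.2)) = 0
          rw [hH0 _ (not_le.1 hc), mul_zero])
      · exact isClosed_le continuous_const (by fun_prop)
      · intro p (hp : ε ≤ |l ^ 2 * p.2|) hz
        simp only [hz, mul_zero, abs_zero] at hp
        linarith
    have hI := FK.smooth_mul hs hT hsub
    rw [Tp, hr _ hT hsub, Measure.volume_eq_prod, integral_prod _ (by
      rw [← Measure.volume_eq_prod]
      exact hI.1.continuous.integrable_of_hasCompactSupport hI.2)]
    have h := Measure.integral_comp_mul_left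
      (fun u => sliceK F l (fun t => B t * ch s t) u * f u) l
    rw [abs_of_pos (by positivity), Complex.real_smul] at h
    have hlC : (l : ℂ) ≠ 0 := by exact_mod_cast hl.ne'
    have e : ∀ x : ℝ, ∫ y : ℝ, F (x, y) * (f (l * x) * (B (l ^ 2 * y) * ch s (l ^ 2 * y))) =
        (l : ℂ) * (sliceK F l (fun t => B t * ch s t) (l * x) * f (l * x)) := by
      intro x
      simp only [sliceK]
      rw [mul_div_cancel_left₀ _ hl.ne']
      have e1 : ∀ y : ℝ, F (x, y) * (f (l * x) * (B (l ^ 2 * y) * ch s (l ^ 2 * y))) =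
          f (l * x) * (F (x, y) * (B (l ^ 2 * y) * ch s (l ^ 2 * y))) := fun y => by ring
      simp_rw [e1]
      rw [integral_const_mul]
      field_simp
    simp only [e]
    rw [integral_const_mul, h]
    push_cast
    field_simp
  have hX := hasDerivAt_sliceK (u := 1) hs.dX hl hH hε0 hH0 one_ne_zero
  refine ⟨fun f g hf hg => Tp_add_right hl hH hf hg, fun c f hf => Tp_smul_right hl hH hf c,
    fun f r hf hr => ?_, sliceK F l (fun t => B t * ch s t),
    fun u => (u : ℂ)⁻¹ * sliceK (dX F) l (fun t => B t * ch s t) u,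
    fun u hu => (hasDerivAt_sliceK hs hl hH hε0 hH0 hu).1, ?_, fun u hu => m0 (n0 u) hu,
    fun u hu => ?_, fun g hg _ => hrep g hg⟩
  · rw [hrep _ (hf.testFn.scale (by positivity)),
      ← setIntegral_eq_integral_of_forall_compl_eq_zero (s := Set.Icc (-1) 1)]
    · refine (norm_setIntegral_le_of_norm_le_const (C := 4 * C * β / ε) (by simp)
        fun u _ => ?_).trans ?_
      · rw [norm_mul]
        calc _ ≤ 4 * (C * β) / (ε * (1 + |u|)) * 1 :=
              mul_le_mul (n0 u) (hf.norm_le _) (norm_nonneg _) (by positivity)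
          _ ≤ _ := by
            rw [mul_one, ← mul_assoc]
            refine div_le_div_of_nonneg_left (by positivity) hε0 ?_
            nlinarith [abs_nonneg u]
      · rw [Real.volume_real_Icc_of_le (by norm_num)]
        apply le_of_eq
        ring
    · intro u hu
      rw [hf.supp, mul_zero]
      have : 1 < |u| := by
        by_contra hc
        exact hu (abs_le.1 (not_lt.1 hc))
      rw [abs_mul, abs_of_nonneg (by linarith)]
      nlinarith
  · refine ContinuousOn.mul (fun u hu => ?_) hX.2.continuousOn
    exact (Complex.continuous_ofReal.continuousAt.inv₀
      (by simpa using hu)).continuousWithinAt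
  · rw [norm_mul, norm_inv, Complex.norm_real, Real.norm_eq_abs, ← sq_abs]
    have := m0 (n1 u) hu
    have hu' := abs_pos.2 hu
    calc _ ≤ |u|⁻¹ * (8 * C * β / ε / |u|) := by gcongr
      _ = _ := by field_simp

end CZ

section TT

lemma testFn_cut_div {R : ℝ} (hR : 0 < R) : TestFn (fun t => cut (t / R)) := by
  have := testFn_cut.scale (inv_ne_zero hR.ne')
  simpa only [inv_mul_eq_div] using this

lemma cut_div_of_le {R t : ℝ} (hR : 0 < R) (h : |t| ≤ R / 2) : cut (t / R) = 1 := by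
  refine cut_of_le ?_
  rw [abs_div, abs_of_pos hR, div_le_iff₀ hR]
  linarith

lemma cut_div_of_ge {R t : ℝ} (hR : 0 < R) (h : R ≤ |t|) : cut (t / R) = 0 := by
  refine cut_of_ge ?_
  rwa [abs_div, abs_of_pos hR, le_div_iff₀ hR, one_mul]

lemma exists_norm_deriv_cut_div_le : ∃ D, 1 ≤ D ∧ ∀ R, 0 < R → ∀ t,
    ‖deriv (fun t => cut (t / R)) t‖ * |t| ≤ D := by
  obtain ⟨D, hD, h⟩ := exists_CN_cut 1
  refine ⟨D, hD, fun R hR t => ?_⟩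
  have h1 : HasDerivAt (fun t : ℝ => t / R) (1 / R) t := (hasDerivAt_id t).div_const R
  have h2 : deriv (fun t => cut (t / R)) t = _ :=
    (HasDerivAt.scomp t (h := fun t : ℝ => t / R) (h.hasDerivAt (t / R)) h1).deriv
  by_cases ht : |t| ≤ R
  · rw [h2, norm_smul, Real.norm_of_nonneg (by positivity)]
    calc _ ≤ 1 / R * D * R := by
          gcongr
          exact h.toCB.norm_deriv_le _
      _ = D := by field_simp
  · have h3 : (fun t => cut (t / R)) =ᶠ[𝓝 t] fun _ => 0 := by
      filter_upwards [(isOpen_lt continuous_const continuous_abs).mem_nhds (not_le.1 ht)] with v hv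
      exact cut_div_of_ge hR (le_of_lt hv)
    rw [h3.deriv_eq]
    simp
    linarith

lemma exists_CN_cut_mul_ch (N : ℕ) : ∃ D, 0 < D ∧ ∀ s, |s| ≤ 1 →
    CN N D (fun t => cut t * ch s t) := by
  obtain ⟨D, hD, h⟩ := exists_CN_cut N
  obtain ⟨E, hE, h'⟩ := exists_CB_ch N
  refine ⟨2 ^ N * (D * E), by positivity, fun s hs => ?_⟩
  have h1 := h'.scale hs
  simp only [← ch_scale] at h1
  exact h.mul h1

/-- The truncated partial Fourier pairing in the `y` variable, in scaled coordinates. -/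
def TT (M : SchwartzMap (ℝ × ℝ) ℂ →L[ℂ] ℂ) (s ρ l : ℝ) (f : ℝ → ℂ) : ℂ :=
  Tp M l (fun t => cut (t / ρ ^ 2) * ch s t) f

variable {M : SchwartzMap (ℝ × ℝ) ℂ →L[ℂ] ℂ}

lemma Ker.exists_CZ1_TT (hM : Ker M) : ∃ (N : ℕ) (A : ℝ), 0 ≤ A ∧ ∀ s ρ l, |s| = 1 → 1 ≤ ρ →
    0 < l → CZ1 N A (TT M s ρ l) ∧
      ∀ ρ', ρ ≤ ρ' → CZ1 N (A / ρ ^ 2) (fun f => TT M s ρ' l f - TT M s ρ l f) := by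
  obtain ⟨N, A1, hA1, hb⟩ := hM.exists_CZ1_bump
  obtain ⟨A2, hA2, hf⟩ := hM.exists_CZ1_far
  obtain ⟨D, hD, hcut⟩ := exists_norm_deriv_cut_div_le
  obtain ⟨E, hE, hce⟩ := exists_CN_cut_mul_ch N
  have hB : ∀ R R' : ℝ, 1 ≤ R → R ≤ R' → TestFn (fun t => cut (t / R') - cut (t / R)) ∧
      (∀ t, |t| < R / 2 → cut (t / R') - cut (t / R) = 0) ∧
      (∀ t, ‖cut (t / R') - cut (t / R)‖ ≤ 2 * D) ∧
      (∀ t, ‖deriv (fun t => cut (t / R') - cut (t / R)) t‖ * |t| ≤ 2 * D) := by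
    intro R R' hR hR'
    have h0 : 0 < R := by linarith
    have h0' : 0 < R' := by linarith
    refine ⟨(testFn_cut_div h0').sub (testFn_cut_div h0), fun t ht => ?_, fun t => ?_,
      fun t => ?_⟩
    · rw [cut_div_of_le h0' (by linarith), cut_div_of_le h0 ht.le, sub_self]
    · refine (norm_sub_le _ _).trans ?_
      linarith [norm_cut_le (t / R'), norm_cut_le (t / R)]
    · have h1 : deriv (fun t => cut (t / R') - cut (t / R)) t = _ :=
        (((testFn_cut_div h0').1.differentiable (by simp) t).hasDerivAt.sub
          ((testFn_cut_div h0).1.differentiable (by simp) t).hasDerivAt).deriv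
      rw [h1]
      have h2 := norm_sub_le (deriv (fun t => cut (t / R')) t) (deriv (fun t => cut (t / R)) t)
      nlinarith [hcut R' h0' t, hcut R h0 t, abs_nonneg t]
  refine ⟨N, E * A1 + A2 * (2 * D) * 2, by positivity, fun s ρ l hs hρ hl =>
    ⟨?_, fun ρ' hρ' => ?_⟩⟩
  · have hρ2 : 1 ≤ ρ ^ 2 := one_le_pow₀ hρ
    obtain ⟨t1, t2, t3, t4⟩ := hB 1 (ρ ^ 2) le_rfl hρ2
    have k1 := hf N l s (1 / 2) (2 * D) _ hl hs t1 le_rfl t2 t3 t4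
    have k2 := (hb l _ hl ((hce s hs.le).normalize le_rfl hE)).smul (E : ℂ)
    refine ((k2.add k1).mono le_rfl ?_).congr fun f hf => ?_
    · rw [Complex.norm_real, Real.norm_of_nonneg hE.le]
      apply le_of_eq; ring
    · have e1 := (hce s hs.le).testFn
      rw [Tp_smul_left hl e1 hf]
      have hEc : (E : ℂ) ≠ 0 := by exact_mod_cast hE.ne'
      push_cast
      rw [mul_inv_cancel_left₀ hEc, ← Tp_add_left hl e1 (t1.mul_right (contDiff_ch s)) hf, TT]
      congr 1; ext t
      rw [div_one]; ring
  · have hρ2 : 1 ≤ ρ ^ 2 := one_le_pow₀ hρ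
    have hρ2' : ρ ^ 2 ≤ ρ' ^ 2 := by gcongr
    obtain ⟨t1, t2, t3, t4⟩ := hB (ρ ^ 2) (ρ' ^ 2) hρ2 hρ2'
    have k1 := hf N l s (ρ ^ 2 / 2) (2 * D) _ hl hs t1 (by linarith) t2 t3 t4
    refine (k1.mono le_rfl ?_).congr fun f hf => ?_
    · rw [div_div_eq_mul_div]
      gcongr
      linarith [mul_nonneg hE.le hA1]
    · have e1 := (testFn_cut_div (R := ρ ^ 2) (by positivity)).mul_right (contDiff_ch s)
      rw [sub_eq_iff_eq_add, TT, TT, ← Tp_add_left hl (t1.mul_right (contDiff_ch s)) e1 hf]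
      congr 1; ext t
      ring

end TT

section Param

variable {M : SchwartzMap (ℝ × ℝ) ℂ →L[ℂ] ℂ}

lemma TestFn.exists_eq_zero {f : ℝ → ℂ} (hf : TestFn f) : ∃ B, 0 ≤ B ∧ ∀ u, B < |u| → f u = 0 := by
  obtain ⟨B, hB⟩ := hf.2.isCompact.isBounded.subset_closedBall 0
  refine ⟨|B|, abs_nonneg B, fun u hu => image_eq_zero_of_notMem_tsupport fun hm => ?_⟩
  have := hB hm
  rw [mem_closedBall_zero_iff, Real.norm_eq_abs] at this
  linarith [le_abs_self B]

lemma locSupp_scale {P : Type*} [NormedAddCommGroup P] {τ : P → ℝ} (hτ : ∀ p, |τ p| ≤ ‖p‖)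
    {f h : ℝ → ℂ} (hf : TestFn f) (hh : TestFn h) (w : P → ℝ → ℂ) :
    LocSupp (fun z : P × (ℝ × ℝ) => f (exp (τ z.1) * z.2.1) * w z.1 (exp (τ z.1) * z.2.1) *
      h (exp (τ z.1) ^ 2 * z.2.2)) := by
  obtain ⟨B, hB, hfB⟩ := hf.exists_eq_zero
  obtain ⟨B', hB', hhB⟩ := hh.exists_eq_zero
  intro R
  refine ⟨Metric.closedBall 0 ((B + B') * exp R ^ 2), isCompact_closedBall _ _, fun p hp x hx => ?_⟩
  rw [mem_closedBall_zero_iff, Prod.norm_def, not_le, lt_max_iff, Real.norm_eq_abs,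
    Real.norm_eq_abs] at hx
  have hR : 0 ≤ R := (norm_nonneg p).trans hp
  have h1 : exp (-R) ≤ exp (τ p) := exp_le_exp.2 (by linarith [neg_abs_le (τ p), hτ p])
  have h2 : exp (-R) * exp R = 1 := by rw [← exp_add]; simp
  have h3 : 1 ≤ exp R := one_le_exp hR
  have h4 := exp_pos (-R)
  have key : ∀ {b y : ℝ}, 0 ≤ b → b * exp R ^ 2 < |y| → b < |exp (τ p) ^ 2 * y| ∧
      b < |exp (τ p) * y| := by
    intro b y hb hy
    have hy0 : 0 ≤ |y| := abs_nonneg y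
    have e1 : b * exp R ≤ b * exp R ^ 2 := by
      have : exp R ≤ exp R ^ 2 := by nlinarith
      exact mul_le_mul_of_nonneg_left this hb
    constructor
    · rw [abs_mul, abs_of_pos (by positivity)]
      calc b = exp (-R) ^ 2 * (b * exp R ^ 2) := by
            rw [show exp (-R) ^ 2 * (b * exp R ^ 2) = b * (exp (-R) * exp R) ^ 2 by ring, h2]; ring
        _ < exp (-R) ^ 2 * |y| := by gcongr
        _ ≤ _ := by gcongr
    · rw [abs_mul, abs_of_pos (by positivity)]
      calc b = exp (-R) * (b * exp R) := by
            rw [show exp (-R) * (b * exp R) = b * (exp (-R) * exp R) by ring, h2]; ring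
        _ < exp (-R) * |y| := by gcongr; linarith
        _ ≤ _ := by gcongr
  rcases hx with hx | hx
  · have := (key (b := B) hB ((by gcongr; linarith : B * exp R ^ 2 ≤ _).trans_lt hx)).2
    simp only [hfB _ this, zero_mul]
  · have := (key (b := B') hB' ((by gcongr; linarith : B' * exp R ^ 2 ≤ _).trans_lt hx)).1
    simp only [hhB _ this, mul_zero]

lemma Tp_MX {l : ℝ} (hl : 0 < l) {h f : ℝ → ℂ} (hh : TestFn h) (hf : TestFn f) :
    Tp (MX M) l h f = Tp M l h (dZ f) := by
  rw [Tp, ap_MX _ (testFn_Tp hl hh hf), dX_tensor (hf.scale hl.ne') (hh.scale (pow_pos hl 2).ne'),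
    dZ_scale, Tp]

lemma Tp_MY {l : ℝ} (hl : 0 < l) {h f : ℝ → ℂ} (hh : TestFn h) (hf : TestFn f) :
    Tp (MY M) l h f = Tp M l (dZ h) f := by
  rw [Tp, ap_MY _ (testFn_Tp hl hh hf), dY_tensor (hf.scale hl.ne') (hh.scale (pow_pos hl 2).ne'),
    dZ_scale, Tp]

lemma hasDerivAt_Tp_exp {h f : ℝ → ℂ} (hh : TestFn h) (hf : TestFn f) (τ : ℝ) :
    HasDerivAt (fun τ => Tp M (exp τ) h f)
      (Tp (MX M) (exp τ) h f + 2 * Tp (MY M) (exp τ) h f) τ := by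
  have hΨ : ContDiff ℝ (⊤ : ℕ∞) (fun z : ℝ × (ℝ × ℝ) => f (exp z.1 * z.2.1) *
      h (exp z.1 ^ 2 * z.2.2)) :=
    (hf.1.comp ((contDiff_exp.comp contDiff_fst).mul (contDiff_fst.comp contDiff_snd))).mul
      (hh.1.comp (((contDiff_exp.comp contDiff_fst).pow 2).mul (contDiff_snd.comp contDiff_snd)))
  have hs := locSupp_scale (τ := fun t : ℝ => t) (fun p => le_rfl) hf hh fun _ _ => 1
  simp only [mul_one] at hs
  have key := ap_hasDerivAt M (Ψ := fun z : ℝ × (ℝ × ℝ) => f (exp z.1 * z.2.1) *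
      h (exp z.1 ^ 2 * z.2.2)) (Ψ' := fun z => dZ f (exp z.1 * z.2.1) * h (exp z.1 ^ 2 * z.2.2) +
      2 * (f (exp z.1 * z.2.1) * dZ h (exp z.1 ^ 2 * z.2.2))) hΨ hs (fun t x => ?_) τ
  · refine key.congr_deriv ?_
    rw [Tp_MX (exp_pos τ) hh hf, Tp_MY (exp_pos τ) hh hf, Tp, Tp,
      ← ap_smul M 2 (testFn_Tp (exp_pos τ) hh.dZ hf), ← ap_add M (testFn_Tp (exp_pos τ) hh hf.dZ)
      ((testFn_Tp (exp_pos τ) hh.dZ hf).smul 2)]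
  · have e1 : HasDerivAt (fun t => exp t * x.1) (exp t * x.1) t := (hasDerivAt_exp t).mul_const _
    have e2 : HasDerivAt (fun t => exp t ^ 2 * x.2) (2 * exp t * exp t * x.2) t := by
      simpa using ((hasDerivAt_exp t).pow 2).mul_const x.2
    have e3 := HasDerivAt.scomp t (h := fun t => exp t * x.1) (hf.hasDerivAt _) e1
    have e4 := HasDerivAt.scomp t (h := fun t => exp t ^ 2 * x.2) (hh.hasDerivAt _) e2
    refine (e3.mul e4).congr_deriv ?_
    simp only [dZ, Complex.real_smul, Function.comp_apply]
    push_cast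
    ring

variable {w w' : ℝ × ℝ → ℂ}

lemma continuous_Tp_exp {h f : ℝ → ℂ} (hh : TestFn h) (hf : TestFn f)
    (hw : ContDiff ℝ (⊤ : ℕ∞) w) :
    Continuous (fun p : ℝ × ℝ => Tp M (exp p.1) h (fun u => f u * w (p.2, u))) := by
  have hs := locSupp_scale (P := ℝ × ℝ) (τ := fun p => p.1) (fun p => norm_fst_le p) hf hh
    fun p u => w (p.2, u)
  refine ap_continuous M (P := ℝ × ℝ) ?_ hs
  have he : ContDiff ℝ (⊤ : ℕ∞) (fun z : (ℝ × ℝ) × (ℝ × ℝ) => exp z.1.1) :=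
    contDiff_exp.comp (contDiff_fst.comp contDiff_fst)
  have h1 : ContDiff ℝ (⊤ : ℕ∞) (fun z : (ℝ × ℝ) × (ℝ × ℝ) => exp z.1.1 * z.2.1) :=
    he.mul (contDiff_fst.comp contDiff_snd)
  have h2 : ContDiff ℝ (⊤ : ℕ∞) (fun z : (ℝ × ℝ) × (ℝ × ℝ) => exp z.1.1 ^ 2 * z.2.2) :=
    (he.pow 2).mul (contDiff_snd.comp contDiff_snd)
  exact ((hf.1.comp h1).mul (hw.comp ((contDiff_snd.comp contDiff_fst).prodMk h1))).mul
    (hh.1.comp h2)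

lemma hasDerivAt_Tp_right {l : ℝ} (hl : 0 < l) {h f : ℝ → ℂ} (hh : TestFn h) (hf : TestFn f)
    (hw : ContDiff ℝ (⊤ : ℕ∞) w) (hd : ∀ a u, HasDerivAt (fun a => w (a, u)) (w' (a, u)) a)
    (a : ℝ) : HasDerivAt (fun a => Tp M l h (fun u => f u * w (a, u)))
      (Tp M l h (fun u => f u * w' (a, u))) a := by
  refine ap_hasDerivAt M (Ψ := fun z : ℝ × (ℝ × ℝ) => f (l * z.2.1) * w (z.1, l * z.2.1) *
    h (l ^ 2 * z.2.2)) (Ψ' := fun z : ℝ × (ℝ × ℝ) => f (l * z.2.1) * w' (z.1, l * z.2.1) *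
    h (l ^ 2 * z.2.2)) ?_ ?_ (fun t x => ?_) a
  · have h1 : ContDiff ℝ (⊤ : ℕ∞) (fun z : ℝ × (ℝ × ℝ) => l * z.2.1) := by fun_prop
    exact ((hf.1.comp h1).mul (hw.comp (contDiff_fst.prodMk h1))).mul
      (hh.1.comp (contDiff_const.mul (contDiff_snd.comp contDiff_snd)))
  · intro R
    have ht := (testFn_Tp hl hh hf).2
    refine ⟨_, ht.isCompact, fun p _ x hx => ?_⟩
    have hz : f (l * x.1) * h (l ^ 2 * x.2) = 0 :=
      image_eq_zero_of_notMem_tsupport (f := fun p : ℝ × ℝ => f (l * p.1) * h (l ^ 2 * p.2)) hx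
    show f (l * x.1) * w (p, l * x.1) * h (l ^ 2 * x.2) = 0
    linear_combination w (p, l * x.1) * hz
  · exact ((hd t (l * x.1)).const_mul (f (l * x.1))).mul_const (h (l ^ 2 * x.2))

end Param

section Sym

/-- Continuous families with weight `(1+|a|)^{-k}`, Cauchy as the truncation is removed. -/
def G0 (k : ℕ) (f : ℝ → ℝ → ℝ → ℂ) : Prop :=
  (∀ ρ, 1 ≤ ρ → Continuous (fun p : ℝ × ℝ => f ρ p.1 p.2)) ∧ ∃ C, 0 ≤ C ∧
    (∀ ρ τ a, 1 ≤ ρ → ‖f ρ τ a‖ * (1 + |a|) ^ k ≤ C) ∧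
    ∀ ρ ρ' τ a, 1 ≤ ρ → ρ ≤ ρ' → ‖f ρ' τ a - f ρ τ a‖ ≤ C / ρ

/-- Families with `n` controlled derivatives of the types `∂_τ`, `∂_a`, `a∂_a`. -/
def GF : ℕ → ℕ → (ℝ → ℝ → ℝ → ℂ) → Prop
  | 0, k, f => G0 k f
  | n + 1, k, f => G0 k f ∧ ∃ f1 f2 f3, GF n k f1 ∧ GF n k f2 ∧ GF n k f3 ∧
      ∀ ρ τ a, 1 ≤ ρ → HasDerivAt (fun τ => f ρ τ a) (f1 ρ τ a) τ ∧
        HasDerivAt (fun a => f ρ τ a) (f2 ρ τ a) a ∧ a * f2 ρ τ a = f3 ρ τ a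

/-- Continuous functions with weight `(1+|a|)^{-k}`. -/
def C0 (k : ℕ) (f : ℝ → ℝ → ℂ) : Prop :=
  Continuous (fun p : ℝ × ℝ => f p.1 p.2) ∧ ∃ C, 0 ≤ C ∧ ∀ τ a, ‖f τ a‖ * (1 + |a|) ^ k ≤ C

/-- Functions with `n` controlled derivatives of the types `∂_τ`, `∂_a`, `a∂_a`. -/
def GC : ℕ → ℕ → (ℝ → ℝ → ℂ) → Prop
  | 0, k, f => C0 k f
  | n + 1, k, f => C0 k f ∧ ∃ f1 f2 f3, GC n k f1 ∧ GC n k f2 ∧ GC n k f3 ∧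
      ∀ τ a, HasDerivAt (fun τ => f τ a) (f1 τ a) τ ∧
        HasDerivAt (fun a => f τ a) (f2 τ a) a ∧ a * f2 τ a = f3 τ a

lemma GF.base {n k : ℕ} {f : ℝ → ℝ → ℝ → ℂ} (h : GF n k f) : G0 k f := by
  cases n with
  | zero => exact h
  | succ n => exact h.1

lemma GC.base {n k : ℕ} {f : ℝ → ℝ → ℂ} (h : GC n k f) : C0 k f := by
  cases n with
  | zero => exact h
  | succ n => exact h.1

lemma GC.pred {n k : ℕ} {f : ℝ → ℝ → ℂ} (h : GC (n + 1) k f) : GC n k f := by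
  induction n generalizing f with
  | zero => exact h.base
  | succ n ih =>
    obtain ⟨h0, f1, f2, f3, h1, h2, h3, hd⟩ := h
    exact ⟨h0, f1, f2, f3, ih h1, ih h2, ih h3, hd⟩

lemma G0.lin {k : ℕ} {f g : ℝ → ℝ → ℝ → ℂ} (hf : G0 k f) (hg : G0 k g) (c d : ℂ) :
    G0 k (fun ρ τ a => c * f ρ τ a + d * g ρ τ a) := by
  obtain ⟨fc, C, hC, f1, f2⟩ := hf
  obtain ⟨gc, D, hD, g1, g2⟩ := hg
  refine ⟨fun ρ hρ => (continuous_const.mul (fc ρ hρ)).add (continuous_const.mul (gc ρ hρ)),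
    ‖c‖ * C + ‖d‖ * D, by positivity, fun ρ τ a hρ => ?_, fun ρ ρ' τ a hρ hρ' => ?_⟩
  · calc _ ≤ (‖c‖ * ‖f ρ τ a‖ + ‖d‖ * ‖g ρ τ a‖) * (1 + |a|) ^ k := by
          gcongr
          refine (norm_add_le _ _).trans ?_
          rw [norm_mul, norm_mul]
      _ = ‖c‖ * (‖f ρ τ a‖ * (1 + |a|) ^ k) + ‖d‖ * (‖g ρ τ a‖ * (1 + |a|) ^ k) := by ring
      _ ≤ _ := add_le_add (mul_le_mul_of_nonneg_left (f1 ρ τ a hρ) (norm_nonneg _))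
          (mul_le_mul_of_nonneg_left (g1 ρ τ a hρ) (norm_nonneg _))
  · rw [show c * f ρ' τ a + d * g ρ' τ a - (c * f ρ τ a + d * g ρ τ a) =
      c * (f ρ' τ a - f ρ τ a) + d * (g ρ' τ a - g ρ τ a) by ring, add_div]
    refine (norm_add_le _ _).trans ?_
    rw [norm_mul, norm_mul, mul_div_assoc, mul_div_assoc]
    exact add_le_add (mul_le_mul_of_nonneg_left (f2 ρ ρ' τ a hρ hρ') (norm_nonneg _))
      (mul_le_mul_of_nonneg_left (g2 ρ ρ' τ a hρ hρ') (norm_nonneg _))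

lemma GF.lin {n k : ℕ} {f g : ℝ → ℝ → ℝ → ℂ} (hf : GF n k f) (hg : GF n k g) (c d : ℂ) :
    GF n k (fun ρ τ a => c * f ρ τ a + d * g ρ τ a) := by
  induction n generalizing f g with
  | zero => exact G0.lin hf hg c d
  | succ n ih =>
    obtain ⟨hf0, f1, f2, f3, k1, k2, k3, kd⟩ := hf
    obtain ⟨hg0, g1, g2, g3, l1, l2, l3, ld⟩ := hg
    refine ⟨hf0.lin hg0 c d, _, _, _, ih k1 l1, ih k2 l2, ih k3 l3, fun ρ τ a hρ => ?_⟩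
    obtain ⟨p1, p2, p3⟩ := kd ρ τ a hρ
    obtain ⟨q1, q2, q3⟩ := ld ρ τ a hρ
    refine ⟨(p1.const_mul c).add (q1.const_mul d), (p2.const_mul c).add (q2.const_mul d), ?_⟩
    rw [← p3, ← q3]; ring

lemma GC.lin {n k : ℕ} {f g : ℝ → ℝ → ℂ} (hf : GC n k f) (hg : GC n k g) (c d : ℂ) :
    GC n k (fun τ a => c * f τ a + d * g τ a) := by
  have base : ∀ {f g : ℝ → ℝ → ℂ}, C0 k f → C0 k g →
      C0 k (fun τ a => c * f τ a + d * g τ a) := by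
    rintro f g ⟨fc, C, hC, f1⟩ ⟨gc, D, hD, g1⟩
    refine ⟨(continuous_const.mul fc).add (continuous_const.mul gc),
      ‖c‖ * C + ‖d‖ * D, by positivity, fun τ a => ?_⟩
    calc _ ≤ (‖c‖ * ‖f τ a‖ + ‖d‖ * ‖g τ a‖) * (1 + |a|) ^ k := by
          gcongr
          refine (norm_add_le _ _).trans ?_
          rw [norm_mul, norm_mul]
      _ = ‖c‖ * (‖f τ a‖ * (1 + |a|) ^ k) + ‖d‖ * (‖g τ a‖ * (1 + |a|) ^ k) := by ring
      _ ≤ _ := add_le_add (mul_le_mul_of_nonneg_left (f1 τ a) (norm_nonneg _))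
          (mul_le_mul_of_nonneg_left (g1 τ a) (norm_nonneg _))
  induction n generalizing f g with
  | zero => exact base hf hg
  | succ n ih =>
    obtain ⟨hf0, f1, f2, f3, k1, k2, k3, kd⟩ := hf
    obtain ⟨hg0, g1, g2, g3, l1, l2, l3, ld⟩ := hg
    refine ⟨base hf0 hg0, _, _, _, ih k1 l1, ih k2 l2, ih k3 l3, fun τ a => ?_⟩
    obtain ⟨p1, p2, p3⟩ := kd τ a
    obtain ⟨q1, q2, q3⟩ := ld τ a
    refine ⟨(p1.const_mul c).add (q1.const_mul d), (p2.const_mul c).add (q2.const_mul d), ?_⟩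
    rw [← p3, ← q3]; ring

lemma GC.add {n k : ℕ} {f g : ℝ → ℝ → ℂ} (hf : GC n k f) (hg : GC n k g) :
    GC n k (fun τ a => f τ a + g τ a) := by
  simpa using hf.lin hg 1 1

lemma GC.weaken {n k : ℕ} {f : ℝ → ℝ → ℂ} (hf : GC n k f) : GC n 0 f := by
  have base : ∀ {f : ℝ → ℝ → ℂ}, C0 k f → C0 0 f := by
    rintro f ⟨fc, C, hC, f1⟩
    refine ⟨fc, C, hC, fun τ a => le_trans ?_ (f1 τ a)⟩
    rw [pow_zero]
    exact mul_le_mul_of_nonneg_left (one_le_pow₀ (by linarith [abs_nonneg a])) (norm_nonneg _)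
  induction n generalizing f with
  | zero => exact base hf
  | succ n ih =>
    obtain ⟨hf0, f1, f2, f3, k1, k2, k3, kd⟩ := hf
    exact ⟨base hf0, f1, f2, f3, ih k1, ih k2, ih k3, kd⟩

lemma GC.test_mul {n k : ℕ} {f : ℝ → ℝ → ℂ} {q : ℝ → ℂ} (hq : TestFn q) (hf : GC n k f) :
    GC n k (fun τ a => q a * f τ a) := by
  have base : ∀ {f : ℝ → ℝ → ℂ} {q : ℝ → ℂ}, TestFn q → C0 k f →
      C0 k (fun τ a => q a * f τ a) := by
    rintro f q hq ⟨fc, C, hC, f1⟩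
    obtain ⟨D, hD⟩ := hq.exists_CB 0
    refine ⟨(hq.1.continuous.comp continuous_snd).mul fc, D * C, mul_nonneg hD.nonneg hC,
      fun τ a => ?_⟩
    rw [norm_mul, mul_assoc]
    exact mul_le_mul (hD.norm_le a) (f1 τ a) (by positivity) hD.nonneg
  induction n generalizing f q with
  | zero => exact base hq hf
  | succ n ih =>
    have hp := hf.pred
    obtain ⟨hf0, f1, f2, f3, k1, k2, k3, kd⟩ := hf
    refine ⟨base hq hf0, _, _, _, ih hq k1, (ih hq.deriv hp).add (ih hq k2),
      (ih hq.dZ hp).add (ih hq k3), fun τ a => ?_⟩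
    obtain ⟨p1, p2, p3⟩ := kd τ a
    refine ⟨p1.const_mul _, (hq.hasDerivAt a).mul p2, ?_⟩
    rw [← p3, dZ]; ring

lemma GC.coord_mul {n : ℕ} {f : ℝ → ℝ → ℂ} (hf : GC n 1 f) :
    GC n 0 (fun τ a => (a : ℂ) * f τ a) := by
  have base : ∀ {f : ℝ → ℝ → ℂ}, C0 1 f → C0 0 (fun τ a => (a : ℂ) * f τ a) := by
    rintro f ⟨fc, C, hC, f1⟩
    refine ⟨(Complex.continuous_ofReal.comp continuous_snd).mul fc, C, hC,
      fun τ a => le_trans ?_ (f1 τ a)⟩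
    rw [norm_mul, pow_zero, pow_one, mul_one, Complex.norm_real, Real.norm_eq_abs]
    nlinarith [norm_nonneg (f τ a)]
  induction n generalizing f with
  | zero => exact base hf
  | succ n ih =>
    have hp := hf.pred
    obtain ⟨hf0, f1, f2, f3, k1, k2, k3, kd⟩ := hf
    refine ⟨base hf0, _, _, _, ih k1, (hp.add k3).weaken, (ih hp).add (ih k3), fun τ a => ?_⟩
    obtain ⟨p1, p2, p3⟩ := kd τ a
    refine ⟨p1.const_mul _, ((Complex.ofRealCLM.hasDerivAt (x := a)).mul p2).congr_deriv ?_, ?_⟩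
    · simp [p3]
    · rw [← p3]; ring

/-- `f` converges pointwise to `F` as the truncation is removed. -/
def Lim (f : ℝ → ℝ → ℝ → ℂ) (F : ℝ → ℝ → ℂ) : Prop :=
  ∀ τ a, Tendsto (fun m : ℕ => f (m + 1) τ a) atTop (𝓝 (F τ a))

lemma G0.exists_lim {k : ℕ} {f : ℝ → ℝ → ℝ → ℂ} (h : G0 k f) : ∃ F, Lim f F := by
  obtain ⟨-, C, hC, -, h2⟩ := h
  have : ∀ τ a, ∃ z, Tendsto (fun m : ℕ => f (m + 1) τ a) atTop (𝓝 z) := by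
    intro τ a
    refine cauchySeq_tendsto_of_complete (cauchySeq_of_le_tendsto_0' (fun m : ℕ => C / (m + 1))
      (fun m n hmn => ?_) ?_)
    · rw [dist_comm, dist_eq_norm]
      exact h2 _ _ τ a (by linarith [Nat.cast_nonneg (α := ℝ) m]) (by gcongr)
    · exact tendsto_const_div_atTop_nhds_zero_nat C |>.comp (tendsto_add_atTop_nat 1) |>.congr
        fun m => by simp
  choose F hF using this
  exact ⟨F, hF⟩

lemma G0.norm_sub_le {k : ℕ} {f : ℝ → ℝ → ℝ → ℂ} (h : G0 k f) {F : ℝ → ℝ → ℂ} (hF : Lim f F) :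
    ∃ C, 0 ≤ C ∧ ∀ ρ τ a, 1 ≤ ρ → ‖F τ a - f ρ τ a‖ ≤ C / ρ := by
  obtain ⟨-, C, hC, -, h2⟩ := h
  refine ⟨C, hC, fun ρ τ a hρ => ?_⟩
  refine le_of_tendsto ((hF τ a).sub_const (f ρ τ a)).norm ?_
  obtain ⟨n, hn⟩ := exists_nat_ge ρ
  filter_upwards [eventually_ge_atTop n] with m hm
  refine h2 _ _ τ a hρ ?_
  have : (n : ℝ) ≤ m := by exact_mod_cast hm
  linarith

lemma G0.tendstoUniformly {k : ℕ} {f : ℝ → ℝ → ℝ → ℂ} (h : G0 k f) {F : ℝ → ℝ → ℂ}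
    (hF : Lim f F) : TendstoUniformly (fun (m : ℕ) (p : ℝ × ℝ) => f (m + 1) p.1 p.2)
      (fun p => F p.1 p.2) atTop := by
  obtain ⟨C, hC, h⟩ := h.norm_sub_le hF
  rw [Metric.tendstoUniformly_iff]
  intro ε hε
  have h1 : Tendsto (fun m : ℕ => C / ((m : ℝ) + 1)) atTop (𝓝 0) :=
    tendsto_const_div_atTop_nhds_zero_nat C |>.comp (tendsto_add_atTop_nat 1) |>.congr
        fun m => by simp
  filter_upwards [h1.eventually (gt_mem_nhds hε)] with m hm p
  rw [dist_eq_norm]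
  exact (h _ p.1 p.2 (by linarith [Nat.cast_nonneg (α := ℝ) m])).trans_lt hm

theorem GF.lim {n k : ℕ} {f : ℝ → ℝ → ℝ → ℂ} (h : GF n k f) {F : ℝ → ℝ → ℂ} (hF : Lim f F) :
    GC n k F := by
  have one : ∀ m : ℕ, (1 : ℝ) ≤ m + 1 := fun m => by linarith [Nat.cast_nonneg (α := ℝ) m]
  have base : ∀ {f : ℝ → ℝ → ℝ → ℂ} {F : ℝ → ℝ → ℂ}, G0 k f → Lim f F → C0 k F := by
    intro f F h hF
    refine ⟨(h.tendstoUniformly hF).continuous (Frequently.of_forall fun m => h.1 _ (one m)), ?_⟩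
    obtain ⟨-, C, hC, h1, -⟩ := h
    exact ⟨C, hC, fun τ a => le_of_tendsto' ((hF τ a).norm.mul_const _)
      fun m => h1 _ τ a (one m)⟩
  induction n generalizing f F with
  | zero => exact base h hF
  | succ n ih =>
    obtain ⟨h0, f1, f2, f3, k1, k2, k3, kd⟩ := h
    obtain ⟨F1, hF1⟩ := k1.base.exists_lim
    obtain ⟨F2, hF2⟩ := k2.base.exists_lim
    obtain ⟨F3, hF3⟩ := k3.base.exists_lim
    refine ⟨base h0 hF, F1, F2, F3, ih k1 hF1, ih k2 hF2, ih k3 hF3, fun τ a => ⟨?_, ?_, ?_⟩⟩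
    · exact hasDerivAt_of_tendstoUniformly
        ((k1.base.tendstoUniformly hF1).comp fun τ => (τ, a))
        (Eventually.of_forall fun m τ => (kd _ τ a (one m)).1) (fun τ => hF τ a) τ
    · exact hasDerivAt_of_tendstoUniformly
        ((k2.base.tendstoUniformly hF2).comp fun a => (τ, a))
        (Eventually.of_forall fun m a => (kd _ τ a (one m)).2.1) (fun a => hF τ a) a
    · exact tendsto_nhds_unique ((hF2 τ a).const_mul (a : ℂ))
        ((hF3 τ a).congr fun m => ((kd _ τ a (one m)).2.2).symm)

end Sym

section TTcalc

variable {M : SchwartzMap (ℝ × ℝ) ℂ →L[ℂ] ℂ} {s ρ l : ℝ}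

lemma testFn_cut_mul_ch (s : ℝ) (hρ : 0 < ρ) : TestFn (fun t => cut (t / ρ ^ 2) * ch s t) :=
  (testFn_cut_div (pow_pos hρ 2)).mul_right (contDiff_ch s)

lemma TT_add (hρ : 0 < ρ) (hl : 0 < l) {f g : ℝ → ℂ} (hf : TestFn f) (hg : TestFn g) :
    TT M s ρ l (fun u => f u + g u) = TT M s ρ l f + TT M s ρ l g :=
  Tp_add_right hl (testFn_cut_mul_ch s hρ) hf hg

lemma TT_smul (hρ : 0 < ρ) (hl : 0 < l) {f : ℝ → ℂ} (hf : TestFn f) (c : ℂ) :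
    TT M s ρ l (fun u => c * f u) = c * TT M s ρ l f :=
  Tp_smul_right hl (testFn_cut_mul_ch s hρ) hf c

lemma TT_lin (hρ : 0 < ρ) (hl : 0 < l) {f g : ℝ → ℂ} (hf : TestFn f) (hg : TestFn g) (c d : ℂ) :
    TT M s ρ l (fun u => c * f u + d * g u) = c * TT M s ρ l f + d * TT M s ρ l g := by
  rw [TT_add hρ hl (hf.smul c) (hg.smul d), TT_smul hρ hl hf, TT_smul hρ hl hg]

lemma TT_MX (hρ : 0 < ρ) (hl : 0 < l) {f : ℝ → ℂ} (hf : TestFn f) :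
    TT (MX M) s ρ l f = TT M s ρ l (dZ f) :=
  Tp_MX hl (testFn_cut_mul_ch s hρ) hf

/-- Integration by parts along the first variable against a modulation. -/
lemma TT_mul_dZ (hρ : 0 < ρ) (hl : 0 < l) {f : ℝ → ℂ} (hf : TestFn f) {w w' : ℝ → ℂ}
    (hw : ContDiff ℝ (⊤ : ℕ∞) w) (hd : ∀ u, HasDerivAt w (w' u) u) :
    TT M s ρ l (fun u => f u * ((u : ℂ) * w' u)) =
      1 * TT (MX M) s ρ l (fun u => f u * w u) + -1 * TT M s ρ l (fun u => dZ f u * w u) := by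
  rw [TT_MX hρ hl (hf.mul_right hw), ← TT_lin hρ hl (hf.mul_right hw).dZ (hf.dZ.mul_right hw)]
  congr 1
  ext u
  have h : deriv (fun u => f u * w u) u = _ := ((hf.hasDerivAt u).mul (hd u)).deriv
  rw [dZ, h, dZ]
  ring

end TTcalc

section S

variable {M : SchwartzMap (ℝ × ℝ) ℂ →L[ℂ] ℂ} {s : ℝ}

lemma CZ1.exists_norm_test_mul_ch_le (N : ℕ) {g : ℝ → ℂ} (hg : TestFn g)
    (g1 : ∀ u, 1 < |u| → g u = 0) : ∃ C, 0 ≤ C ∧ ∀ A T, CZ1 N A T → ∀ a,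
      ‖T (fun u => g u * ch a u)‖ ≤ C * A := by
  obtain ⟨C, hC, h⟩ := CZ1.exists_norm_mul_ch_le N
  obtain ⟨D, hD⟩ := exists_CN_of_smooth hg.1 g1 (N + 1)
  have h0 : (0 : ℝ) < max D 1 := lt_max_of_lt_right one_pos
  have h0' : ((max D 1 : ℝ) : ℂ) ≠ 0 := by exact_mod_cast h0.ne'
  have hn := hD.normalize (le_max_left D 1) h0
  refine ⟨max D 1 * C, by positivity, fun A T hT a => ?_⟩
  have h1 := h A T hT _ a hn
  have h2 : T (fun u => g u * ch a u) = ((max D 1 : ℝ) : ℂ) *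
      T (fun u => (((max D 1)⁻¹ : ℝ) : ℂ) * g u * ch a u) := by
    rw [← hT.2.1 _ _ (hn.testFn.mul_right (contDiff_ch a))]
    congr 1
    ext u
    push_cast
    field_simp
  rw [h2, norm_mul, Complex.norm_real, Real.norm_of_nonneg h0.le, mul_assoc]
  exact mul_le_mul_of_nonneg_left h1 h0.le

/-- The contribution of bounded `u`. -/
def SS (M : SchwartzMap (ℝ × ℝ) ℂ →L[ℂ] ℂ) (s : ℝ) (g : ℝ → ℂ) (ρ τ a : ℝ) : ℂ :=
  TT M s ρ (exp τ) (fun u => g u * ch a u)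

lemma contDiff_ch_uncurry : ContDiff ℝ (⊤ : ℕ∞) (fun p : ℝ × ℝ => ch p.1 p.2) :=
  ContDiff.eI (by fun_prop)

lemma SS_G0 (hs : |s| = 1) (hM : Ker M) {g : ℝ → ℂ} (hg : TestFn g)
    (g1 : ∀ u, 1 < |u| → g u = 0) : G0 0 (SS M s g) := by
  obtain ⟨N, A, hA, hT⟩ := hM.exists_CZ1_TT
  obtain ⟨C, hC, h⟩ := CZ1.exists_norm_test_mul_ch_le N hg g1
  refine ⟨fun ρ hρ => ?_, C * A, by positivity, fun ρ τ a hρ => ?_, fun ρ ρ' τ a hρ hρ' => ?_⟩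
  · exact continuous_Tp_exp (testFn_cut_mul_ch s (one_pos.trans_le hρ)) hg contDiff_ch_uncurry
  · rw [pow_zero, mul_one]
    exact h _ _ (hT s ρ _ hs hρ (exp_pos τ)).1 a
  · refine (h _ _ ((hT s ρ _ hs hρ (exp_pos τ)).2 ρ' hρ') a).trans ?_
    rw [← mul_div_assoc]
    refine div_le_div_of_nonneg_left (by positivity) (by positivity) ?_
    nlinarith

theorem SS_GF (hs : |s| = 1) (hM : Ker M) {g : ℝ → ℂ} (hg : TestFn g)
    (g1 : ∀ u, 1 < |u| → g u = 0) (n : ℕ) : GF n 0 (SS M s g) := by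
  induction n generalizing M g with
  | zero => exact SS_G0 hs hM hg g1
  | succ n ih =>
    have hsm : ContDiff ℝ (⊤ : ℕ∞) (fun u : ℝ => (-(2 * π * Complex.I) * u : ℂ)) :=
      contDiff_const.mul (contDiff_ofReal_comp contDiff_id)
    have hd1 : ∀ u, 1 < |u| → dZ g u = 0 := by
      intro u hu
      have : g =ᶠ[𝓝 u] fun _ => 0 := by
        filter_upwards [(isOpen_lt continuous_const continuous_abs).mem_nhds hu] with v hv
        exact g1 v hv
      rw [dZ, this.deriv_eq]; simp
    refine ⟨SS_G0 hs hM hg g1, _, _, _, (ih hM.MX hg g1).lin (ih hM.MY hg g1) 1 2,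
      ih hM (g := fun u => g u * (-(2 * π * Complex.I) * u)) (hg.mul_right hsm)
        (fun u hu => by rw [g1 u hu, zero_mul]),
      (ih hM.MX hg g1).lin (ih hM hg.dZ hd1) 1 (-1), fun ρ τ a hρ => ?_⟩
    have hρ0 := one_pos.trans_le hρ
    have hh := testFn_cut_mul_ch s hρ0
    refine ⟨?_, ?_, ?_⟩
    · rw [one_mul]
      exact hasDerivAt_Tp_exp hh (hg.mul_right (contDiff_ch a)) τ
    · have := hasDerivAt_Tp_right (M := M) (exp_pos τ) hh hg contDiff_ch_uncurry
        (w' := fun p => -(2 * π * Complex.I) * p.2 * ch p.1 p.2) (fun a u => ?_) a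
      · simpa only [SS, TT, mul_assoc] using this
      · have h1 : HasDerivAt (fun a => ch a u) _ a :=
          (((hasDerivAt_id a).const_mul (-2 * π)).mul_const u).eI
        refine h1.congr_deriv ?_
        simp only [ch, id]
        push_cast
        ring
    · have := TT_mul_dZ (M := M) (s := s) hρ0 (exp_pos τ) hg (contDiff_ch a) (hasDerivAt_ch a)
      simp only [SS]
      rw [← this, ← TT_smul hρ0 (exp_pos τ) ((hg.mul_right hsm).mul_right (contDiff_ch a))]
      congr 1
      ext u
      ring

end S

section Amp

/-- Amplitude families: vanishing near zero and independent of the truncation `ρ` for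
`|u| < ρ / 2`. -/
def Amp0 (b : ℝ → ℝ → ℂ) : Prop :=
  (∀ ρ, 1 ≤ ρ → TestFn (b ρ)) ∧ (∀ ρ u, 1 ≤ ρ → |u| < 1 / 2 → b ρ u = 0) ∧
  (∀ ρ ρ' u, 1 ≤ ρ → ρ ≤ ρ' → |u| < ρ / 2 → b ρ' u = b ρ u) ∧
  ∃ C, 0 ≤ C ∧ ∀ ρ u, 1 ≤ ρ → ‖b ρ u‖ ≤ C

/-- Amplitude families with `n` controlled homogeneous derivatives. -/
def Amp : ℕ → (ℝ → ℝ → ℂ) → Prop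
  | 0, b => Amp0 b
  | n + 1, b => Amp0 b ∧ Amp n (fun ρ => dZ (b ρ))

variable {b : ℝ → ℝ → ℂ}

lemma Amp.base {n : ℕ} (h : Amp n b) : Amp0 b := by
  cases n with
  | zero => exact h
  | succ n => exact h.1

lemma Amp.pred {n : ℕ} (h : Amp (n + 1) b) : Amp n b := by
  induction n generalizing b with
  | zero => exact h.base
  | succ n ih => exact ⟨h.1, ih h.2⟩

lemma Amp0.lin {b' : ℝ → ℝ → ℂ} (h : Amp0 b) (h' : Amp0 b') (c d : ℂ) :
    Amp0 (fun ρ u => c * b ρ u + d * b' ρ u) := by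
  obtain ⟨h1, h2, h3, C, hC, h4⟩ := h
  obtain ⟨k1, k2, k3, D, hD, k4⟩ := h'
  refine ⟨fun ρ hρ => ((h1 ρ hρ).smul c).add ((k1 ρ hρ).smul d), fun ρ u hρ hu => ?_,
    fun ρ ρ' u hρ hρ' hu => ?_, ‖c‖ * C + ‖d‖ * D, by positivity, fun ρ u hρ => ?_⟩
  · simp only [h2 ρ u hρ hu, k2 ρ u hρ hu]; ring
  · simp only [h3 ρ ρ' u hρ hρ' hu, k3 ρ ρ' u hρ hρ' hu]
  · refine (norm_add_le _ _).trans ?_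
    rw [norm_mul, norm_mul]
    exact add_le_add (mul_le_mul_of_nonneg_left (h4 ρ u hρ) (norm_nonneg _))
      (mul_le_mul_of_nonneg_left (k4 ρ u hρ) (norm_nonneg _))

lemma Amp0.congr {b' : ℝ → ℝ → ℂ} (h : Amp0 b) (e : ∀ ρ, 1 ≤ ρ → b' ρ = b ρ) : Amp0 b' := by
  obtain ⟨h1, h2, h3, C, hC, h4⟩ := h
  refine ⟨fun ρ hρ => e ρ hρ ▸ h1 ρ hρ, fun ρ u hρ hu => e ρ hρ ▸ h2 ρ u hρ hu,
    fun ρ ρ' u hρ hρ' hu => e ρ hρ ▸ e ρ' (hρ.trans hρ') ▸ h3 ρ ρ' u hρ hρ' hu, C, hC,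
    fun ρ u hρ => e ρ hρ ▸ h4 ρ u hρ⟩

lemma Amp.congr {n : ℕ} {b' : ℝ → ℝ → ℂ} (h : Amp n b) (e : ∀ ρ, 1 ≤ ρ → b' ρ = b ρ) :
    Amp n b' := by
  induction n generalizing b b' with
  | zero => exact Amp0.congr h e
  | succ n ih => exact ⟨h.1.congr e, ih h.2 fun ρ hρ => by rw [e ρ hρ]⟩

lemma Amp.lin {n : ℕ} {b' : ℝ → ℝ → ℂ} (h : Amp n b) (h' : Amp n b') (c d : ℂ) :
    Amp n (fun ρ u => c * b ρ u + d * b' ρ u) := by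
  induction n generalizing b b' with
  | zero => exact Amp0.lin h h' c d
  | succ n ih =>
    refine ⟨h.1.lin h'.1 c d, (ih h.2 h'.2).congr fun ρ hρ => ?_⟩
    ext u
    have e : deriv (fun u => c * b ρ u + d * b' ρ u) u = _ :=
      ((((h.1.1 ρ hρ).hasDerivAt u).const_mul c).add
        (((h'.1.1 ρ hρ).hasDerivAt u).const_mul d)).deriv
    rw [dZ, e, dZ, dZ]
    ring

/-- Division by the coordinate. -/
def dv (f : ℝ → ℂ) (u : ℝ) : ℂ := (u : ℂ)⁻¹ * f u

lemma contDiff_dv {f : ℝ → ℂ} (hf : TestFn f) {ε : ℝ} (hε : 0 < ε) (h0 : ∀ u, |u| < ε → f u = 0) :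
    ContDiff ℝ (⊤ : ℕ∞) (dv f) := by
  rw [contDiff_iff_contDiffAt]
  intro u
  rcases eq_or_ne u 0 with rfl | hu
  · have : dv f =ᶠ[𝓝 0] fun _ => 0 := by
      filter_upwards [Metric.ball_mem_nhds (0 : ℝ) hε] with v hv
      rw [dv, h0 v (by simpa using hv), mul_zero]
    exact contDiffAt_const.congr_of_eventuallyEq this
  · exact (((contDiff_ofReal_comp contDiff_id).contDiffAt).inv (by simpa using hu)).mul
      hf.1.contDiffAt

lemma testFn_dv {f : ℝ → ℂ} (hf : TestFn f) {ε : ℝ} (hε : 0 < ε) (h0 : ∀ u, |u| < ε → f u = 0) :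
    TestFn (dv f) := ⟨contDiff_dv hf hε h0, hf.2.mul_left⟩

lemma dZ_dv {f : ℝ → ℂ} (hf : TestFn f) :
    dZ (dv f) = fun u => 1 * dv (dZ f) u + -1 * dv f u := by
  ext u
  rcases eq_or_ne u 0 with rfl | hu
  · simp [dZ, dv]
  · have hu' : (u : ℂ) ≠ 0 := by exact_mod_cast hu
    have h1 : HasDerivAt (fun u : ℝ => (u : ℂ)⁻¹) (-1 / (u : ℂ) ^ 2) u := by
      exact ((Complex.ofRealCLM.hasDerivAt (x := u)).inv hu').congr_deriv (by simp)
    have h2 : deriv (dv f) u = _ := (h1.mul (hf.hasDerivAt u)).deriv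
    rw [dZ, h2, dv, dv, dZ]
    field_simp
    ring

lemma Amp0.dv (h : Amp0 b) : Amp0 (fun ρ => dv (b ρ)) := by
  obtain ⟨h1, h2, h3, C, hC, h4⟩ := h
  refine ⟨fun ρ hρ => testFn_dv (h1 ρ hρ) one_half_pos fun u => h2 ρ u hρ, fun ρ u hρ hu => ?_,
    fun ρ ρ' u hρ hρ' hu => ?_, 2 * C, by positivity, fun ρ u hρ => ?_⟩
  · simp only [_root_.dv, h2 ρ u hρ hu, mul_zero]
  · simp only [_root_.dv, h3 ρ ρ' u hρ hρ' hu]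
  · simp only [_root_.dv]
    by_cases hu : |u| < 1 / 2
    · rw [h2 ρ u hρ hu, mul_zero, norm_zero]; positivity
    · rw [norm_mul, norm_inv, Complex.norm_real, Real.norm_eq_abs]
      have : |u|⁻¹ ≤ 2 := by
        rw [inv_le_comm₀ (by linarith) two_pos]; linarith
      exact mul_le_mul this (h4 ρ u hρ) (norm_nonneg _) two_pos.le

lemma Amp.dv {n : ℕ} (h : Amp n b) : Amp n (fun ρ => dv (b ρ)) := by
  induction n generalizing b with
  | zero => exact Amp0.dv h
  | succ n ih =>
    refine ⟨h.1.dv, ((ih h.2).lin (ih h.pred) 1 (-1)).congr fun ρ hρ => ?_⟩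
    exact dZ_dv (h.1.1 ρ hρ)

end Amp

section TTparts

variable {M : SchwartzMap (ℝ × ℝ) ℂ →L[ℂ] ℂ} {s ρ l : ℝ}

/-- Integration by parts along the first variable away from zero. -/
lemma TT_mul_deriv (hρ : 0 < ρ) (hl : 0 < l) {b : ℝ → ℂ} (hb : TestFn b) {ε : ℝ} (hε : 0 < ε)
    (b0 : ∀ u, |u| < ε → b u = 0) {W W' : ℝ → ℂ}
    (hW : ContDiff ℝ (⊤ : ℕ∞) W) (hd : ∀ u, HasDerivAt W (W' u) u) (v : ℝ) :
    TT M s ρ l (fun u => b u * W' (u + v)) =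
      1 * TT (MX M) s ρ l (fun u => dv b u * W (u + v)) +
        1 * TT M s ρ l (fun u => (1 * dv b u + -1 * dv (dZ b) u) * W (u + v)) := by
  have hWv : ContDiff ℝ (⊤ : ℕ∞) (fun u => W (u + v)) := hW.comp (by fun_prop)
  have hdv : ∀ u, HasDerivAt (fun u => W (u + v)) (W' (u + v)) u := fun u =>
    (hd (u + v)).comp_add_const u v
  have hdb := testFn_dv hb hε b0
  have h1 := TT_mul_dZ (M := M) (s := s) hρ hl hdb hWv hdv
  have h2 : (fun u => b u * W' (u + v)) = fun u => dv b u * ((u : ℂ) * W' (u + v)) := by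
    ext u
    rcases eq_or_ne u 0 with rfl | hu
    · simp [dv, b0 0 (by simpa using hε)]
    · have hu' : (u : ℂ) ≠ 0 := by exact_mod_cast hu
      rw [dv]; field_simp
  rw [h2, h1, dZ_dv hb]
  have h3 : TestFn (fun u => (1 * dv (dZ b) u + -1 * dv b u) * W (u + v)) := by
    have := hdb.dZ.mul_right hWv
    rwa [dZ_dv hb] at this
  rw [one_mul (TT M s ρ l _), ← TT_smul hρ hl h3]
  congr 2
  ext u
  ring

end TTparts

section J

variable {M : SchwartzMap (ℝ × ℝ) ℂ →L[ℂ] ℂ} {s κ c₁ : ℝ}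

/-- The contribution of large `u`, with the stationary phase `κ (u + c₁ a)²`. -/
def JJ (M : SchwartzMap (ℝ × ℝ) ℂ →L[ℂ] ℂ) (s κ c₁ : ℝ) (b : ℝ → ℝ → ℂ) (ρ τ a : ℝ) : ℂ :=
  TT M s ρ (exp τ) (fun u => b ρ u * Gam κ (u + c₁ * a))

lemma contDiff_Gam_uncurry :
    ContDiff ℝ (⊤ : ℕ∞) (fun p : ℝ × ℝ => Gam κ (p.2 + c₁ * p.1)) :=
  ContDiff.eI (by fun_prop)

lemma contDiff_Gam_shift (v : ℝ) : ContDiff ℝ (⊤ : ℕ∞) (fun u : ℝ => Gam κ (u + v)) :=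
  ContDiff.eI (by fun_prop)

lemma JJ_G0 (hs : |s| = 1) (hκ : κ ≠ 0) (hc : c₁ ≠ 0) (hM : Ker M) {b : ℝ → ℝ → ℂ}
    (hb : Amp 1 b) : G0 1 (JJ M s κ c₁ b) := by
  obtain ⟨N, A, hA, hT⟩ := hM.exists_CZ1_TT
  obtain ⟨C, hC, h⟩ := CZ1.exists_norm_mul_Gam_le hκ
  obtain ⟨⟨b1, b2, b3, β₁, hβ₁, b4⟩, -, -, -, β₂, hβ₂, b5⟩ := hb
  obtain ⟨β, hβ, bb, bd⟩ : ∃ β, 0 ≤ β ∧ (∀ ρ u, 1 ≤ ρ → ‖b ρ u‖ ≤ β) ∧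
      ∀ ρ u, 1 ≤ ρ → ‖deriv (b ρ) u‖ * |u| ≤ β := by
    refine ⟨max β₁ β₂, hβ₁.trans (le_max_left _ _), fun ρ u hρ =>
      (b4 ρ u hρ).trans (le_max_left _ _), fun ρ u hρ => ?_⟩
    have := (b5 ρ u hρ).trans (le_max_right β₁ β₂)
    simp only [dZ] at this
    rwa [norm_mul, Complex.norm_real, Real.norm_eq_abs, mul_comm] at this
  have hK : ∀ a : ℝ, 1 + |a| ≤ (1 + 1 / |c₁|) * (1 + |c₁ * a|) := by
    intro a
    have h0 : 0 < |c₁| := abs_pos.2 hc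
    rw [abs_mul, show (1 + 1 / |c₁|) * (1 + |c₁| * |a|) =
      1 + |a| + |c₁| * |a| + 1 / |c₁| by field_simp; ring]
    have : 0 ≤ |c₁| * |a| + 1 / |c₁| := by positivity
    linarith
  have hK0 : 0 ≤ 1 + 1 / |c₁| := by positivity
  refine ⟨fun ρ hρ => ?_, (1 + 1 / |c₁|) * (C * (A * β)) + 5 * (C * (A * β)), by positivity,
    fun ρ τ a hρ => ?_, fun ρ ρ' τ a hρ hρ' => ?_⟩
  · exact continuous_Tp_exp (testFn_cut_mul_ch s (one_pos.trans_le hρ)) (b1 ρ hρ)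
      contDiff_Gam_uncurry
  · have h1 := h N A β (1 / 2) _ (hT s ρ _ hs hρ (exp_pos τ)).1 le_rfl (b ρ) (c₁ * a) (b1 ρ hρ)
      (fun u => b2 ρ u hρ) (fun u => bb ρ u hρ) (fun u => bd ρ u hρ)
    change ‖JJ M s κ c₁ b ρ τ a‖ * _ ≤ _ at h1
    rw [pow_one]
    calc ‖JJ M s κ c₁ b ρ τ a‖ * (1 + |a|)
        ≤ ‖JJ M s κ c₁ b ρ τ a‖ * ((1 + 1 / |c₁|) * (1 + |c₁ * a| + 1 / 2)) := by
          refine mul_le_mul_of_nonneg_left ((hK a).trans ?_) (norm_nonneg _)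
          exact mul_le_mul_of_nonneg_left (by linarith) hK0
      _ = (1 + 1 / |c₁|) * (‖JJ M s κ c₁ b ρ τ a‖ * (1 + |c₁ * a| + 1 / 2)) := by ring
      _ ≤ (1 + 1 / |c₁|) * (C * (A * β)) := mul_le_mul_of_nonneg_left h1 hK0
      _ ≤ _ := by linarith [show 0 ≤ 5 * (C * (A * β)) by positivity]
  · have hρ0 := one_pos.trans_le hρ
    have hρ1 := hρ.trans hρ'
    have hT0 := hT s ρ _ hs hρ (exp_pos τ)
    have h1 := h N (A / ρ ^ 2) β (1 / 2) _ (hT0.2 ρ' hρ') le_rfl (b ρ') (c₁ * a) (b1 ρ' hρ1)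
      (fun u => b2 ρ' u hρ1) (fun u => bb ρ' u hρ1) (fun u => bd ρ' u hρ1)
    have ht : TestFn (fun u => b ρ' u - b ρ u) := (b1 ρ' hρ1).sub (b1 ρ hρ)
    have h2 := h N A (2 * β) (ρ / 2) _ hT0.1 (by linarith) (fun u => b ρ' u - b ρ u) (c₁ * a) ht
      (fun u hu => by rw [b3 ρ ρ' u hρ hρ' hu, sub_self])
      (fun u => (norm_sub_le _ _).trans (by linarith [bb ρ' u hρ1, bb ρ u hρ])) (fun u => by
        have e : deriv (fun u => b ρ' u - b ρ u) u = _ :=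
          (((b1 ρ' hρ1).hasDerivAt u).sub ((b1 ρ hρ).hasDerivAt u)).deriv
        rw [e]
        refine (mul_le_mul_of_nonneg_right (norm_sub_le _ _) (abs_nonneg u)).trans ?_
        linarith [bd ρ' u hρ1, bd ρ u hρ])
    have e : JJ M s κ c₁ b ρ' τ a - JJ M s κ c₁ b ρ τ a =
        (TT M s ρ' (exp τ) (fun u => b ρ' u * Gam κ (u + c₁ * a)) -
          TT M s ρ (exp τ) (fun u => b ρ' u * Gam κ (u + c₁ * a))) +
        TT M s ρ (exp τ) (fun u => (b ρ' u - b ρ u) * Gam κ (u + c₁ * a)) := by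
      have e1 := TT_lin (M := M) (s := s) hρ0 (exp_pos τ)
        ((b1 ρ' hρ1).mul_right (contDiff_Gam_shift (κ := κ) (c₁ * a)))
        ((b1 ρ hρ).mul_right (contDiff_Gam_shift (κ := κ) (c₁ * a))) 1 (-1)
      have e2 : (fun u => (b ρ' u - b ρ u) * Gam κ (u + c₁ * a)) = fun u =>
          1 * (b ρ' u * Gam κ (u + c₁ * a)) + -1 * (b ρ u * Gam κ (u + c₁ * a)) := by
        ext u; ring
      rw [e2, e1, JJ, JJ]
      ring
    rw [e]
    refine (norm_add_le _ _).trans ?_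
    have g1 : ‖TT M s ρ' (exp τ) (fun u => b ρ' u * Gam κ (u + c₁ * a)) -
          TT M s ρ (exp τ) (fun u => b ρ' u * Gam κ (u + c₁ * a))‖ ≤ C * (A * β) / ρ := by
      have : C * (A / ρ ^ 2 * β) ≤ C * (A * β) / ρ := by
        rw [show C * (A / ρ ^ 2 * β) = C * (A * β) / ρ ^ 2 by ring]
        refine div_le_div_of_nonneg_left (by positivity) (by positivity) ?_
        nlinarith
      refine le_trans ?_ this
      refine le_trans ?_ h1
      exact le_mul_of_one_le_right (norm_nonneg _) (by linarith [abs_nonneg (c₁ * a)])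
    have g2 : ‖TT M s ρ (exp τ) (fun u => (b ρ' u - b ρ u) * Gam κ (u + c₁ * a))‖ ≤
        4 * (C * (A * β)) / ρ := by
      rw [le_div_iff₀ hρ0]
      have h3 : ‖TT M s ρ (exp τ) (fun u => (b ρ' u - b ρ u) * Gam κ (u + c₁ * a))‖ * (ρ / 2) ≤
          C * (A * (2 * β)) := le_trans (mul_le_mul_of_nonneg_left
            (by linarith [abs_nonneg (c₁ * a)]) (norm_nonneg _)) h2
      linarith
    calc _ ≤ C * (A * β) / ρ + 4 * (C * (A * β)) / ρ := add_le_add g1 g2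
      _ = 5 * (C * (A * β)) / ρ := by ring
      _ ≤ _ := by
        refine div_le_div_of_nonneg_right ?_ hρ0.le
        linarith [show 0 ≤ (1 + 1 / |c₁|) * (C * (A * β)) by positivity]

/-- The first derivative of the Gaussian phase. -/
def Gam1 (κ w : ℝ) : ℂ := 2 * κ * w * Complex.I * Gam κ w

/-- The second derivative of the Gaussian phase. -/
def Gam2 (κ w : ℝ) : ℂ := 2 * κ * Complex.I * Gam κ w + 2 * κ * w * Complex.I * Gam1 κ w

lemma contDiff_Gam1 (κ : ℝ) : ContDiff ℝ (⊤ : ℕ∞) (Gam1 κ) :=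
  ((contDiff_const.mul (contDiff_ofReal_comp contDiff_id)).mul contDiff_const).mul (contDiff_Gam κ)

lemma contDiff_Gam2 (κ : ℝ) : ContDiff ℝ (⊤ : ℕ∞) (Gam2 κ) :=
  (contDiff_const.mul (contDiff_Gam κ)).add
    (((contDiff_const.mul (contDiff_ofReal_comp contDiff_id)).mul contDiff_const).mul
      (contDiff_Gam1 κ))

lemma hasDerivAt_Gam1 (κ w : ℝ) : HasDerivAt (Gam1 κ) (Gam2 κ w) w := by
  have h := ((((Complex.ofRealCLM.hasDerivAt (x := w)).const_mul (2 * κ : ℂ)).mul_const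
    Complex.I).mul (hasDerivAt_Gam κ w))
  refine h.congr_deriv ?_
  simp [Gam2, Gam1]

/-- The family `TT (b Γ')`, expressed through the families `JJ`. -/
lemma TT_mul_Gam1 {ρ l : ℝ} (hρ : 0 < ρ) (hl : 0 < l) {b : ℝ → ℂ} (hb : TestFn b)
    (b0 : ∀ u, |u| < 1 / 2 → b u = 0) (v : ℝ) :
    TT M s ρ l (fun u => b u * Gam1 κ (u + v)) =
      1 * TT (MX M) s ρ l (fun u => dv b u * Gam κ (u + v)) +
        1 * TT M s ρ l (fun u => (1 * dv b u + -1 * dv (dZ b) u) * Gam κ (u + v)) :=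
  TT_mul_deriv hρ hl hb one_half_pos b0 (contDiff_Gam κ) (hasDerivAt_Gam κ) v

lemma GF.congr {n k : ℕ} {f g : ℝ → ℝ → ℝ → ℂ} (h : GF n k f)
    (e : ∀ ρ τ a, 1 ≤ ρ → g ρ τ a = f ρ τ a) : GF n k g := by
  have base : ∀ {f g : ℝ → ℝ → ℝ → ℂ}, G0 k f → (∀ ρ τ a, 1 ≤ ρ → g ρ τ a = f ρ τ a) →
      G0 k g := by
    rintro f g ⟨h1, C, hC, h2, h3⟩ e
    refine ⟨fun ρ hρ => ?_, C, hC, fun ρ τ a hρ => e ρ τ a hρ ▸ h2 ρ τ a hρ,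
      fun ρ ρ' τ a hρ hρ' => ?_⟩
    · simpa only [e ρ _ _ hρ] using h1 ρ hρ
    · rw [e ρ τ a hρ, e ρ' τ a (hρ.trans hρ')]
      exact h3 ρ ρ' τ a hρ hρ'
  induction n generalizing f g with
  | zero => exact base h e
  | succ n ih =>
    obtain ⟨h0, f1, f2, f3, k1, k2, k3, kd⟩ := h
    refine ⟨base h0 e, f1, f2, f3, k1, k2, k3, fun ρ τ a hρ => ?_⟩
    simpa only [e ρ _ _ hρ] using kd ρ τ a hρ

theorem JJ_GF (hs : |s| = 1) (hκ : κ ≠ 0) (hc : c₁ ≠ 0) (hM : Ker M) {b : ℝ → ℝ → ℂ}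
    (hb : ∀ n, Amp n b) (n : ℕ) : GF n 1 (JJ M s κ c₁ b) := by
  induction n generalizing M b with
  | zero => exact JJ_G0 hs hκ hc hM (hb 1)
  | succ n ih =>
    have hbd : ∀ {b : ℝ → ℝ → ℂ}, (∀ n, Amp n b) → ∀ n, Amp n (fun ρ => dZ (b ρ)) :=
      fun h n => (h (n + 1)).2
    have hq : ∀ {b : ℝ → ℝ → ℂ}, (∀ n, Amp n b) →
        ∀ n, Amp n (fun ρ u => 1 * dv (b ρ) u + -1 * dv (dZ (b ρ)) u) :=
      fun h n => (h n).dv.lin (hbd h n).dv 1 (-1)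
    have hP : ∀ {M : SchwartzMap (ℝ × ℝ) ℂ →L[ℂ] ℂ}, Ker M → ∀ {b : ℝ → ℝ → ℂ},
        (∀ n, Amp n b) → GF n 1 (fun ρ τ a => TT M s ρ (exp τ)
          (fun u => b ρ u * Gam1 κ (u + c₁ * a))) := by
      intro M hM b hb
      refine ((ih hM.MX fun n => (hb n).dv).lin (ih hM (hq hb)) 1 1).congr fun ρ τ a hρ => ?_
      exact TT_mul_Gam1 (one_pos.trans_le hρ) (exp_pos τ) ((hb 0).base.1 ρ hρ)
        (fun u => (hb 0).base.2.1 ρ u hρ) (c₁ * a)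
    have hP2 : GF n 1 (fun ρ τ a => TT M s ρ (exp τ)
          (fun u => b ρ u * Gam2 κ (u + c₁ * a))) := by
      refine ((hP hM.MX fun n => (hb n).dv).lin (hP hM (hq hb)) 1 1).congr fun ρ τ a hρ => ?_
      exact TT_mul_deriv (one_pos.trans_le hρ) (exp_pos τ) ((hb 0).base.1 ρ hρ)
        one_half_pos (fun u => (hb 0).base.2.1 ρ u hρ) (contDiff_Gam1 κ) (hasDerivAt_Gam1 κ)
        (c₁ * a)
    refine ⟨JJ_G0 hs hκ hc hM (hb 1), _, _, _, (ih hM.MX hb).lin (ih hM.MY hb) 1 2,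
      (hP hM hb).lin (hP hM hb) c₁ 0,
      (hP2.lin (ih hM hb) (2 * Complex.I * κ)⁻¹ (-1)).lin
        ((ih hM.MX hb).lin (ih hM (hbd hb)) 1 (-1)) 1 (-1), fun ρ τ a hρ => ?_⟩
    have hρ0 := one_pos.trans_le hρ
    have hh := testFn_cut_mul_ch s hρ0
    have hbt := (hb 0).base.1 ρ hρ
    have hG := contDiff_Gam_shift (κ := κ) (c₁ * a)
    have hG1 : ContDiff ℝ (⊤ : ℕ∞) (fun u => Gam1 κ (u + c₁ * a)) :=
      (contDiff_Gam1 κ).comp (by fun_prop)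
    refine ⟨?_, ?_, ?_⟩
    · rw [one_mul]
      exact hasDerivAt_Tp_exp hh (hbt.mul_right hG) τ
    · have := hasDerivAt_Tp_right (M := M) (exp_pos τ) hh hbt
        (contDiff_Gam_uncurry (κ := κ) (c₁ := c₁)) (w' := fun p => c₁ * Gam1 κ (p.2 + c₁ * p.1)) (fun a u => ?_) a
      · refine this.congr_deriv ?_
        rw [zero_mul, add_zero, ← TT_smul hρ0 (exp_pos τ)
          (hbt.mul_right hG1)]
        simp only [TT]
        congr 1
        ext u
        ring
      · have h1 : HasDerivAt (fun a => u + c₁ * a) c₁ a := by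
          simpa using ((hasDerivAt_id a).const_mul c₁).const_add u
        refine (HasDerivAt.scomp a (h := fun a => u + c₁ * a)
          (hasDerivAt_Gam κ (u + c₁ * a)) h1).congr_deriv ?_
        simp [Gam1]
    · have hd : ∀ u, HasDerivAt (fun u => Gam κ (u + c₁ * a)) (Gam1 κ (u + c₁ * a)) u := fun u =>
        (hasDerivAt_Gam κ _).comp_add_const u _
      have e1 := TT_mul_dZ (M := M) (s := s) hρ0 (exp_pos τ) hbt hG hd
      have hG2 : ContDiff ℝ (⊤ : ℕ∞) (fun u => Gam2 κ (u + c₁ * a)) :=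
        (contDiff_Gam2 κ).comp (by fun_prop)
      have hu : ContDiff ℝ (⊤ : ℕ∞) (fun u : ℝ => (u : ℂ)) := contDiff_ofReal_comp contDiff_id
      simp only [JJ]
      rw [← e1, ← TT_lin hρ0 (exp_pos τ) (hbt.mul_right hG2) (hbt.mul_right hG),
        ← TT_lin hρ0 (exp_pos τ) (((hbt.mul_right hG2).smul _).add ((hbt.mul_right hG).smul _))
          (hbt.mul_right (hu.mul hG1)), zero_mul, add_zero, ← mul_assoc,
        ← TT_smul hρ0 (exp_pos τ) (hbt.mul_right hG1)]
      congr 1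
      ext u
      have hκ' : (κ : ℂ) ≠ 0 := by exact_mod_cast hκ
      simp only [Gam2, Gam1]
      push_cast
      field_simp
      ring_nf

end J

section Good

/-- Functions all of whose derivatives of the types `∂_τ`, `∂_a`, `a∂_a` are bounded. -/
def Good (f : ℝ → ℝ → ℂ) : Prop := ∀ n, GC n 0 f

/-- The derivative in the first variable. -/
def dT (f : ℝ → ℝ → ℂ) (τ a : ℝ) : ℂ := deriv (fun τ => f τ a) τ

/-- The derivative in the second variable. -/
def dA (f : ℝ → ℝ → ℂ) (τ : ℝ) : ℝ → ℂ := deriv (f τ)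

variable {f : ℝ → ℝ → ℂ}

lemma GC.derivs {n k : ℕ} (h : GC (n + 1) k f) : GC n k (dT f) ∧ GC n k (dA f) ∧
    GC n k (fun τ a => a * dA f τ a) ∧ ∀ τ a, HasDerivAt (fun τ => f τ a) (dT f τ a) τ ∧
      HasDerivAt (fun a => f τ a) (dA f τ a) a := by
  obtain ⟨-, f1, f2, f3, h1, h2, h3, hd⟩ := h
  have e1 : dT f = f1 := by ext τ a; exact (hd τ a).1.deriv
  have e2 : dA f = f2 := by ext τ a; exact (hd τ a).2.1.deriv
  have e3 : (fun τ a => a * dA f τ a) = f3 := by ext τ a; rw [e2]; exact (hd τ a).2.2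
  rw [e3, e1, e2]
  exact ⟨h1, h2, h3, fun τ a => ⟨(hd τ a).1, (hd τ a).2.1⟩⟩

lemma Good.dT (h : Good f) : Good (dT f) := fun n => (h (n + 1)).derivs.1

lemma Good.dA (h : Good f) : Good (dA f) := fun n => (h (n + 1)).derivs.2.1

lemma Good.mul_dA (h : Good f) : Good (fun τ a => a * _root_.dA f τ a) :=
  fun n => (h (n + 1)).derivs.2.2.1

lemma Good.hasDerivAt_left (h : Good f) (τ a : ℝ) :
    HasDerivAt (fun τ => f τ a) (_root_.dT f τ a) τ := ((h 1).derivs.2.2.2 τ a).1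

lemma Good.hasDerivAt_right (h : Good f) (τ a : ℝ) : HasDerivAt (f τ) (_root_.dA f τ a) a :=
  ((h 1).derivs.2.2.2 τ a).2

lemma Good.continuous (h : Good f) : Continuous (fun p : ℝ × ℝ => f p.1 p.2) := (h 0).1

lemma Good.bdd (h : Good f) : ∃ C, 0 ≤ C ∧ ∀ τ a, ‖f τ a‖ ≤ C := by
  obtain ⟨-, C, hC, hb⟩ := h 0
  exact ⟨C, hC, fun τ a => by simpa using hb τ a⟩

lemma Good.lin {g : ℝ → ℝ → ℂ} (hf : Good f) (hg : Good g) (c d : ℂ) :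
    Good (fun τ a => c * f τ a + d * g τ a) := fun n => (hf n).lin (hg n) c d

lemma Good.contDiff (h : Good f) : ContDiff ℝ (⊤ : ℕ∞) (fun p : ℝ × ℝ => f p.1 p.2) := by
  rw [contDiff_infty]
  intro n
  induction n generalizing f with
  | zero => exact contDiff_zero.2 h.continuous
  | succ n ih =>
    push_cast
    rw [contDiff_succ_iff_hasFDerivAt]
    refine ⟨fun p => (ContinuousLinearMap.toSpanSingleton ℝ (_root_.dT f p.1 p.2)).coprod
      (ContinuousLinearMap.toSpanSingleton ℝ (_root_.dA f p.1 p.2)), ?_, fun p => ?_⟩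
    · have e : (fun p : ℝ × ℝ => (ContinuousLinearMap.toSpanSingleton ℝ (_root_.dT f p.1 p.2)).coprod
          (ContinuousLinearMap.toSpanSingleton ℝ (_root_.dA f p.1 p.2))) = fun p =>
          (ContinuousLinearMap.fst ℝ ℝ ℝ).smulRight (_root_.dT f p.1 p.2) +
          (ContinuousLinearMap.snd ℝ ℝ ℝ).smulRight (_root_.dA f p.1 p.2) := by
        ext p <;> simp
      rw [e]
      exact (contDiff_const.smulRight (ih h.dT)).add (contDiff_const.smulRight (ih h.dA))
    · have hc1 : Continuous (fun p : ℝ × ℝ =>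
          ContinuousLinearMap.toSpanSingleton ℝ (_root_.dT f p.1 p.2)) := by
        have := (contDiff_const (c := ContinuousLinearMap.id ℝ ℝ)).smulRight
          (contDiff_zero.2 h.dT.continuous) (𝕜 := ℝ) (n := 0)
        refine this.continuous.congr fun p => ?_
        ext; simp
      have hc2 : Continuous (fun p : ℝ × ℝ =>
          ContinuousLinearMap.toSpanSingleton ℝ (_root_.dA f p.1 p.2)) := by
        have := (contDiff_const (c := ContinuousLinearMap.id ℝ ℝ)).smulRight
          (contDiff_zero.2 h.dA.continuous) (𝕜 := ℝ) (n := 0)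
        refine this.continuous.congr fun p => ?_
        ext; simp
      exact (hasStrictFDerivAt_uncurry_coprod (f := f)
        (f₁ := fun τ a => ContinuousLinearMap.toSpanSingleton ℝ (_root_.dT f τ a))
        (f₂ := fun τ a => ContinuousLinearMap.toSpanSingleton ℝ (_root_.dA f τ a))
        (Eventually.of_forall fun p => (h.hasDerivAt_left p.1 p.2).hasFDerivAt)
        (Eventually.of_forall fun p => (h.hasDerivAt_right p.1 p.2).hasFDerivAt)
        hc1.continuousAt hc2.continuousAt).hasFDerivAt

/-- The derivatives of `δ ↦ f (log δ) a`, multiplied by `δ ^ α`. -/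
def lops : ℕ → (ℝ → ℝ → ℂ) → ℝ → ℝ → ℂ
  | 0, f => f
  | α + 1, f => fun τ a => 1 * dT (lops α f) τ a + -α * lops α f τ a

lemma Good.lops (h : Good f) (α : ℕ) : Good (lops α f) := by
  induction α with
  | zero => exact h
  | succ α ih => exact ih.dT.lin ih 1 (-α)

lemma lops_mul (q : ℝ → ℂ) (α : ℕ) (f : ℝ → ℝ → ℂ) :
    lops α (fun τ a => q a * f τ a) = fun τ a => q a * lops α f τ a := by
  induction α with
  | zero => rfl
  | succ α ih =>
    ext τ a
    simp only [lops, ih]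
    rw [show dT (fun τ a => q a * lops α f τ a) τ a = q a * dT (lops α f) τ a from
      deriv_const_mul_field _]
    ring

lemma Good.iteratedDeriv_log (h : Good f) (a : ℝ) (α : ℕ) : ∀ δ, 0 < δ →
    iteratedDeriv α (fun δ => f (Real.log δ) a) δ =
      (((δ ^ α)⁻¹ : ℝ) : ℂ) * _root_.lops α f (Real.log δ) a := by
  induction α with
  | zero => intro δ hδ; simp [_root_.lops]
  | succ α ih =>
    intro δ hδ
    rw [iteratedDeriv_succ]
    have e : iteratedDeriv α (fun δ => f (Real.log δ) a) =ᶠ[𝓝 δ] fun δ =>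
        (((δ ^ α)⁻¹ : ℝ) : ℂ) * _root_.lops α f (Real.log δ) a := by
      filter_upwards [lt_mem_nhds hδ] with δ' hδ'
      exact ih δ' hδ'
    rw [e.deriv_eq]
    have h1 : HasDerivAt (fun δ : ℝ => (((δ ^ α)⁻¹ : ℝ) : ℂ)) _ δ :=
      ((hasDerivAt_pow α δ).inv (pow_pos hδ α).ne').ofReal_comp
    have h2 : HasDerivAt (fun δ => _root_.lops α f (Real.log δ) a) _ δ :=
      HasDerivAt.scomp δ (h := Real.log) ((h.lops α).hasDerivAt_left (Real.log δ) a)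
        (Real.hasDerivAt_log hδ.ne')
    have h3 := (h1.mul h2).deriv
    refine h3.trans ?_
    rw [_root_.lops, Complex.real_smul]
    have hδ' : (δ : ℂ) ≠ 0 := by exact_mod_cast hδ.ne'
    push_cast
    rcases α with _ | α
    · simp
    · rw [Nat.add_sub_cancel]
      field_simp
      push_cast
      ring

/-- Iterates of `a∂_a - j`, i.e. `a ^ β ∂_a ^ β`. -/
lemma Good.pow_mul_dA (h : Good f) (β : ℕ) : Good (fun τ a => (a : ℂ) ^ β * _root_.dA^[β] f τ a) ∧
    Good (_root_.dA^[β] f) := by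
  have hg : ∀ β, Good (_root_.dA^[β] f) := by
    intro β
    induction β with
    | zero => exact h
    | succ β ih => rw [Function.iterate_succ_apply']; exact ih.dA
  refine ⟨?_, hg β⟩
  induction β with
  | zero => simpa using h
  | succ β ih =>
    have h1 := ih.mul_dA.lin ih 1 (-β)
    convert h1 using 3 with τ a
    have h2 : HasDerivAt (fun a : ℝ => (a : ℂ) ^ β * _root_.dA^[β] f τ a) _ a :=
      ((Complex.ofRealCLM.hasDerivAt (x := a)).pow β).mul ((hg β).hasDerivAt_right τ a)
    rw [show _root_.dA (fun τ a => (a : ℂ) ^ β * _root_.dA^[β] f τ a) τ a = _ from h2.deriv,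
      Function.iterate_succ_apply']
    rcases β with _ | β
    · simp
    · simp only [Nat.add_sub_cancel, Pi.pow_apply, Complex.ofRealCLM_apply, Complex.ofReal_one, Nat.cast_add,
        Nat.cast_one]
      ring

lemma dA_iterate (β : ℕ) (f : ℝ → ℝ → ℂ) (τ : ℝ) : dA^[β] f τ = iteratedDeriv β (f τ) := by
  rw [iteratedDeriv_eq_iterate]
  induction β with
  | zero => rfl
  | succ β ih => rw [Function.iterate_succ_apply', Function.iterate_succ_apply', dA, ih]

lemma Good.exists_bound (h : Good f) (α β : ℕ) : ∃ C, 0 ≤ C ∧ ∀ τ a,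
    ‖_root_.lops α (_root_.dA^[β] f) τ a‖ * (1 + |a|) ^ β ≤ C := by
  obtain ⟨h1, h2⟩ := h.pow_mul_dA β
  obtain ⟨C1, hC1, b1⟩ := (h1.lops α).bdd
  obtain ⟨C2, hC2, b2⟩ := (h2.lops α).bdd
  rw [lops_mul (fun a => (a : ℂ) ^ β)] at b1
  refine ⟨2 ^ β * (C1 + C2), by positivity, fun τ a => ?_⟩
  have g1 := b1 τ a
  rw [norm_mul, norm_pow, Complex.norm_real, Real.norm_eq_abs] at g1
  have g2 := b2 τ a
  set X := ‖_root_.lops α (_root_.dA^[β] f) τ a‖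
  have hX : 0 ≤ X := norm_nonneg _
  have hp : (1 + |a|) ^ β ≤ 2 ^ β * (|a| ^ β + 1) := by
    rcases le_total |a| 1 with ha | ha
    · calc (1 + |a|) ^ β ≤ 2 ^ β := pow_le_pow_left₀ (by positivity) (by linarith) β
        _ ≤ _ := le_mul_of_one_le_right (by positivity) (by linarith [pow_nonneg (abs_nonneg a) β])
    · calc (1 + |a|) ^ β ≤ (2 * |a|) ^ β := pow_le_pow_left₀ (by positivity) (by linarith) β
        _ = 2 ^ β * |a| ^ β := mul_pow _ _ _
        _ ≤ _ := mul_le_mul_of_nonneg_left (by linarith) (by positivity)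
  calc X * (1 + |a|) ^ β ≤ X * (2 ^ β * (|a| ^ β + 1)) := mul_le_mul_of_nonneg_left hp hX
    _ = 2 ^ β * (|a| ^ β * X + X) := by ring
    _ ≤ _ := mul_le_mul_of_nonneg_left (add_le_add g1 g2) (by positivity)

/-- The function on `{η ≠ 0}` given in parabolic polar coordinates by `f`. -/
def polar (f : ℝ → ℝ → ℝ → ℂ) (ξ η : ℝ) : ℂ :=
  if η = 0 then 0 else f (SignType.sign η) (Real.log (√|η|)) (ξ / √|η|)

lemma polar_mul {f : ℝ → ℝ → ℝ → ℂ} {s δ a : ℝ} (hs : s = 1 ∨ s = -1) (hδ : 0 < δ) :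
    polar f (a * δ) (s * δ ^ 2) = f s (Real.log δ) a := by
  have hδ2 : 0 < δ ^ 2 := pow_pos hδ 2
  have h1 : |s| = 1 := by rcases hs with rfl | rfl <;> simp
  have h2 : √|s * δ ^ 2| = δ := by
    rw [abs_mul, h1, one_mul, abs_of_pos hδ2, Real.sqrt_sq hδ.le]
  have h0 : s * δ ^ 2 ≠ 0 := by
    rcases hs with rfl | rfl
    · simpa using hδ.ne'
    · simpa using hδ.ne'
  rw [polar, if_neg h0, h2, mul_div_assoc, div_self hδ.ne', mul_one]
  congr 1
  rcases hs with rfl | rfl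
  · rw [one_mul, sign_pos hδ2]; simp
  · rw [sign_neg (by linarith)]; simp

lemma contDiffOn_polar {f : ℝ → ℝ → ℝ → ℂ}
    (hf : ∀ s, s = 1 ∨ s = -1 → ContDiff ℝ (⊤ : ℕ∞) (fun p : ℝ × ℝ => f s p.1 p.2)) :
    ContDiffOn ℝ (⊤ : ℕ∞) (fun p : ℝ × ℝ => polar f p.1 p.2) {p | p.2 ≠ 0} := by
  intro p hp
  have hp' : p.2 ≠ 0 := hp
  refine ContDiffAt.contDiffWithinAt ?_
  have ha : ContDiffAt ℝ (⊤ : ℕ∞) (fun p : ℝ × ℝ => √|p.2|) p :=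
    ((contDiffAt_abs hp').comp p contDiffAt_snd).sqrt (abs_ne_zero.2 hp')
  have hs0 : √|p.2| ≠ 0 := (Real.sqrt_pos.2 (abs_pos.2 hp')).ne'
  have hs : ((SignType.sign p.2 : SignType) : ℝ) = 1 ∨ ((SignType.sign p.2 : SignType) : ℝ) = -1 := by
    rcases lt_or_gt_of_ne hp' with h | h
    · right; rw [sign_neg h]; simp
    · left; rw [sign_pos h]; simp
  have h1 : ContDiffAt ℝ (⊤ : ℕ∞) (fun q : ℝ × ℝ =>
      f (SignType.sign p.2) (Real.log (√|q.2|)) (q.1 / √|q.2|)) p :=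
    (hf _ hs).contDiffAt.comp p (f := fun q : ℝ × ℝ => (Real.log (√|q.2|), q.1 / √|q.2|))
      ((ha.log hs0).prodMk (contDiffAt_fst.div ha hs0))
  refine h1.congr_of_eventuallyEq ?_
  have hsg : ∀ᶠ q : ℝ × ℝ in 𝓝 p, SignType.sign q.2 = SignType.sign p.2 ∧ q.2 ≠ 0 := by
    have hc : ContinuousAt (fun q : ℝ × ℝ => q.2) p := continuousAt_snd
    rcases lt_or_gt_of_ne hp' with h | h
    · filter_upwards [hc.eventually (gt_mem_nhds h)] with q hq
      exact ⟨by rw [sign_neg hq, sign_neg h], hq.ne⟩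
    · filter_upwards [hc.eventually (lt_mem_nhds h)] with q hq
      exact ⟨by rw [sign_pos hq, sign_pos h], hq.ne'⟩
  filter_upwards [hsg] with q hq
  rw [polar, if_neg hq.2, hq.1]

theorem isFlagMultF1_polar {f : ℝ → ℝ → ℝ → ℂ} (hf : ∀ s, s = 1 ∨ s = -1 → Good (f s)) :
    ∃ B Cab, IsFlagMultF1 B Cab (polar f) := by
  obtain ⟨C1, hC1, b1⟩ := (hf 1 (Or.inl rfl)).bdd
  obtain ⟨C2, hC2, b2⟩ := (hf (-1) (Or.inr rfl)).bdd
  choose D1 hD1 d1 using (hf 1 (Or.inl rfl)).exists_bound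
  choose D2 hD2 d2 using (hf (-1) (Or.inr rfl)).exists_bound
  refine ⟨C1 + C2, fun α β => D1 α β + D2 α β, fun ξ η => ?_,
    contDiffOn_polar fun s hs => (hf s hs).contDiff, fun s hs α β δ hδ a => ?_⟩
  · rw [polar]
    split_ifs with h
    · rw [norm_zero]; positivity
    · rcases lt_or_gt_of_ne h with h | h
      · rw [sign_neg h]
        simpa using (b2 _ _).trans (by linarith)
      · rw [sign_pos h]
        simpa using (b1 _ _).trans (by linarith)
  · have hg := hf s hs
    have e : (fun δ' : ℝ => iteratedDeriv β (fun a' : ℝ => polar f (a' * δ') (s * δ' ^ 2)) a)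
        =ᶠ[𝓝 δ] fun δ' => dA^[β] (f s) (Real.log δ') a := by
      filter_upwards [lt_mem_nhds hδ] with δ' hδ'
      rw [dA_iterate]
      congr 1
      ext a'
      exact polar_mul hs hδ'
    rw [e.iteratedDeriv_eq, (hg.pow_mul_dA β).2.iteratedDeriv_log a α δ hδ, norm_mul,
      Complex.norm_real, Real.norm_of_nonneg (by positivity), Real.rpow_neg hδ.le,
      Real.rpow_natCast, Real.rpow_neg (by positivity), Real.rpow_natCast]
    have hb : ‖lops α (dA^[β] (f s)) (Real.log δ) a‖ * (1 + |a|) ^ β ≤ D1 α β + D2 α β := by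
      rcases hs with rfl | rfl
      · linarith [d1 α β (Real.log δ) a, hD2 α β]
      · linarith [d2 α β (Real.log δ) a, hD1 α β]
    rw [← div_eq_mul_inv _ ((1 + |a|) ^ β), le_div_iff₀ (by positivity)]
    calc (δ ^ α)⁻¹ * ‖lops α (dA^[β] (f s)) (Real.log δ) a‖ * (1 + |a|) ^ β
        = (δ ^ α)⁻¹ * (‖lops α (dA^[β] (f s)) (Real.log δ) a‖ * (1 + |a|) ^ β) := by ring
      _ ≤ (δ ^ α)⁻¹ * (D1 α β + D2 α β) := mul_le_mul_of_nonneg_left hb (by positivity)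
      _ = _ := mul_comm _ _

end Good

section CutAmp

/-- Smooth functions vanishing near zero and constant near infinity. -/
def OutAmp (p : ℝ → ℂ) : Prop :=
  ContDiff ℝ (⊤ : ℕ∞) p ∧ (∀ u, |u| < 1 / 2 → p u = 0) ∧ ∃ c : ℂ, TestFn (fun u => p u - c)

/-- Test functions constant near zero. -/
def InAmp (q : ℝ → ℂ) : Prop := TestFn q ∧ ∃ c : ℂ, ∀ u, |u| < 1 / 2 → q u = c

lemma dZ_eq_zero_of_const {f : ℝ → ℂ} {r : ℝ} {c : ℂ} (h : ∀ u, |u| < r → f u = c) (u : ℝ)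
    (hu : |u| < r) : dZ f u = 0 := by
  have : f =ᶠ[𝓝 u] fun _ => c := by
    filter_upwards [(isOpen_lt continuous_abs continuous_const).mem_nhds hu] with v hv
    exact h v hv
  rw [dZ, this.deriv_eq]; simp

lemma InAmp.dZ {q : ℝ → ℂ} (h : InAmp q) : InAmp (dZ q) := by
  obtain ⟨h1, c, hc⟩ := h
  exact ⟨h1.dZ, 0, dZ_eq_zero_of_const hc⟩

lemma OutAmp.hasDerivAt {p : ℝ → ℂ} (h : OutAmp p) (u : ℝ) : HasDerivAt p (deriv p u) u :=
  (h.1.differentiable (by simp) u).hasDerivAt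

lemma OutAmp.dZ {p : ℝ → ℂ} (h : OutAmp p) : OutAmp (dZ p) := by
  have hd := h.hasDerivAt
  obtain ⟨h1, h2, c, h3⟩ := h
  have e : _root_.dZ p = _root_.dZ (fun u => p u - c) := by
    ext u
    rw [_root_.dZ, _root_.dZ, deriv_sub_const]
  refine ⟨?_, dZ_eq_zero_of_const h2, 0, ?_⟩
  · rw [e]; exact h3.dZ.1
  · simpa only [e, sub_zero] using h3.dZ

lemma OutAmp.bdd {p : ℝ → ℂ} (h : OutAmp p) : ∃ C, 0 ≤ C ∧ ∀ u, ‖p u‖ ≤ C := by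
  obtain ⟨-, -, c, h3⟩ := h
  obtain ⟨D, hD⟩ := h3.exists_CB 0
  refine ⟨D + ‖c‖, add_nonneg hD.nonneg (norm_nonneg _), fun u => ?_⟩
  calc ‖p u‖ = ‖(p u - c) + c‖ := by rw [sub_add_cancel]
    _ ≤ _ := (norm_add_le _ _).trans (add_le_add (hD.norm_le u) le_rfl)

lemma testFn_comp_div {q : ℝ → ℂ} (hq : TestFn q) {R : ℝ} (hR : 0 < R) :
    TestFn (fun t => q (t / R)) := by
  have := hq.scale (inv_ne_zero hR.ne')
  simpa only [inv_mul_eq_div] using this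

lemma OutAmp.amp {p q : ℝ → ℂ} (hp : OutAmp p) (hq : InAmp q) (n : ℕ) :
    Amp n (fun ρ u => p u * q (u / ρ)) := by
  have base : ∀ {p q : ℝ → ℂ}, OutAmp p → InAmp q → Amp0 (fun ρ u => p u * q (u / ρ)) := by
    intro p q hp hq
    obtain ⟨C, hC, hb⟩ := hp.bdd
    obtain ⟨D, hD⟩ := hq.1.exists_CB 0
    obtain ⟨c, hc⟩ := hq.2
    refine ⟨fun ρ hρ => TestFn.mul_left hp.1 (testFn_comp_div hq.1 (one_pos.trans_le hρ)),
      fun ρ u hρ hu => ?_, fun ρ ρ' u hρ hρ' hu => ?_, C * D, mul_nonneg hC hD.nonneg,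
      fun ρ u hρ => ?_⟩
    · simp only [hp.2.1 u hu, zero_mul]
    · have : ∀ ρ', ρ ≤ ρ' → q (u / ρ') = c := by
        intro ρ' h
        have h0 : 0 < ρ' := by linarith
        refine hc _ ?_
        rw [abs_div, abs_of_pos h0, div_lt_iff₀ h0]
        linarith
      simp only [this ρ le_rfl, this ρ' hρ']
    · rw [norm_mul]
      exact mul_le_mul (hb u) (hD.norm_le _) (norm_nonneg _) hC
  induction n generalizing p q with
  | zero => exact base hp hq
  | succ n ih =>
    refine ⟨base hp hq, ((ih hp.dZ hq).lin (ih hp hq.dZ) 1 1).congr fun ρ hρ => ?_⟩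
    have hρ0 := one_pos.trans_le hρ
    ext u
    have h1 : HasDerivAt (fun u : ℝ => u / ρ) (1 / ρ) u := (hasDerivAt_id u).div_const ρ
    have h2 : HasDerivAt (fun u => q (u / ρ)) _ u :=
      HasDerivAt.scomp u (h := fun u : ℝ => u / ρ) (hq.1.hasDerivAt (u / ρ)) h1
    have h3 : deriv (fun u => p u * q (u / ρ)) u = _ := ((hp.hasDerivAt u).mul h2).deriv
    simp only [_root_.dZ, h3, Complex.real_smul]
    push_cast
    ring

lemma outAmp_one_sub_cut : OutAmp (fun u => 1 - cut u) := by
  refine ⟨contDiff_const.sub contDiff_cut, fun u hu => ?_, 1, ?_⟩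
  · simp only [cut_of_le hu.le, sub_self]
  · have := testFn_cut.smul (-1)
    convert this using 2 with u
    ring

lemma inAmp_cut : InAmp cut := ⟨testFn_cut, 1, fun _ hu => cut_of_le hu.le⟩

end CutAmp

section Decomposition

variable {M : SchwartzMap (ℝ × ℝ) ℂ →L[ℂ] ℂ} {c₀ : ℝ}

/-- The curvature of the phase on the half plane of sign `s`. -/
def kap (c₀ s : ℝ) : ℝ := -2 * π * s * c₀

/-- The truncated multiplier near the origin in the scaled variable. -/
def SM (M : SchwartzMap (ℝ × ℝ) ℂ →L[ℂ] ℂ) (c₀ s : ℝ) : ℝ → ℝ → ℝ → ℂ :=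
  SS M s (fun u => cut u * Gam (kap c₀ s) u)

/-- The truncated multiplier away from the origin in the scaled variable. -/
def JM (M : SchwartzMap (ℝ × ℝ) ℂ →L[ℂ] ℂ) (c₀ s : ℝ) : ℝ → ℝ → ℝ → ℂ :=
  JJ M s (kap c₀ s) (s / (2 * c₀)) (fun ρ u => (1 - cut u) * cut (u / ρ))

lemma SM_GF (hM : Ker M) {s : ℝ} (hs : |s| = 1) (n : ℕ) : GF n 0 (SM M c₀ s) :=
  SS_GF hs hM (testFn_cut.mul_right (contDiff_Gam _))
    (fun u hu => by rw [cut_of_ge hu.le, zero_mul]) n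

lemma JM_GF (hM : Ker M) (hc : 0 < c₀) {s : ℝ} (hs : |s| = 1) (n : ℕ) : GF n 1 (JM M c₀ s) := by
  have hs0 : s ≠ 0 := by rintro rfl; simp at hs
  have hk : kap c₀ s ≠ 0 := by
    rw [kap]
    have := Real.pi_pos.ne'
    have := hc.ne'
    simp [*]
  exact JJ_GF hs hk (div_ne_zero hs0 (by positivity)) hM (outAmp_one_sub_cut.amp inAmp_cut) n

theorem exists_limits (hM : Ker M) (hc : 0 < c₀) : ∃ S J : ℝ → ℝ → ℝ → ℂ, ∀ s, |s| = 1 →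
    Lim (SM M c₀ s) (S s) ∧ Lim (JM M c₀ s) (J s) ∧ (∀ n, GC n 0 (S s)) ∧ ∀ n, GC n 1 (J s) := by
  have h : ∀ s, ∃ S J : ℝ → ℝ → ℂ, |s| = 1 →
      Lim (SM M c₀ s) S ∧ Lim (JM M c₀ s) J ∧ (∀ n, GC n 0 S) ∧ ∀ n, GC n 1 J := by
    intro s
    by_cases hs : |s| = 1
    · obtain ⟨S, hS⟩ := (SM_GF (c₀ := c₀) hM hs 0).base.exists_lim
      obtain ⟨J, hJ⟩ := (JM_GF hM hc hs 0).base.exists_lim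
      exact ⟨S, J, fun _ => ⟨hS, hJ, fun n => (SM_GF hM hs n).lim hS,
        fun n => (JM_GF hM hc hs n).lim hJ⟩⟩
    · exact ⟨0, 0, fun h => (hs h).elim⟩
  choose S J h using h
  exact ⟨S, J, h⟩

/-- The full multiplier in parabolic polar coordinates. -/
def symm_polar (c₀ : ℝ) (S J : ℝ → ℝ → ℝ → ℂ) (s τ a : ℝ) : ℂ :=
  S s τ a + eI (π / (2 * c₀) * (s * a ^ 2)) * J s τ a

/-- The radial cut-off, as a function of the ratio `ξ⁴ / (ξ⁴ + η²)`. -/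
def phiCut (ξ η : ℝ) : ℝ := Real.smoothTransition (4 * (ξ ^ 4 / (ξ ^ 4 + η ^ 2)) - 2)

lemma contDiffOn_phiCut :
    ContDiffOn ℝ (⊤ : ℕ∞) (fun p : ℝ × ℝ => phiCut p.1 p.2) {p : ℝ × ℝ | p ≠ 0} := by
  have h : ∀ p ∈ {p : ℝ × ℝ | p ≠ 0}, p.1 ^ 4 + p.2 ^ 2 ≠ 0 := by
    intro p hp h0
    refine hp (Prod.ext ?_ ?_)
    · have : p.1 ^ 4 = 0 := by nlinarith [sq_nonneg p.2, sq_nonneg (p.1 ^ 2)]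
      exact pow_eq_zero_iff (by norm_num) |>.1 this
    · have : p.2 ^ 2 = 0 := by nlinarith [sq_nonneg p.2, sq_nonneg (p.1 ^ 2)]
      exact pow_eq_zero_iff (by norm_num) |>.1 this
  refine Real.smoothTransition.contDiff.comp_contDiffOn ?_
  have h1 : ContDiffOn ℝ (⊤ : ℕ∞) (fun p : ℝ × ℝ => p.1 ^ 4) {p : ℝ × ℝ | p ≠ 0} := by fun_prop
  have h2 : ContDiffOn ℝ (⊤ : ℕ∞) (fun p : ℝ × ℝ => p.1 ^ 4 + p.2 ^ 2) {p : ℝ × ℝ | p ≠ 0} := by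
    fun_prop
  exact (contDiffOn_const.mul (h1.div h2 h)).sub contDiffOn_const

lemma le_abs_of_phiCut_ne_zero {ξ η : ℝ} (h : phiCut ξ η ≠ 0) : √|η| ≤ |ξ| := by
  by_contra! hc
  refine h (Real.smoothTransition.zero_of_nonpos ?_)
  have h1 : ξ ^ 2 < |η| := by
    rw [← sq_abs, ← Real.sq_sqrt (abs_nonneg η)]
    exact pow_lt_pow_left₀ hc (abs_nonneg _) two_ne_zero
  have h2 : ξ ^ 4 < η ^ 2 := by
    rw [← sq_abs η, show ξ ^ 4 = (ξ ^ 2) ^ 2 by ring]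
    exact pow_lt_pow_left₀ h1 (sq_nonneg _) two_ne_zero
  have h3 : 0 ≤ ξ ^ 4 := by positivity
  have : ξ ^ 4 / (ξ ^ 4 + η ^ 2) ≤ 1 / 2 := by
    rw [div_le_iff₀ (by linarith)]; linarith
  linarith

lemma phiCut_polar {ξ η : ℝ} (hη : η ≠ 0) : phiCut ξ η = phiCut (ξ / √|η|) 1 := by
  have h0 : 0 < |η| := abs_pos.2 hη
  have h4 : √|η| ^ 4 = η ^ 2 := by
    rw [show √|η| ^ 4 = (√|η| ^ 2) ^ 2 by ring, Real.sq_sqrt h0.le, sq_abs]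
  have h5 : η ^ 2 ≠ 0 := pow_ne_zero 2 hη
  rw [phiCut, phiCut]
  congr 3
  rw [div_pow, h4, one_pow]
  field_simp

lemma testFn_one_sub_phiCut : TestFn (fun a : ℝ => ((1 - phiCut a 1 : ℝ) : ℂ)) := by
  constructor
  · have h : ContDiff ℝ (⊤ : ℕ∞) (fun a : ℝ => 1 - phiCut a 1) := by
      refine contDiff_const.sub ?_
      rw [← contDiffOn_univ]
      refine contDiffOn_phiCut.comp (s := Set.univ) (f := fun a : ℝ => (a, (1 : ℝ))) ?_ ?_
      · exact (contDiff_id.prodMk contDiff_const).contDiffOn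
      · intro a _ h
        simpa using congrArg Prod.snd h
    exact Complex.ofRealCLM.contDiff.comp h
  · refine HasCompactSupport.intro (isCompact_Icc (a := -2) (b := 2)) fun a ha => ?_
    have ha2 : 2 < |a| := by
      by_contra! hc
      exact ha (abs_le.1 hc)
    have h1 : (4 : ℝ) < a ^ 2 := by
      rw [← sq_abs]; nlinarith
    have h4 : (3 : ℝ) ≤ a ^ 4 := by nlinarith
    have : 3 / 4 ≤ a ^ 4 / (a ^ 4 + 1 ^ 2) := by
      rw [le_div_iff₀ (by positivity)]; linarith
    rw [phiCut, Real.smoothTransition.one_of_one_le (by linarith), sub_self, Complex.ofReal_zero]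

/-- The multiplier decomposition in parabolic polar coordinates. -/
theorem symm_polar_decomposition {S J : ℝ → ℝ → ℝ → ℂ} (hS : ∀ s, |s| = 1 → ∀ n, GC n 0 (S s))
    (hJ : ∀ s, |s| = 1 → ∀ n, GC n 1 (J s)) (c₀ : ℝ) :
    Measurable (fun p : ℝ × ℝ => polar (symm_polar c₀ S J) p.1 p.2) ∧
    (∃ B, 0 ≤ B ∧ ∀ ξ η, ‖polar (symm_polar c₀ S J) ξ η‖ ≤ B) ∧
    ContDiffOn ℝ (⊤ : ℕ∞) (fun p : ℝ × ℝ => polar (symm_polar c₀ S J) p.1 p.2) {p | p.2 ≠ 0} ∧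
    ∃ (B₁ B₂ : ℝ) (D₁ D₂ : ℕ → ℕ → ℝ) (L₁ L₂ : ℝ → ℝ → ℂ),
      IsFlagMultF1 B₁ D₁ L₁ ∧ IsFlagMultF1 B₂ D₂ L₂ ∧ ∀ ξ η, η ≠ 0 → ξ ≠ 0 →
        polar (symm_polar c₀ S J) ξ η = L₁ ξ η + (phiCut ξ η : ℂ) *
          eI (π / (2 * c₀) * ξ ^ 2 / η) * ((|η| ^ ((1:ℝ)/2) / ξ : ℝ) : ℂ) * L₂ ξ η := by
  have habs : ∀ {s : ℝ}, s = 1 ∨ s = -1 → |s| = 1 := by rintro s (rfl | rfl) <;> simp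
  have hSG : ∀ s, s = 1 ∨ s = -1 → Good (S s) := fun s hs => hS s (habs hs)
  have hJG : ∀ s, s = 1 ∨ s = -1 → Good (J s) := fun s hs n => (hJ s (habs hs) n).weaken
  have he : ∀ s : ℝ, ContDiff ℝ (⊤ : ℕ∞) (fun a : ℝ => eI (π / (2 * c₀) * (s * a ^ 2))) :=
    fun s => ContDiff.eI (by fun_prop)
  have hsm := contDiffOn_polar (f := symm_polar c₀ S J) fun s hs =>
    (hSG s hs).contDiff.add (((he s).comp contDiff_snd).mul (hJG s hs).contDiff)
  refine ⟨?_, ?_, hsm, ?_⟩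
  · classical
    have hset : MeasurableSet {p : ℝ × ℝ | p.2 ≠ 0} :=
      (isOpen_ne_fun continuous_snd continuous_const).measurableSet
    have := hsm.continuousOn.measurable_piecewise
      (continuousOn_const (c := (0 : ℂ)) (s := {p : ℝ × ℝ | p.2 ≠ 0}ᶜ)) hset
    convert this using 1
    ext p
    by_cases hp : p.2 = 0
    · simp [Set.piecewise, polar, hp]
    · simp [Set.piecewise, hp]
  · obtain ⟨C1, hC1, b1⟩ := (hSG 1 (Or.inl rfl)).bdd
    obtain ⟨C2, hC2, b2⟩ := (hSG (-1) (Or.inr rfl)).bdd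
    obtain ⟨C3, hC3, b3⟩ := (hJG 1 (Or.inl rfl)).bdd
    obtain ⟨C4, hC4, b4⟩ := (hJG (-1) (Or.inr rfl)).bdd
    refine ⟨C1 + C2 + C3 + C4, by positivity, fun ξ η => ?_⟩
    rw [polar]
    split_ifs with h
    · rw [norm_zero]; positivity
    · refine (norm_add_le _ _).trans ?_
      rw [norm_mul, norm_eI, one_mul]
      rcases lt_or_gt_of_ne h with h | h
      · rw [sign_neg h]
        simp only [SignType.coe_neg_one]
        linarith [b2 (Real.log (√|η|)) (ξ / √|η|), b4 (Real.log (√|η|)) (ξ / √|η|)]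
      · rw [sign_pos h]
        simp only [SignType.coe_one]
        linarith [b1 (Real.log (√|η|)) (ξ / √|η|), b3 (Real.log (√|η|)) (ξ / √|η|)]
  · have h1 : ∀ s, s = 1 ∨ s = -1 → Good (fun τ a => S s τ a +
        ((1 - phiCut a 1 : ℝ) : ℂ) * eI (π / (2 * c₀) * (s * a ^ 2)) * J s τ a) := by
      intro s hs n
      exact (hS s (habs hs) n).add ((hJ s (habs hs) n).weaken.test_mul
        (testFn_one_sub_phiCut.mul_right (he s)))
    have h2 : ∀ s, s = 1 ∨ s = -1 → Good (fun τ a => (a : ℂ) * J s τ a) := by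
      intro s hs n
      exact (hJ s (habs hs) n).coord_mul
    obtain ⟨B₁, D₁, hL1⟩ := isFlagMultF1_polar (f := fun s τ a => S s τ a +
        ((1 - phiCut a 1 : ℝ) : ℂ) * eI (π / (2 * c₀) * (s * a ^ 2)) * J s τ a) h1
    obtain ⟨B₂, D₂, hL2⟩ := isFlagMultF1_polar (f := fun s τ a => (a : ℂ) * J s τ a) h2
    refine ⟨B₁, B₂, D₁, D₂, _, _, hL1, hL2, fun ξ η hη hξ => ?_⟩
    have hη0 : 0 < √|η| := Real.sqrt_pos.2 (abs_pos.2 hη)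
    rw [← Real.sqrt_eq_rpow, polar, polar, polar, if_neg hη, if_neg hη, if_neg hη, symm_polar,
      phiCut_polar hη]
    have hph : π / (2 * c₀) * ξ ^ 2 / η =
        π / (2 * c₀) * ((SignType.sign η : ℝ) * (ξ / √|η|) ^ 2) := by
      rw [div_pow, Real.sq_sqrt (abs_nonneg η), mul_div_assoc]
      congr 1
      rcases lt_or_gt_of_ne hη with h | h
      · rw [sign_neg h, abs_of_neg h]; simp [div_neg]
      · rw [sign_pos h, abs_of_pos h]; simp
    rw [hph]
    have hx : ((√|η| / ξ : ℝ) : ℂ) * ((ξ / √|η| : ℝ) : ℂ) = 1 := by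
      rw [← Complex.ofReal_mul]
      have : √|η| / ξ * (ξ / √|η|) = 1 := by field_simp
      rw [this, Complex.ofReal_one]
    set X := J (SignType.sign η) (Real.log √|η|) (ξ / √|η|)
    set E := eI (π / (2 * c₀) * ((SignType.sign η : ℝ) * (ξ / √|η|) ^ 2))
    rw [show ∀ P Y Z : ℂ, P * E * Y * (Z * X) = P * E * X * (Y * Z) from fun P Y Z => by ring, hx]
    push_cast
    ring

end Decomposition

section UniformAmplitudes

lemma exists_CN_cut_mul_ch_four (N : ℕ) : ∃ D, 0 < D ∧ ∀ s, |s| ≤ 4 →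
    CN N D (fun t => cut t * ch s t) := by
  obtain ⟨D, hD, h⟩ := exists_CN_cut N
  obtain ⟨E, hE, h'⟩ := exists_CB_ch N
  have h2 := h'.mul h'
  have h4 := h2.mul h2
  have hpos : 0 < 2 ^ N * (D * (2 ^ N * (2 ^ N * (E * E) * (2 ^ N * (E * E))))) := by positivity
  refine ⟨_, hpos, fun s hs => ?_⟩
  have hs4 : |s / 4| ≤ 1 := by
    rw [abs_div, abs_of_pos (by norm_num : (0 : ℝ) < 4)]
    linarith
  convert h.mul (h4.scale hs4) using 2 with t
  congr 1
  simp only [ch, ← eI_add]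
  congr 1
  ring

lemma exists_CN_cut_mul_Gam (c : ℝ) (N : ℕ) : ∃ D, 0 < D ∧ ∀ σ, |σ| ≤ 4 →
    CN N D (fun u => cut u * Gam (-2 * π * c * σ) u) := by
  have hG : ∀ e : ℝ, ∃ D, CB N D (fun w => cut (w / 2) * Gam (-8 * π * c * e) w) := fun e =>
    ((testFn_cut_div two_pos).mul_right (contDiff_Gam _)).exists_CB N
  obtain ⟨D, hD, h⟩ := exists_CN_cut N
  obtain ⟨E1, h1⟩ := hG 1
  obtain ⟨E2, h2⟩ := hG (-1)
  have hE : 0 ≤ max E1 E2 := h1.nonneg.trans (le_max_left _ _)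
  refine ⟨2 ^ N * (D * (max E1 E2 + 1)), by positivity, fun σ hσ => ?_⟩
  have key : ∀ e E : ℝ, CB N E (fun w => cut (w / 2) * Gam (-8 * π * c * e) w) →
      E ≤ max E1 E2 → e * |σ| = σ →
      CN N (2 ^ N * (D * (max E1 E2 + 1))) (fun u => cut u * Gam (-2 * π * c * σ) u) := by
    intro e E hE hle he
    have hl0 := Real.sqrt_nonneg (|σ| / 4)
    have hl2 : √(|σ| / 4) ^ 2 = |σ| / 4 := Real.sq_sqrt (by positivity)
    have hl : |√(|σ| / 4)| ≤ 1 := by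
      rw [abs_of_nonneg hl0]
      exact Real.sqrt_le_one.2 (by linarith)
    have := h.mul ((hE.mono le_rfl (hle.trans (le_add_of_nonneg_right zero_le_one))).scale hl)
    convert this using 2 with u
    by_cases hu : 1 ≤ |u|
    · rw [cut_of_ge hu, zero_mul, zero_mul]
    · have hw : |√(|σ| / 4) * u| ≤ 2 / 2 := by
        rw [abs_mul]
        nlinarith [abs_nonneg u, abs_nonneg √(|σ| / 4)]
      rw [cut_div_of_le two_pos hw, one_mul, Gam, Gam]
      congr 2
      rw [mul_pow, hl2]
      linear_combination (-2 * π * c * u ^ 2) * he.symm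
  rcases le_total 0 σ with h0 | h0
  · exact key 1 E1 h1 (le_max_left _ _) (by rw [abs_of_nonneg h0, one_mul])
  · exact key (-1) E2 h2 (le_max_right _ _) (by rw [abs_of_nonpos h0]; ring)

end UniformAmplitudes

section TruncatedMultiplier

variable {M : SchwartzMap (ℝ × ℝ) ℂ →L[ℂ] ℂ} {c₀ : ℝ}

/-- The sheared exponential at the frequency `q`. -/
def shearExp (c₀ : ℝ) (q p : ℝ × ℝ) : ℂ :=
  eI (-2 * π * (p.1 * q.1 + (p.2 + c₀ * p.1 ^ 2) * q.2))

/-- The parabolic cut-off at scale `R`. -/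
def cutR (R : ℝ) (p : ℝ × ℝ) : ℂ := cut (p.1 / R) * cut (p.2 / R ^ 2)

lemma testFn_cutR {R : ℝ} (hR : 0 < R) : TestFn (cutR R) :=
  (testFn_cut_div hR).tensor (testFn_cut_div (pow_pos hR 2))

/-- The multiplier of the sheared distribution, truncated at scale `R`. -/
def mR (M : SchwartzMap (ℝ × ℝ) ℂ →L[ℂ] ℂ) (c₀ R : ℝ) (q : ℝ × ℝ) : ℂ :=
  ap M (fun p => cutR R p * shearExp c₀ q p)

lemma contDiff_shearExp :
    ContDiff ℝ (⊤ : ℕ∞) (fun z : (ℝ × ℝ) × (ℝ × ℝ) => shearExp c₀ z.1 z.2) :=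
  ContDiff.eI (by fun_prop)

lemma continuous_mR {R : ℝ} (hR : 0 < R) : Continuous (mR M c₀ R) := by
  refine ap_continuous M (Ψ := fun z : (ℝ × ℝ) × (ℝ × ℝ) => cutR R z.2 * shearExp c₀ z.1 z.2) ?_ ?_
  · exact ((testFn_cutR hR).1.comp contDiff_snd).mul contDiff_shearExp
  · intro _
    refine ⟨tsupport (cutR R), (testFn_cutR hR).2, fun p _ x hx => ?_⟩
    simp only [image_eq_zero_of_notMem_tsupport hx, zero_mul]

lemma mR_eq_Tp {R : ℝ} (hR : 0 < R) (q : ℝ × ℝ) :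
    mR M c₀ R q = Tp M (1 / R) (fun t => cut t * ch (q.2 * R ^ 2) t)
      (fun u => cut u * Gam (-2 * π * c₀ * (q.2 * R ^ 2)) u * ch (q.1 * R) u) := by
  rw [mR, Tp]
  congr 1
  ext p
  have e : shearExp c₀ q p = Gam (-2 * π * c₀ * (q.2 * R ^ 2)) (1 / R * p.1) *
      ch (q.1 * R) (1 / R * p.1) * ch (q.2 * R ^ 2) ((1 / R) ^ 2 * p.2) := by
    rw [shearExp, Gam, ch, ch, ← eI_add, ← eI_add]
    congr 1
    field_simp
    ring
  rw [e, cutR, show p.1 / R = 1 / R * p.1 by ring, show p.2 / R ^ 2 = (1 / R) ^ 2 * p.2 by ring]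
  ring

lemma mR_eq_TT {R δ s a : ℝ} (hR : 0 < R) (hδ : 0 < δ) :
    mR M c₀ R (a * δ, s * δ ^ 2) = TT M s (R * δ) δ
      (fun u => cut (u / (R * δ)) * (ch a u * Gam (kap c₀ s) u)) := by
  rw [mR, TT, Tp]
  congr 1
  ext p
  have e : shearExp c₀ (a * δ, s * δ ^ 2) p = ch a (δ * p.1) * Gam (kap c₀ s) (δ * p.1) *
      ch s (δ ^ 2 * p.2) := by
    rw [shearExp, Gam, ch, ch, kap, ← eI_add, ← eI_add]
    congr 1
    ring
  rw [e, cutR, show δ * p.1 / (R * δ) = p.1 / R by field_simp,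
    show δ ^ 2 * p.2 / (R * δ) ^ 2 = p.2 / R ^ 2 by field_simp]
  ring

lemma exists_norm_mR_le_low (hM : Ker M) (c₀ : ℝ) : ∃ C, 0 ≤ C ∧ ∀ R q, 0 < R →
    |q.2 * R ^ 2| ≤ 4 → ‖mR M c₀ R q‖ ≤ C := by
  obtain ⟨N, A, hA, hb⟩ := hM.exists_CZ1_bump
  obtain ⟨C, hC, hch⟩ := CZ1.exists_norm_mul_ch_le N
  obtain ⟨D, hD, h1⟩ := exists_CN_cut_mul_ch_four N
  obtain ⟨E, hE, h2⟩ := exists_CN_cut_mul_Gam c₀ (N + 1)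
  refine ⟨D * E * (C * A), by positivity, fun R q hR hq => ?_⟩
  have hl : 0 < 1 / R := by positivity
  have b1 := h1 _ hq
  have b2 := h2 _ hq
  have key := hch A _ (hb (1 / R) _ hl (b1.normalize le_rfl hD)) _ (q.1 * R)
    (b2.normalize le_rfl hE)
  have ht := b1.testFn
  have hg : TestFn (fun u => cut u * Gam (-2 * π * c₀ * (q.2 * R ^ 2)) u * ch (q.1 * R) u) :=
    b2.testFn.mul_right (contDiff_ch _)
  have e : (fun u => ((E⁻¹ : ℝ) : ℂ) * (cut u * Gam (-2 * π * c₀ * (q.2 * R ^ 2)) u) *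
      ch (q.1 * R) u) = fun u => ((E⁻¹ : ℝ) : ℂ) *
        (cut u * Gam (-2 * π * c₀ * (q.2 * R ^ 2)) u * ch (q.1 * R) u) := by
    ext u; ring
  rw [e, Tp_smul_left hl ht (hg.smul _), Tp_smul_right hl ht hg, ← mR_eq_Tp hR, norm_mul, norm_mul,
    Complex.norm_real, Complex.norm_real, Real.norm_of_nonneg (inv_nonneg.2 hD.le),
    Real.norm_of_nonneg (inv_nonneg.2 hE.le), inv_mul_le_iff₀ hD, inv_mul_le_iff₀ hE] at key
  linarith

lemma mR_eq_SM_add_JM (hc : 0 < c₀) {R δ s a : ℝ} (hR : 0 < R) (hδ : 0 < δ) (hs : |s| = 1)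
    (hρ : 2 ≤ R * δ) : mR M c₀ R (a * δ, s * δ ^ 2) = SM M c₀ s (R * δ) (Real.log δ) a +
      eI (π / (2 * c₀) * (s * a ^ 2)) * JM M c₀ s (R * δ) (Real.log δ) a := by
  have hρ0 : 0 < R * δ := by positivity
  have hs2 : s ^ 2 = 1 := by rw [← sq_abs, hs, one_pow]
  have e : (fun u => cut (u / (R * δ)) * (ch a u * Gam (kap c₀ s) u)) = fun u =>
      1 * (cut u * Gam (kap c₀ s) u * ch a u) + eI (π / (2 * c₀) * (s * a ^ 2)) *
        ((1 - cut u) * cut (u / (R * δ)) * Gam (kap c₀ s) (u + s / (2 * c₀) * a)) := by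
    ext u
    have e1 : eI (π / (2 * c₀) * (s * a ^ 2)) * Gam (kap c₀ s) (u + s / (2 * c₀) * a) =
        ch a u * Gam (kap c₀ s) u := by
      rw [ch, Gam, Gam, ← eI_add, ← eI_add, kap]
      congr 1
      field_simp
      linear_combination (-(s * a ^ 2) - 4 * c₀ * a * u) * hs2
    have e2 : cut u = cut u * cut (u / (R * δ)) := by
      by_cases hu : 1 ≤ |u|
      · rw [cut_of_ge hu, zero_mul]
      · rw [cut_div_of_le hρ0 (by linarith), mul_one]
    linear_combination (ch a u * Gam (kap c₀ s) u) * (-e2) - (1 - cut u) * cut (u / (R * δ)) * e1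
  rw [mR_eq_TT hR hδ, e, TT_lin hρ0 hδ, one_mul, SM, SS, JM, JJ, Real.exp_log hδ]
  · exact (testFn_cut.mul_right (contDiff_Gam _)).mul_right (contDiff_ch _)
  · exact (TestFn.mul_left outAmp_one_sub_cut.1 (testFn_cut_div hρ0)).mul_right
      (contDiff_Gam_shift _)

lemma exists_polar_coords {η : ℝ} (hη : η ≠ 0) (ξ : ℝ) : ∃ s δ a, (s = 1 ∨ s = -1) ∧ 0 < δ ∧
    δ ^ 2 = |η| ∧ ξ = a * δ ∧ η = s * δ ^ 2 := by
  have h0 : 0 < |η| := abs_pos.2 hη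
  have h1 : 0 < √|η| := Real.sqrt_pos.2 h0
  have h2 : √|η| ^ 2 = |η| := Real.sq_sqrt h0.le
  rcases lt_or_gt_of_ne hη with h | h
  · refine ⟨-1, √|η|, ξ / √|η|, Or.inr rfl, h1, h2, (div_mul_cancel₀ _ h1.ne').symm, ?_⟩
    rw [h2, abs_of_neg h]; ring
  · refine ⟨1, √|η|, ξ / √|η|, Or.inl rfl, h1, h2, (div_mul_cancel₀ _ h1.ne').symm, ?_⟩
    rw [h2, abs_of_pos h]; ring

theorem exists_norm_mR_le (hM : Ker M) (hc : 0 < c₀) : ∃ C, 0 ≤ C ∧ ∀ R (q : ℝ × ℝ), 0 < R →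
    q.2 ≠ 0 → ‖mR M c₀ R q‖ ≤ C := by
  obtain ⟨C0, hC0, h0⟩ := exists_norm_mR_le_low hM c₀
  have hb : ∀ s : ℝ, ∃ C, 0 ≤ C ∧ (|s| = 1 → ∀ ρ τ a, 1 ≤ ρ →
      ‖SM M c₀ s ρ τ a‖ + ‖JM M c₀ s ρ τ a‖ ≤ C) := by
    intro s
    by_cases hs : |s| = 1
    · obtain ⟨-, C1, hC1, b1, -⟩ := (SM_GF (c₀ := c₀) hM hs 0).base
      obtain ⟨-, C2, hC2, b2, -⟩ := (JM_GF (c₀ := c₀) hM hc hs 0).base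
      refine ⟨C1 + C2, by positivity, fun _ ρ τ a hρ => add_le_add ?_ ?_⟩
      · simpa using b1 ρ τ a hρ
      · refine le_trans ?_ (b2 ρ τ a hρ)
        rw [pow_one]
        exact le_mul_of_one_le_right (norm_nonneg _) (le_add_of_nonneg_right (abs_nonneg _))
    · exact ⟨0, le_rfl, fun h => absurd h hs⟩
  obtain ⟨C1, hC1, h1⟩ := hb 1
  obtain ⟨C2, hC2, h2⟩ := hb (-1)
  refine ⟨C0 + C1 + C2, by positivity, fun R q hR hq => ?_⟩
  by_cases hlow : |q.2 * R ^ 2| ≤ 4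
  · linarith [h0 R q hR hlow]
  obtain ⟨s, δ, a, hs, hδ, hδ2, e1, e2⟩ := exists_polar_coords hq q.1
  have hρ : 2 ≤ R * δ := by
    rw [abs_mul, abs_of_pos (pow_pos hR 2), ← hδ2, not_le] at hlow
    nlinarith [mul_pos hR hδ]
  have hs1 : |s| = 1 := by rcases hs with rfl | rfl <;> simp
  have hq' : q = (a * δ, s * δ ^ 2) := Prod.ext e1 e2
  rw [hq', mR_eq_SM_add_JM hc hR hδ hs1 hρ]
  refine (norm_add_le _ _).trans ?_
  rw [norm_mul, norm_eI, one_mul]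
  rcases hs with rfl | rfl
  · linarith [h1 hs1 (R * δ) (Real.log δ) a (by linarith)]
  · linarith [h2 hs1 (R * δ) (Real.log δ) a (by linarith)]

theorem tendsto_mR (hM : Ker M) (hc : 0 < c₀) {S J : ℝ → ℝ → ℝ → ℂ}
    (hS : ∀ s, |s| = 1 → Lim (SM M c₀ s) (S s)) (hJ : ∀ s, |s| = 1 → Lim (JM M c₀ s) (J s))
    {q : ℝ × ℝ} (hq : q.2 ≠ 0) :
    Tendsto (fun R => mR M c₀ R q) atTop (𝓝 (polar (symm_polar c₀ S J) q.1 q.2)) := by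
  obtain ⟨s, δ, a, hs, hδ, -, e1, e2⟩ := exists_polar_coords hq q.1
  have hs1 : |s| = 1 := by rcases hs with rfl | rfl <;> simp
  have hq' : q = (a * δ, s * δ ^ 2) := Prod.ext e1 e2
  obtain ⟨C1, -, b1⟩ := (SM_GF (c₀ := c₀) hM hs1 0).base.norm_sub_le (hS s hs1)
  obtain ⟨C2, -, b2⟩ := (JM_GF (c₀ := c₀) hM hc hs1 0).base.norm_sub_le (hJ s hs1)
  have hρ : Tendsto (fun R => R * δ) atTop atTop := tendsto_id.atTop_mul_const hδ
  have hz : Tendsto (fun R => (C1 + C2) / (R * δ)) atTop (𝓝 0) := hρ.const_div_atTop _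
  rw [hq', polar_mul hs hδ, tendsto_iff_norm_sub_tendsto_zero]
  refine squeeze_zero' (Eventually.of_forall fun _ => norm_nonneg _) ?_ hz
  filter_upwards [hρ.eventually_ge_atTop 2, eventually_gt_atTop 0] with R hR hR0
  rw [mR_eq_SM_add_JM hc hR0 hδ hs1 hR, symm_polar, ← norm_neg, neg_sub, add_sub_add_comm,
    ← mul_sub, add_div]
  refine (norm_add_le _ _).trans ?_
  rw [norm_mul, norm_eI, one_mul]
  exact add_le_add (b1 _ _ _ (by linarith)) (b2 _ _ _ (by linarith))

end TruncatedMultiplier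

section ParametricIntegral

lemma TestFn.exists_eq_zero_of_le {E : Type*} [NormedAddCommGroup E] [NormedSpace ℝ E] {f : E → ℂ}
    (hf : TestFn f) : ∃ R : ℝ, 0 < R ∧ ∀ x, R ≤ ‖x‖ → f x = 0 := by
  obtain ⟨R, hR⟩ := hf.2.isCompact.isBounded.subset_closedBall 0
  refine ⟨|R| + 1, by positivity, fun x h => image_eq_zero_of_notMem_tsupport fun hm => ?_⟩
  have h1 : ‖x‖ ≤ R := by simpa using hR hm
  linarith [le_abs_self R]

lemma TestFn.integral {Q : Type*} [NormedAddCommGroup Q] [NormedSpace ℝ Q] {Ψ : ℝ × Q → ℂ}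
    (hΨ : TestFn Ψ) : TestFn (fun q => ∫ t, Ψ (t, q)) := by
  obtain ⟨R, hR, hz⟩ := hΨ.exists_eq_zero_of_le
  constructor
  · have h : ContDiff ℝ (⊤ : ℕ∞) (fun z : ℝ × Q => Ψ (-R + 2 * R * z.1, z.2)) :=
      hΨ.1.comp (by fun_prop)
    have h2 := (contDiff_const (c := ((2 * R : ℝ) : ℂ))).mul (contDiff_integral_param h)
    have e0 : (fun q => ∫ t, Ψ (t, q)) = fun q => ((2 * R : ℝ) : ℂ) *
        ∫ t in (0 : ℝ)..1, Ψ (-R + 2 * R * t, q) := by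
      ext q
      have e := intervalIntegral.smul_integral_comp_add_mul (a := 0) (b := 1)
        (f := fun t => Ψ (t, q)) (2 * R) (-R)
      rw [mul_zero, mul_one, add_zero, show -R + 2 * R = R by ring, Complex.real_smul] at e
      rw [e, intervalIntegral.integral_of_le (by linarith),
        setIntegral_eq_integral_of_forall_compl_eq_zero]
      intro t ht
      refine hz _ (le_trans ?_ (norm_fst_le (t, q)))
      by_contra hcon
      rw [not_le, Real.norm_eq_abs, abs_lt] at hcon
      exact ht ⟨hcon.1, hcon.2.le⟩
    rw [e0]
    exact h2
  · refine HasCompactSupport.intro (hΨ.2.isCompact.image continuous_snd) fun q hq => ?_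
    have : ∀ t, Ψ (t, q) = 0 := fun t =>
      image_eq_zero_of_notMem_tsupport fun hm => hq ⟨_, hm, rfl⟩
    simp only [this, integral_zero]

lemma TestFn.integrable {ψ : ℝ × ℝ → ℂ} (h : TestFn ψ) : Integrable ψ :=
  h.1.continuous.integrable_of_hasCompactSupport h.2

end ParametricIntegral

section Truncation

lemma exists_norm_iteratedFDeriv_cutR_le (l : ℕ) : ∃ C, 0 ≤ C ∧ ∀ R, 1 ≤ R → ∀ x,
    ‖iteratedFDeriv ℝ l (cutR R) x‖ ≤ C := by
  have h1 := testFn_cutR one_pos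
  obtain ⟨C, hC⟩ := (h1.1.continuous_iteratedFDeriv (m := l) (mod_cast le_top)).bounded_above_of_compact_support
    (h1.2.iteratedFDeriv l)
  refine ⟨C, (norm_nonneg _).trans (hC 0), fun R hR x => ?_⟩
  have hR0 : 0 < R := by linarith
  set L : ℝ × ℝ →L[ℝ] ℝ × ℝ := (R⁻¹ • ContinuousLinearMap.fst ℝ ℝ ℝ).prod
    ((R ^ 2)⁻¹ • ContinuousLinearMap.snd ℝ ℝ ℝ) with hL
  have hLn : ‖L‖ ≤ 1 := by
    refine ContinuousLinearMap.opNorm_le_bound _ zero_le_one fun p => ?_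
    have e : L p = (R⁻¹ * p.1, (R ^ 2)⁻¹ * p.2) := by simp [hL]
    rw [e, one_mul, Prod.norm_def, Prod.norm_def, norm_mul, norm_mul]
    refine max_le_max ?_ ?_
    · refine mul_le_of_le_one_left (norm_nonneg _) ?_
      rw [norm_inv, Real.norm_of_nonneg hR0.le]
      exact inv_le_one_of_one_le₀ hR
    · refine mul_le_of_le_one_left (norm_nonneg _) ?_
      rw [norm_inv, Real.norm_of_nonneg (by positivity)]
      exact inv_le_one_of_one_le₀ (one_le_pow₀ hR)
  have e : cutR R = cutR 1 ∘ L := by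
    ext p
    simp [hL, cutR, div_eq_inv_mul]
  rw [e, ContinuousLinearMap.iteratedFDeriv_comp_right _ h1.1 x (i := l) (mod_cast le_top)]
  refine (ContinuousMultilinearMap.norm_compContinuousLinearMap_le _ _).trans ?_
  refine (mul_le_of_le_one_right (norm_nonneg _) ?_).trans (hC _)
  exact Finset.prod_le_one (fun _ _ => norm_nonneg _) fun _ _ => hLn

lemma cutR_eq_one {R : ℝ} (hR : 1 ≤ R) {x : ℝ × ℝ} (hx : ‖x‖ ≤ R / 2) : cutR R x = 1 := by
  have h1 : |x.1| ≤ R / 2 := (norm_fst_le x).trans hx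
  have h2 : |x.2| ≤ R / 2 := (norm_snd_le x).trans hx
  rw [cutR, cut_div_of_le (by linarith) h1, cut_div_of_le (by positivity) (by nlinarith), mul_one]

theorem tendsto_cutR_mul {ψ : SchwartzMap (ℝ × ℝ) ℂ} {φ : ℕ → SchwartzMap (ℝ × ℝ) ℂ}
    (h : ∀ n p, φ n p = cutR (n + 1) p * ψ p) : Tendsto φ atTop (𝓝 ψ) := by
  refine ((schwartz_withSeminorms ℝ (ℝ × ℝ) ℂ).tendsto_nhds _ _).2 ?_
  rintro ⟨k, l⟩ ε hε
  choose C hC hCb using exists_norm_iteratedFDeriv_cutR_le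
  set B : ℝ := ∑ i ∈ Finset.range (l + 1), (l.choose i : ℝ) * C i *
    SchwartzMap.seminorm ℝ (k + 1) (l - i) ψ + SchwartzMap.seminorm ℝ (k + 1) l ψ with hB
  have hB0 : 0 ≤ B := by
    have : ∀ i, 0 ≤ C i := hC
    have : ∀ j, 0 ≤ SchwartzMap.seminorm ℝ (k + 1) j ψ := fun j => apply_nonneg _ _
    refine add_nonneg (Finset.sum_nonneg fun i _ => ?_) (this l)
    exact mul_nonneg (mul_nonneg (Nat.cast_nonneg _) (hC i)) (this _)
  have hlim : Tendsto (fun n : ℕ => 2 / ((n : ℝ) + 1) * B) atTop (𝓝 0) := by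
    have h1 : Tendsto (fun n : ℕ => 2 / ((n : ℝ) + 1)) atTop (𝓝 0) :=
      tendsto_const_div_atTop_nhds_zero_nat 2 |>.comp (tendsto_add_atTop_nat 1) |>.congr
        fun m => by simp
    simpa using h1.mul_const B
  filter_upwards [hlim.eventually (gt_mem_nhds hε)] with n hn
  refine lt_of_le_of_lt (SchwartzMap.seminorm_le_bound ℝ k l _ (by positivity) fun x => ?_) hn
  set R : ℝ := (n : ℝ) + 1 with hR
  have hR1 : 1 ≤ R := by rw [hR]; linarith [Nat.cast_nonneg (α := ℝ) n]
  have hR0 : 0 < R := by linarith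
  have hRHS : 0 ≤ 2 / R * B := by positivity
  have eφ : (φ n : ℝ × ℝ → ℂ) = fun p => cutR R p * ψ p := funext (h n)
  by_cases hx : ‖x‖ < R / 2
  · have : (⇑(φ n - ψ) : ℝ × ℝ → ℂ) =ᶠ[𝓝 x] fun _ => 0 := by
      filter_upwards [continuous_norm.continuousAt.eventually (gt_mem_nhds hx)] with y hy
      rw [sub_apply, h, cutR_eq_one hR1 hy.le, one_mul, sub_self]
    rw [(Filter.EventuallyEq.iteratedFDeriv ℝ this l).eq_of_nhds]
    simpa using hRHS
  · have hx' : R / 2 ≤ ‖x‖ := not_lt.1 hx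
    have e3 : iteratedFDeriv ℝ l (⇑(φ n - ψ)) x =
        iteratedFDeriv ℝ l (φ n) x - iteratedFDeriv ℝ l ψ x := by
      rw [← iteratedFDeriv_sub_apply]
      · rfl
      · exact ((φ n).smooth l).contDiffAt
      · exact (ψ.smooth l).contDiffAt
    have hs : ∀ j, ‖x‖ ^ (k + 1) * ‖iteratedFDeriv ℝ j ψ x‖ ≤
        SchwartzMap.seminorm ℝ (k + 1) j ψ := fun j => SchwartzMap.le_seminorm ℝ _ _ ψ x
    have e4 : ‖x‖ ^ (k + 1) * ‖iteratedFDeriv ℝ l (⇑(φ n - ψ)) x‖ ≤ B := by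
      rw [e3]
      refine (mul_le_mul_of_nonneg_left (norm_sub_le _ _) (by positivity)).trans ?_
      rw [mul_add, hB]
      refine add_le_add ?_ (hs l)
      rw [eφ]
      refine (mul_le_mul_of_nonneg_left (norm_iteratedFDeriv_mul_le
        (testFn_cutR hR0).1 (ψ.smooth (⊤ : ℕ∞)) x (mod_cast le_top)) (by positivity)).trans ?_
      rw [Finset.mul_sum]
      refine Finset.sum_le_sum fun i _ => ?_
      calc ‖x‖ ^ (k + 1) * ((l.choose i : ℝ) * ‖iteratedFDeriv ℝ i (cutR R) x‖ *
            ‖iteratedFDeriv ℝ (l - i) ψ x‖)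
          = (l.choose i : ℝ) * ‖iteratedFDeriv ℝ i (cutR R) x‖ *
            (‖x‖ ^ (k + 1) * ‖iteratedFDeriv ℝ (l - i) ψ x‖) := by ring
        _ ≤ _ := mul_le_mul (mul_le_mul_of_nonneg_left (hCb i R hR1 x) (Nat.cast_nonneg _))
          (hs _) (by positivity) (mul_nonneg (Nat.cast_nonneg _) (hC i))
    have e5 : ‖x‖ ^ k ≤ 2 / R * ‖x‖ ^ (k + 1) := by
      have : 1 ≤ 2 / R * ‖x‖ := by
        rw [div_mul_eq_mul_div, le_div_iff₀ hR0]; linarith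
      calc ‖x‖ ^ k ≤ (2 / R * ‖x‖) * ‖x‖ ^ k := le_mul_of_one_le_left (by positivity) this
        _ = _ := by ring
    calc _ ≤ 2 / R * ‖x‖ ^ (k + 1) * ‖iteratedFDeriv ℝ l (⇑(φ n - ψ)) x‖ :=
          mul_le_mul_of_nonneg_right e5 (norm_nonneg _)
      _ = 2 / R * (‖x‖ ^ (k + 1) * ‖iteratedFDeriv ℝ l (⇑(φ n - ψ)) x‖) := by ring
      _ ≤ _ := mul_le_mul_of_nonneg_left e4 (by positivity)

end Truncation

section SchwartzOperators

open FourierTransform in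
lemma exists_fourier_prod : ∃ F : SchwartzMap (ℝ × ℝ) ℂ →L[ℂ] SchwartzMap (ℝ × ℝ) ℂ, ∀ ψ p,
    F ψ p = ∫ q : ℝ × ℝ, eI (-2 * π * (p.1 * q.1 + p.2 * q.2)) * ψ q := by
  let e := Complex.equivRealProdCLM
  refine ⟨(SchwartzMap.compCLMOfContinuousLinearEquiv ℂ e.symm).comp
    ((fourierCLM ℂ (SchwartzMap ℂ ℂ)).comp (SchwartzMap.compCLMOfContinuousLinearEquiv ℂ e)),
    fun ψ p => ?_⟩
  simp only [ContinuousLinearMap.comp_apply, SchwartzMap.compCLMOfContinuousLinearEquiv_apply,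
    Function.comp_apply, fourierCLM_apply, SchwartzMap.fourier_coe]
  rw [Real.fourier_eq']
  rw [← Complex.volume_preserving_equiv_real_prod.integral_comp'
    (g := fun q : ℝ × ℝ => eI (-2 * π * (p.1 * q.1 + p.2 * q.2)) * ψ q)]
  congr 1
  ext z
  rw [smul_eq_mul, eI, mul_comm Complex.I, Complex.inner]
  congr 5
  simp [e]

lemma exists_shear (c : ℝ) : ∃ T : SchwartzMap (ℝ × ℝ) ℂ →L[ℂ] SchwartzMap (ℝ × ℝ) ℂ, ∀ ψ p,
    T ψ p = ψ (p.1, p.2 + c * p.1 ^ 2) := by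
  have h1 : Function.HasTemperateGrowth (fun p : ℝ × ℝ => p.1 ^ 2) :=
    (ContinuousLinearMap.fst ℝ ℝ ℝ).hasTemperateGrowth.pow 2
  have h2 : Function.HasTemperateGrowth (fun p : ℝ × ℝ => (p.1, p.2 + c * p.1 ^ 2)) := by
    have := Function.HasTemperateGrowth.id'.add
      ((c • ContinuousLinearMap.inr ℝ ℝ ℝ).hasTemperateGrowth.comp h1)
    convert this using 1
    ext p <;> simp
  refine ⟨SchwartzMap.compCLM ℂ h2 ⟨2, 1 + |c|, fun p => ?_⟩, fun ψ p => ?_⟩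
  · set q : ℝ × ℝ := (p.1, p.2 + c * p.1 ^ 2) with hq
    have a1 : |p.1| ≤ ‖q‖ := norm_fst_le q
    have a2 : |p.2 + c * p.1 ^ 2| ≤ ‖q‖ := norm_snd_le q
    have hn := norm_nonneg q
    have hc := abs_nonneg c
    rw [Prod.norm_def, max_le_iff, Real.norm_eq_abs, Real.norm_eq_abs]
    have a3 : |p.2| ≤ ‖q‖ + |c| * ‖q‖ ^ 2 := by
      have e : p.2 = (p.2 + c * p.1 ^ 2) - c * p.1 ^ 2 := by ring
      rw [e]
      refine (abs_sub _ _).trans (add_le_add a2 ?_)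
      rw [abs_mul, abs_pow]
      gcongr
    constructor <;> nlinarith [mul_nonneg hc hn, mul_nonneg hc (sq_nonneg ‖q‖), sq_nonneg ‖q‖]
  · rw [SchwartzMap.compCLM_apply]; rfl

end SchwartzOperators

section PairingIntegral

variable {M : SchwartzMap (ℝ × ℝ) ℂ →L[ℂ] ℂ} {c₀ : ℝ}

theorem ap_cutR_mul_integral {R : ℝ} (hR : 0 < R) {ψ : ℝ × ℝ → ℂ} (hψ : TestFn ψ) :
    ap M (fun p => cutR R p * ∫ q, shearExp c₀ q p * ψ q) = ∫ q, mR M c₀ R q * ψ q := by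
  set H : ℝ × (ℝ × (ℝ × ℝ)) → ℂ := fun z =>
    ψ (z.2.1, z.1) * (cutR R z.2.2 * shearExp c₀ (z.2.1, z.1) z.2.2) with hH
  have hHs : ContDiff ℝ (⊤ : ℕ∞) H := by
    refine (hψ.1.comp (by fun_prop)).mul (((testFn_cutR hR).1.comp (by fun_prop)).mul ?_)
    exact contDiff_shearExp.comp (f := fun z : ℝ × (ℝ × (ℝ × ℝ)) => ((z.2.1, z.1), z.2.2))
      (by fun_prop)
  obtain ⟨B1, hB1, b1⟩ := hψ.exists_eq_zero_of_le
  obtain ⟨B2, hB2, b2⟩ := (testFn_cutR hR).exists_eq_zero_of_le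
  have hz : ∀ t1 t2 x, B1 ≤ |t1| ∨ B1 ≤ |t2| ∨ B2 ≤ ‖x‖ → H (t2, t1, x) = 0 := by
    intro t1 t2 x h
    simp only [hH]
    rcases h with h | h | h
    · rw [b1 _ (h.trans (norm_fst_le (t1, t2))), zero_mul]
    · rw [b1 _ (h.trans (norm_snd_le (t1, t2))), zero_mul]
    · rw [b2 _ h, zero_mul, mul_zero]
  have hHt : TestFn H := by
    refine ⟨hHs, HasCompactSupport.intro (isCompact_closedBall 0 (max B1 B2)) ?_⟩
    rintro ⟨t2, t1, x⟩ h
    by_contra hc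
    have hn : |t1| < B1 ∧ |t2| < B1 ∧ ‖x‖ < B2 := by
      by_contra hcon
      refine hc (hz _ _ _ ?_)
      by_contra! h'
      exact hcon h'
    refine h ?_
    simp only [mem_closedBall_zero_iff, Prod.norm_def, max_le_iff, Real.norm_eq_abs] at hn ⊢
    refine ⟨hn.2.1.le.trans (le_max_left _ _), hn.1.le.trans (le_max_left _ _), ?_, ?_⟩
    · exact ((le_max_left _ _).trans hn.2.2.le).trans (le_max_right _ _)
    · exact ((le_max_right _ _).trans hn.2.2.le).trans (le_max_right _ _)
  have hsl : ∀ t1, TestFn (fun z : ℝ × (ℝ × ℝ) => H (z.1, t1, z.2)) := by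
    intro t1
    refine ⟨hHs.comp (by fun_prop), HasCompactSupport.intro
      (isCompact_closedBall 0 (max B1 B2)) ?_⟩
    rintro ⟨t2, x⟩ h
    by_contra hc
    have hn : |t2| < B1 ∧ ‖x‖ < B2 := by
      by_contra hcon
      refine hc (hz _ _ _ (Or.inr ?_))
      by_contra! h'
      exact hcon h'
    refine h ?_
    rw [mem_closedBall_zero_iff, Prod.norm_def, max_le_iff]
    exact ⟨hn.1.le.trans (le_max_left _ _), hn.2.le.trans (le_max_right _ _)⟩
  have h1 := ap_integral M hHt.integral
  have h2 : ∀ t1, ap M (fun x => ∫ t2, H (t2, t1, x)) = ∫ t2, mR M c₀ R (t1, t2) * ψ (t1, t2) := by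
    intro t1
    refine (ap_integral M (hsl t1)).trans ?_
    congr 1
    ext t2
    simp only [hH]
    have ht : TestFn (fun x => cutR R x * shearExp c₀ (t1, t2) x) :=
      (testFn_cutR hR).mul_right (contDiff_shearExp.comp
        (f := fun x : ℝ × ℝ => (((t1, t2) : ℝ × ℝ), x)) (by fun_prop))
    rw [ap_smul M _ ht, mul_comm, mR]
  have h3 : (fun p => cutR R p * ∫ q, shearExp c₀ q p * ψ q) =
      fun x => ∫ t1, ∫ t2, H (t2, t1, x) := by
    ext x
    have hi : TestFn (fun q => shearExp c₀ q x * ψ q) :=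
      TestFn.mul_left (contDiff_shearExp.comp (f := fun q : ℝ × ℝ => (q, x)) (by fun_prop)) hψ
    have hi' := hi.integrable
    rw [Measure.volume_eq_prod] at hi' ⊢
    rw [integral_prod _ hi', ← integral_const_mul]
    congr 1
    ext t1
    rw [← integral_const_mul]
    congr 1
    ext t2
    simp only [hH]
    ring
  have h4 : Integrable (fun q => mR M c₀ R q * ψ q) :=
    ((continuous_mR hR).mul hψ.1.continuous).integrable_of_hasCompactSupport hψ.2.mul_left
  rw [h3]
  refine h1.trans ?_
  rw [Measure.volume_eq_prod] at h4 ⊢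
  rw [integral_prod _ h4]
  simp only [h2]

end PairingIntegral

section MultiplierRepresentation

variable {M : SchwartzMap (ℝ × ℝ) ℂ →L[ℂ] ℂ} {c₀ : ℝ} {S J : ℝ → ℝ → ℝ → ℂ}

lemma ae_snd_ne_zero : ∀ᵐ q : ℝ × ℝ, q.2 ≠ 0 := by
  have h : ∀ᵐ y : ℝ, y ≠ 0 := by simp [ae_iff]
  exact Measure.quasiMeasurePreserving_snd.ae h

lemma norm_cutR_le (R : ℝ) (p : ℝ × ℝ) : ‖cutR R p‖ ≤ 1 := by
  rw [cutR, norm_mul]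
  exact mul_le_one₀ (norm_cut_le _) (norm_nonneg _) (norm_cut_le _)

lemma tendsto_cutR (p : ℝ × ℝ) : Tendsto (fun n : ℕ => cutR (n + 1) p) atTop (𝓝 1) := by
  refine tendsto_const_nhds.congr' ?_
  filter_upwards [(tendsto_natCast_atTop_atTop (R := ℝ)).eventually_ge_atTop (2 * ‖p‖)] with n hn
  rw [cutR_eq_one (by linarith [n.cast_nonneg (α := ℝ)]) (by linarith)]

lemma exists_cutR_mul (ψ : SchwartzMap (ℝ × ℝ) ℂ) : ∃ φ : ℕ → SchwartzMap (ℝ × ℝ) ℂ,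
    (∀ n p, φ n p = cutR (n + 1) p * ψ p) ∧ ∀ n, TestFn (fun p => φ n p) := by
  have h : ∀ n : ℕ, TestFn (fun p => cutR (n + 1) p * ψ p) := fun n =>
    (testFn_cutR n.cast_add_one_pos).mul_right (ψ.smooth (⊤ : ℕ∞))
  exact ⟨fun n => (h n).2.toSchwartzMap (h n).1, fun n p => rfl, h⟩

theorem shear_fourier_eq_integral_of_testFn (hM : Ker M) (hc : 0 < c₀)
    (hS : ∀ s, |s| = 1 → Lim (SM M c₀ s) (S s)) (hJ : ∀ s, |s| = 1 → Lim (JM M c₀ s) (J s))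
    {ψ : ℝ × ℝ → ℂ} (hψ : TestFn ψ) (θ : SchwartzMap (ℝ × ℝ) ℂ)
    (hθ : ∀ p, θ p = ∫ q, shearExp c₀ q p * ψ q) :
    M θ = ∫ q : ℝ × ℝ, polar (symm_polar c₀ S J) q.1 q.2 * ψ q := by
  obtain ⟨φ, hφ, hφt⟩ := exists_cutR_mul θ
  have h1 : Tendsto (fun n => M (φ n)) atTop (𝓝 (M θ)) :=
    (M.continuous.tendsto θ).comp (tendsto_cutR_mul hφ)
  have h2 : ∀ n : ℕ, M (φ n) = ∫ q, mR M c₀ (n + 1) q * ψ q := by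
    intro n
    rw [← ap_cutR_mul_integral n.cast_add_one_pos hψ, ← ap_coe M (φ n) (hφt n).2]
    congr 1
    ext p
    rw [hφ, hθ]
  obtain ⟨C, hC, hb⟩ := exists_norm_mR_le hM hc
  refine tendsto_nhds_unique h1 ?_
  simp only [h2]
  refine tendsto_integral_of_dominated_convergence (fun q => C * ‖ψ q‖)
    (fun n => ((continuous_mR n.cast_add_one_pos).mul hψ.1.continuous).aestronglyMeasurable)
    (hψ.integrable.norm.const_mul C) (fun n => ?_) ?_
  · filter_upwards [ae_snd_ne_zero] with q hq
    rw [norm_mul]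
    exact mul_le_mul_of_nonneg_right (hb _ q n.cast_add_one_pos hq) (norm_nonneg _)
  · filter_upwards [ae_snd_ne_zero] with q hq
    exact ((tendsto_mR hM hc hS hJ hq).comp
      (tendsto_atTop_add_const_right _ 1 tendsto_natCast_atTop_atTop)).mul_const _

theorem shear_fourier_eq_integral (hM : Ker M) (hc : 0 < c₀)
    (hS : ∀ s, |s| = 1 → Lim (SM M c₀ s) (S s)) (hJ : ∀ s, |s| = 1 → Lim (JM M c₀ s) (J s))
    (hm : Measurable (fun p : ℝ × ℝ => polar (symm_polar c₀ S J) p.1 p.2))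
    {B : ℝ} (hB : ∀ ξ η, ‖polar (symm_polar c₀ S J) ξ η‖ ≤ B)
    {K : SchwartzMap (ℝ × ℝ) ℂ →L[ℂ] ℂ}
    (hK : ∀ ψ ψ' : SchwartzMap (ℝ × ℝ) ℂ,
      (∀ p : ℝ × ℝ, ψ' p = ψ (p.1, p.2 + c₀ * p.1 ^ 2)) → K ψ = M ψ')
    (ψ ψ' : SchwartzMap (ℝ × ℝ) ℂ)
    (h : ∀ p : ℝ × ℝ, ψ' p = ∫ q : ℝ × ℝ, eI (-2 * π * (p.1 * q.1 + p.2 * q.2)) * ψ q) :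
    K ψ' = ∫ p : ℝ × ℝ, polar (symm_polar c₀ S J) p.1 p.2 * ψ p := by
  obtain ⟨𝓕, h𝓕⟩ := exists_fourier_prod
  obtain ⟨T, hT⟩ := exists_shear c₀
  obtain ⟨φ, hφ, hφt⟩ := exists_cutR_mul ψ
  have e : ψ' = 𝓕 ψ := by
    ext p
    rw [h, h𝓕]
  have h1 : Tendsto (fun n => K (𝓕 (φ n))) atTop (𝓝 (K ψ')) := by
    rw [e]
    exact ((K.comp 𝓕).continuous.tendsto ψ).comp (tendsto_cutR_mul hφ)
  have h2 : ∀ n : ℕ, K (𝓕 (φ n)) =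
      ∫ q : ℝ × ℝ, polar (symm_polar c₀ S J) q.1 q.2 * φ n q := by
    intro n
    rw [hK _ (T (𝓕 (φ n))) (hT _)]
    refine shear_fourier_eq_integral_of_testFn hM hc hS hJ (hφt n) _ fun p => ?_
    rw [hT, h𝓕]
    rfl
  refine tendsto_nhds_unique h1 ?_
  simp only [h2, hφ]
  refine tendsto_integral_of_dominated_convergence (fun q => B * ‖ψ q‖)
    (fun n => (hm.aestronglyMeasurable.mul
      ((testFn_cutR n.cast_add_one_pos).1.continuous.mul ψ.continuous).aestronglyMeasurable))
    (ψ.integrable.norm.const_mul B) (fun n => ?_) ?_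
  · refine Eventually.of_forall fun q => ?_
    rw [norm_mul, norm_mul]
    have := mul_le_of_le_one_left (norm_nonneg (ψ q)) (norm_cutR_le (n + 1) q)
    exact mul_le_mul (hB _ _) this (by positivity) ((norm_nonneg _).trans (hB q.1 q.2))
  · refine Eventually.of_forall fun q => ?_
    simpa using ((tendsto_cutR q).mul_const (ψ q)).const_mul
      (polar (symm_polar c₀ S J) q.1 q.2)

end MultiplierRepresentation

/-- Theorem 1.1 of the paper. Let `M` be a flat flag kernel with respect
to `F₁` and let `K` be the sheared distribution `⟨K, φ⟩ = ⟨M, (x,y) ↦ φ(x, y + c₀x²)⟩`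
(formally `K(x,y) = M(x, y - c₀x²)`). Then the Fourier transform of `K` is given by a
bounded measurable function `m`, `C^∞` away from `{η = 0}`, and there are constants
`c > 0`, `c'` with `c₀ c' = π/2`, flat flag multipliers `L₁, L₂` for `F₁`, and a smooth
cutoff `Φ` supported in `{|ξ| ≥ c |η|^{1/2}}`, with
`m(ξ,η) = L₁(ξ,η) + Φ(ξ,η) e^{i c' ξ²/η} (|η|^{1/2}/ξ) L₂(ξ,η)` for `ξ ≠ 0`, `η ≠ 0`. -/
theorem curved_flag_kernel_multiplier_decomposition
    (c₀ : ℝ) (hc₀ : 0 < c₀)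
    (Cab : ℕ → ℕ → ℝ) (Cd : ℕ → ℝ) (C : ℝ)
    (M : SchwartzMap (ℝ × ℝ) ℂ →L[ℂ] ℂ) (F : ℝ → ℝ → ℂ)
    (hM : IsFlagKernelF1 Cab Cd C M F)
    (K : SchwartzMap (ℝ × ℝ) ℂ →L[ℂ] ℂ)
    (hK : ∀ ψ ψ' : SchwartzMap (ℝ × ℝ) ℂ,
      (∀ p : ℝ × ℝ, ψ' p = ψ (p.1, p.2 + c₀ * p.1 ^ 2)) → K ψ = M ψ') :
    ∃ m : ℝ → ℝ → ℂ,
      Measurable (fun p : ℝ × ℝ => m p.1 p.2) ∧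
      (∃ B : ℝ, ∀ ξ η : ℝ, ‖m ξ η‖ ≤ B) ∧
      -- `m` represents the Fourier transform of `K`: `⟨𝓕K, ψ⟩ = ⟨K, 𝓕ψ⟩ = ∫ m ψ`
      (∀ ψ ψ' : SchwartzMap (ℝ × ℝ) ℂ,
        (∀ p : ℝ × ℝ, ψ' p = ∫ q : ℝ × ℝ, eI (-2 * π * (p.1 * q.1 + p.2 * q.2)) * ψ q) →
        K ψ' = ∫ p : ℝ × ℝ, m p.1 p.2 * ψ p) ∧
      ContDiffOn ℝ (⊤ : ℕ∞) (fun p : ℝ × ℝ => m p.1 p.2) {p : ℝ × ℝ | p.2 ≠ 0} ∧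
      ∃ c c' : ℝ, 0 < c ∧ c₀ * c' = π / 2 ∧
      ∃ (B₁ B₂ : ℝ) (D₁ D₂ : ℕ → ℕ → ℝ) (L₁ L₂ : ℝ → ℝ → ℂ) (Φ : ℝ → ℝ → ℝ),
        IsFlagMultF1 B₁ D₁ L₁ ∧ IsFlagMultF1 B₂ D₂ L₂ ∧
        ContDiffOn ℝ (⊤ : ℕ∞) (fun p : ℝ × ℝ => Φ p.1 p.2) {p : ℝ × ℝ | p ≠ 0} ∧
        (∀ ξ η : ℝ, Φ ξ η ≠ 0 → c * |η| ^ ((1:ℝ)/2) ≤ |ξ|) ∧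
        (∀ ξ η : ℝ, η ≠ 0 → ξ ≠ 0 →
          m ξ η = L₁ ξ η +
            (Φ ξ η : ℂ) * eI (c' * ξ ^ 2 / η) * ((|η| ^ ((1:ℝ)/2) / ξ : ℝ) : ℂ) * L₂ ξ η) := by
  obtain ⟨S, J, hSJ⟩ := exists_limits hM.ker hc₀
  obtain ⟨hm, ⟨B, -, hB⟩, hs, B₁, B₂, D₁, D₂, L₁, L₂, h₁, h₂, hL⟩ :=
    symm_polar_decomposition (fun s h => (hSJ s h).2.2.1) (fun s h => (hSJ s h).2.2.2) c₀
  refine ⟨polar (symm_polar c₀ S J), hm, ⟨B, hB⟩,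
    shear_fourier_eq_integral hM.ker hc₀ (fun s h => (hSJ s h).1) (fun s h => (hSJ s h).2.1)
      hm hB hK, hs, 1, π / (2 * c₀), one_pos, by field_simp, B₁, B₂, D₁, D₂, L₁, L₂, phiCut,
    h₁, h₂, contDiffOn_phiCut, fun ξ η h => ?_, hL⟩
  rw [one_mul, ← Real.sqrt_eq_rpow]
  exact le_abs_of_phiCut_ne_zero h
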